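/- arXiv:2108.08804 — 4 statements merged into one kernel-verified Lean document; each statement's English description precedes it below -/
import Mathlib

section
/- Let d ≥ 1, let 0 < α ≤ 1, and let F = {K_1, ..., K_n} be a family of n ≥ d+1 convex sets in ℝ^d. If the number of (d+1)-element subsets J of {1,...,n} for which ⋂_{i∈J} K_i is non-empty is at least α · C(n, d+1), then there is a subset I of {1,...,n} with |I| ≥ (1 - (1-α)^{1/(d+1)}) · n such that ⋂_{i∈I} K_i is non-empty. -/
open scoped Classical

/-- Skew Bollobás theorem (Frankl, Lovász), in a form with an ordering key. -/
theorem skew_bollobas {n d b : ℕ} {L : Type*} [LinearOrder L] (F : Finset (Finset (Fin n)))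
    (B : Finset (Fin n) → Finset (Fin n)) (key : Finset (Fin n) → L)
    (hF : ∀ S ∈ F, S.card = d) (hB : ∀ S ∈ F, (B S).card = b)
    (hdis : ∀ S ∈ F, Disjoint S (B S))
    (hskew : ∀ S ∈ F, ∀ S' ∈ F, S ≠ S' → Disjoint S (B S') → key S < key S') :
    F.card ≤ (b + d).choose d := by
  let P : Finset (Fin n) → Polynomial ℝ := fun S =>
    ∏ x ∈ S, (Polynomial.X - Polynomial.C ((x : ℕ) : ℝ))
  let Y : Finset (Fin n) → (Fin (d + 1) → ℝ) := fun S k => (P S).coeff k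
  let f : Finset (Fin n) → ((Fin (d + 1) → ℝ) → ℝ) := fun T y =>
    ∏ x ∈ T, ∑ k : Fin (d + 1), y k * ((x : ℕ) : ℝ) ^ (k : ℕ)
  have hPdeg : ∀ S ∈ F, (P S).natDegree < d + 1 := by
    intro S hS
    have : (P S).natDegree = S.card := by
      simp only [P]
      rw [Polynomial.natDegree_prod_of_monic _ _ (fun i _ => Polynomial.monic_X_sub_C _)]
      simp only [Polynomial.natDegree_X_sub_C, Finset.sum_const, smul_eq_mul, mul_one]
    rw [this, hF S hS]; omega
  have hfY : ∀ S ∈ F, ∀ T, f T (Y S) = ∏ x ∈ T, (P S).eval ((x : ℕ) : ℝ) := by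
    intro S hS T
    simp only [f, Y]
    refine Finset.prod_congr rfl fun x _ => ?_
    rw [Polynomial.eval_eq_sum_range' (hPdeg S hS), Finset.sum_range]
  have hne : ∀ S ∈ F, ∀ T, f T (Y S) ≠ 0 ↔ Disjoint S T := by
    intro S hS T
    rw [hfY S hS T, Finset.prod_ne_zero_iff, Finset.disjoint_right]
    refine forall₂_congr fun x _ => ?_
    simp only [P, Polynomial.eval_prod, Finset.prod_ne_zero_iff]
    simp only [Polynomial.eval_sub, Polynomial.eval_X, Polynomial.eval_C, ne_eq, sub_eq_zero,
      Nat.cast_inj, Fin.val_inj]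
    constructor
    · intro h hx; exact h x hx rfl
    · rintro h y hy rfl; exact h hy
  have hli : LinearIndependent ℝ (fun S : F => f (B S.1)) := by
    rw [Fintype.linearIndependent_iff]
    intro g hg
    by_contra hcon
    push Not at hcon
    obtain ⟨i0, hi0⟩ := hcon
    obtain ⟨S, hS, hmax⟩ := Finset.exists_max_image (Finset.univ.filter (fun i : F => g i ≠ 0))
      (fun i => key i.1) ⟨i0, by simpa using hi0⟩
    simp only [Finset.mem_filter, Finset.mem_univ, true_and] at hS hmax
    have h1 := congrFun hg (Y S.1)
    simp only [Finset.sum_apply, Pi.smul_apply, smul_eq_mul, Pi.zero_apply] at h1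
    rw [Finset.sum_eq_single S] at h1
    · rcases mul_eq_zero.1 h1 with h | h
      · exact hS h
      · exact (hne S.1 S.2 _).2 (hdis S.1 S.2) h
    · intro S' _ hne'
      by_contra h
      have h2 := left_ne_zero_of_mul h
      have h3 := right_ne_zero_of_mul h
      have h4 := hskew S.1 S.2 S'.1 S'.2 (fun e => hne' (Subtype.ext e.symm))
        ((hne S.1 S.2 _).1 h3)
      exact absurd (hmax S' h2) (not_le.2 h4)
    · simp
  let mon : Sym (Fin (d + 1)) b → ((Fin (d + 1) → ℝ) → ℝ) := fun s y =>
    ((s : Multiset (Fin (d + 1))).map y).prod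
  have hspan : ∀ T : Finset (Fin n), T.card = b →
      f T ∈ Submodule.span ℝ (Set.range mon) := by
    intro T hT
    have : f T = ∑ q ∈ Finset.pi T (fun _ => (Finset.univ : Finset (Fin (d + 1)))),
        (∏ x ∈ T.attach, ((x.1 : ℕ) : ℝ) ^ ((q x.1 x.2 : Fin (d+1)) : ℕ)) •
          (fun y : Fin (d + 1) → ℝ => ∏ x ∈ T.attach, y (q x.1 x.2)) := by
      funext y
      simp only [f, Finset.sum_apply, Pi.smul_apply, smul_eq_mul]
      rw [Finset.prod_sum]
      refine Finset.sum_congr rfl fun q _ => ?_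
      rw [Finset.prod_mul_distrib, mul_comm]
    rw [this]
    refine Submodule.sum_mem _ fun q _ => Submodule.smul_mem _ _ (Submodule.subset_span ?_)
    refine ⟨⟨T.attach.val.map (fun x => q x.1 x.2), by
      rw [Multiset.card_map, Finset.card_val, Finset.card_attach, hT]⟩, ?_⟩
    funext y
    simp [mon, Finset.prod, Multiset.map_map]
  have hfin := (Set.finite_range mon).toFinset
  have h1 : Fintype.card F ≤ (Set.range mon).finrank ℝ := by
    let W := Submodule.span ℝ (Set.range mon)
    have hliW : LinearIndependent ℝ (fun S : F => (⟨f (B S.1), hspan _ (hB S.1 S.2)⟩ : W)) := by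
      refine LinearIndependent.of_comp W.subtype ?_
      exact hli
    have : Module.Finite ℝ W := FiniteDimensional.span_of_finite ℝ (Set.finite_range mon)
    exact hliW.fintype_card_le_finrank
  have h2 := finrank_range_le_card (R := ℝ) mon
  have h3 : Fintype.card (Sym (Fin (d + 1)) b) = (b + d).choose d := by
    rw [Sym.card_sym_eq_choose]
    simp only [Fintype.card_fin]
    rw [show d + 1 + b - 1 = b + d by omega, ← Nat.choose_symm (by omega)]
    congr 1; omega
  rw [Fintype.card_coe] at h1
  omega

theorem choose_telescope (n d r : ℕ) (h : r ≤ n) :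
    ∑ k ∈ Finset.range r, (n - (k + 1)).choose d + (n - r).choose (d + 1) = n.choose (d + 1) := by
  induction r with
  | zero => simp
  | succ r ih =>
    rw [Finset.sum_range_succ, ← ih (by omega)]
    have : n - r = (n - (r + 1)) + 1 := by omega
    rw [this, Nat.choose_succ_succ']
    omega

theorem upper_bound_comb {n d r : ℕ} {L : Type*} [LinearOrder L] (hr : d + r ≤ n)
    (G F : Finset (Finset (Fin n)))
    (M : Finset (Fin n) → Finset (Fin n)) (key : Finset (Fin n) → L)
    (hG : ∀ J ∈ G, J.card = d + 1)
    (hF : ∀ S ∈ F, S.card = d) (hM : ∀ S ∈ F, (M S).card ≤ d + r)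
    (hsub : ∀ S ∈ F, S ⊆ M S)
    (hcov : ∀ J ∈ G, ∃ S ∈ F, S ⊆ J ∧ J ⊆ M S)
    (hskew : ∀ S ∈ F, ∀ S' ∈ F, S ≠ S' → S ⊆ M S' → key S < key S') :
    G.card + (n - r).choose (d + 1) ≤ n.choose (d + 1) := by
  have h1 : G.card ≤ ∑ S ∈ F, (M S \ S).card := by
    have : G ⊆ F.biUnion (fun S => (M S \ S).image (fun v => insert v S)) := by
      intro J hJ
      obtain ⟨S, hS, hSJ, hJM⟩ := hcov J hJ
      have hc : (J \ S).card = 1 := by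
        rw [Finset.card_sdiff_of_subset hSJ, hG J hJ, hF S hS]; omega
      obtain ⟨v, hv⟩ := Finset.card_eq_one.1 hc
      have hvm : v ∈ J \ S := by rw [hv]; simp
      rw [Finset.mem_sdiff] at hvm
      simp only [Finset.mem_biUnion, Finset.mem_image, Finset.mem_sdiff]
      refine ⟨S, hS, v, ⟨hJM hvm.1, hvm.2⟩, ?_⟩
      rw [← Finset.sdiff_union_of_subset hSJ, hv]; rfl
    refine (Finset.card_le_card this).trans (Finset.card_biUnion_le.trans ?_)
    exact Finset.sum_le_sum fun S _ => Finset.card_image_le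
  have h2 : ∑ S ∈ F, (M S \ S).card =
      ∑ k ∈ Finset.range r, (F.filter (fun S => d + (k + 1) ≤ (M S).card)).card := by
    simp_rw [Finset.card_filter]
    rw [Finset.sum_comm]
    refine Finset.sum_congr rfl fun S hS => ?_
    rw [← Finset.card_filter, Finset.card_sdiff_of_subset (hsub S hS), hF S hS]
    have : (Finset.range r).filter (fun k => d + (k + 1) ≤ (M S).card) =
        Finset.range ((M S).card - d) := by
      ext k
      have := hM S hS
      simp only [Finset.mem_filter, Finset.mem_range]
      omega
    rw [this, Finset.card_range]
  have h3 : ∀ k ∈ Finset.range r,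
      (F.filter (fun S => d + (k + 1) ≤ (M S).card)).card ≤ (n - (k + 1)).choose d := by
    intro k hk
    rw [Finset.mem_range] at hk
    have hex : ∀ S, ∃ T : Finset (Fin n), S ∈ F.filter (fun S => d + (k + 1) ≤ (M S).card) →
        S ⊆ T ∧ T ⊆ M S ∧ T.card = d + (k + 1) := by
      intro S
      by_cases hS : S ∈ F.filter (fun S => d + (k + 1) ≤ (M S).card)
      · rw [Finset.mem_filter] at hS
        obtain ⟨T, h⟩ := Finset.exists_subsuperset_card_eq (n := d + (k + 1)) (hsub S hS.1)
          (by rw [hF S hS.1]; omega) hS.2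
        exact ⟨T, fun _ => h⟩
      · exact ⟨∅, fun h => absurd h hS⟩
    choose T hT using hex
    have := skew_bollobas (d := d) (b := n - (d + (k + 1)))
      (F.filter (fun S => d + (k + 1) ≤ (M S).card)) (fun S => (T S)ᶜ) key
      (fun S hS => hF S (Finset.mem_filter.1 hS).1)
      (fun S hS => by rw [Finset.card_compl, (hT S hS).2.2, Fintype.card_fin])
      (fun S hS => by
        rw [disjoint_compl_right_iff]; exact (hT S hS).1)
      (fun S hS S' hS' hne hd => by
        refine hskew S (Finset.mem_filter.1 hS).1 S' (Finset.mem_filter.1 hS').1 hne ?_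
        rw [disjoint_compl_right_iff] at hd
        exact hd.trans (hT S' hS').2.1)
    rwa [show n - (d + (k + 1)) + d = n - (k + 1) by omega] at this
  have h4 := Finset.sum_le_sum h3
  have h5 := choose_telescope n d r (by omega)
  omega

theorem sum_lt_of_separated {n : ℕ} (S S' : Finset (Fin n)) (hc : S.card = S'.card) (hne : S ≠ S')
    (h : ∀ u ∈ S' \ S, ∀ v ∈ S \ S', u < v) :
    ∑ i ∈ S', ((i : ℕ) : ℤ) < ∑ i ∈ S, ((i : ℕ) : ℤ) := by
  have hc1 : (S \ S').card = (S' \ S).card := Finset.card_sdiff_comm hc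
  have hn1 : (S \ S').Nonempty := by
    rw [Finset.nonempty_iff_ne_empty]
    intro he
    rw [Finset.sdiff_eq_empty_iff_subset] at he
    exact hne (Finset.eq_of_subset_of_card_le he hc.ge)
  have hn2 : (S' \ S).Nonempty := by
    rw [← Finset.card_pos, ← hc1, Finset.card_pos]; exact hn1
  have e1 := Finset.sum_inter_add_sum_sdiff S S' (fun i => ((i : ℕ) : ℤ))
  have e2 := Finset.sum_inter_add_sum_sdiff S' S (fun i => ((i : ℕ) : ℤ))
  rw [Finset.inter_comm] at e2
  have hlt : ∑ i ∈ S' \ S, ((i : ℕ) : ℤ) < ∑ i ∈ S \ S', ((i : ℕ) : ℤ) := by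
    let a := (S \ S').min' hn1
    have ha : a ∈ S \ S' := Finset.min'_mem _ _
    calc ∑ i ∈ S' \ S, ((i : ℕ) : ℤ) < ∑ i ∈ S' \ S, ((a : ℕ) : ℤ) := by
          refine Finset.sum_lt_sum_of_nonempty hn2 fun u hu => ?_
          have := h u hu a ha
          exact_mod_cast this
      _ = ∑ i ∈ S \ S', ((a : ℕ) : ℤ) := by simp [hc1]
      _ ≤ _ := by
          refine Finset.sum_le_sum fun u hu => ?_
          have : a ≤ u := Finset.min'_le _ _ hu
          exact_mod_cast this
  linarith

theorem upper_bound_generic {n d r : ℕ} {E : Type*} [NormedAddCommGroup E] [InnerProductSpace ℝ E]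
    [FiniteDimensional ℝ E] (hr : d + r ≤ n) (K : Fin n → Set E)
    (hclosed : ∀ i, IsClosed (K i)) (hconv : ∀ i, Convex ℝ (K i))
    (Q : E → Finset (Fin n)) (hQ : ∀ p, (Q p).card ≤ d)
    (hnhds : ∀ p i, p ∈ K i → i ∉ Q p → K i ∈ nhds p)
    (hdim : ∀ I : Finset (Fin n), (⋂ i ∈ I, K i).Nonempty → I.card ≤ d + r) :
    (((Finset.univ : Finset (Fin n)).powersetCard (d + 1)).filter
        (fun J => (⋂ i ∈ J, K i).Nonempty)).card + (n - r).choose (d + 1) ≤ n.choose (d + 1) := by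
  have hex : ∀ J : Finset (Fin n), ∃ p : E, (⋂ i ∈ J, K i).Nonempty →
      (∀ i ∈ J, p ∈ K i) ∧ ∀ y, (∀ i ∈ J, y ∈ K i) → ‖p‖ ≤ ‖y‖ := by
    intro J
    by_cases hJ : (⋂ i ∈ J, K i).Nonempty
    · have hc : IsClosed (⋂ i ∈ J, K i) := isClosed_biInter fun i _ => hclosed i
      obtain ⟨p, hp, h⟩ := hc.exists_infDist_eq_dist hJ (0 : E)
      refine ⟨p, fun _ => ⟨by simpa using hp, fun y hy => ?_⟩⟩
      have hy' : y ∈ (⋂ i ∈ J, K i) := by simpa using hy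
      have := Metric.infDist_le_dist_of_mem (x := (0 : E)) hy'
      rw [h] at this
      simpa using this
    · exact ⟨0, fun h => absurd h hJ⟩
  choose p hp using hex
  have hne_of : ∀ (J : Finset (Fin n)) (y : E), (∀ i ∈ J, y ∈ K i) → (⋂ i ∈ J, K i).Nonempty :=
    fun J y hy => ⟨y, by simpa using hy⟩
  have hstab : ∀ J S : Finset (Fin n), (⋂ i ∈ J, K i).Nonempty → S ⊆ J → J ∩ Q (p J) ⊆ S →
      p S = p J := by
    intro J S hJ hSJ hT
    have hpJ := hp J hJ
    have hpS := hp S (hne_of S (p J) fun i hi => hpJ.1 i (hSJ hi))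
    have hle : ‖p S‖ ≤ ‖p J‖ := hpS.2 _ fun i hi => hpJ.1 i (hSJ hi)
    by_contra hne
    have hev : ∀ᶠ t : ℝ in nhdsWithin 0 (Set.Ioi 0),
        ∀ i ∈ J, i ∉ Q (p J) → (1 - t) • p J + t • p S ∈ K i := by
      rw [Filter.eventually_all_finset]
      intro i hi
      by_cases hq : i ∈ Q (p J)
      · exact Filter.Eventually.of_forall fun t h => absurd hq h
      · have hc : Filter.Tendsto (fun t : ℝ => (1 - t) • p J + t • p S) (nhdsWithin 0 (Set.Ioi 0))
            (nhds (p J)) := by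
          have : Continuous (fun t : ℝ => (1 - t) • p J + t • p S) := by fun_prop
          have h2 := this.tendsto 0
          simp only [sub_zero, one_smul, zero_smul, add_zero] at h2
          exact h2.mono_left nhdsWithin_le_nhds
        filter_upwards [hc (hnhds _ _ (hpJ.1 i hi) hq)] with t ht _ using ht
    have hlt : ∀ᶠ t : ℝ in nhdsWithin 0 (Set.Ioi 0), t ∈ Set.Ioo (0 : ℝ) 1 :=
      Ioo_mem_nhdsGT one_pos
    obtain ⟨t, ht1, ht2⟩ := (hev.and hlt).exists
    have h3 : ∀ i ∈ J, (1 - t) • p J + t • p S ∈ K i := by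
      intro i hi
      by_cases hq : i ∈ Q (p J)
      · exact hconv i (hpJ.1 i hi) (hpS.1 i (hT (Finset.mem_inter.2 ⟨hi, hq⟩)))
          (by linarith [ht2.2]) ht2.1.le (by ring)
      · exact ht1 i hi hq
    have h4 := hpJ.2 _ h3
    have h5 := norm_combo_lt_of_ne (le_refl ‖p J‖) hle (Ne.symm hne)
      (show 0 < 1 - t by linarith [ht2.2]) ht2.1 (by ring)
    linarith
  have huniq : ∀ (S : Finset (Fin n)) (y : E), (∀ i ∈ S, y ∈ K i) → ‖y‖ ≤ ‖p S‖ → y = p S := by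
    intro S y hy hle
    have hpS := hp S (hne_of S y hy)
    by_contra hne
    have h5 := norm_combo_lt_of_ne (le_refl ‖p S‖) hle (Ne.symm hne)
      (show (0 : ℝ) < 1 / 2 by norm_num) (show (0 : ℝ) < 1 / 2 by norm_num) (by norm_num)
    have := hpS.2 ((1 / 2 : ℝ) • p S + (1 / 2 : ℝ) • y) fun i hi =>
      hconv i (hpS.1 i hi) (hy i hi) (by norm_num) (by norm_num) (by norm_num)
    linarith
  let M : Finset (Fin n) → Finset (Fin n) := fun S =>
    S ∪ Finset.univ.filter (fun v => p S ∈ K v ∧ v ∉ Q (p S) ∧ ∀ u ∈ S, u ∉ Q (p S) → u < v)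
  have hMK : ∀ S, (⋂ i ∈ S, K i).Nonempty → ∀ i ∈ M S, p S ∈ K i := by
    intro S hS i hi
    simp only [M, Finset.mem_union, Finset.mem_filter, Finset.mem_univ, true_and] at hi
    rcases hi with hi | hi
    · exact (hp S hS).1 i hi
    · exact hi.1
  refine upper_bound_comb (L := ℝ ×ₗ (ℕ ×ₗ ℤ)) hr _
    (((Finset.univ : Finset (Fin n)).powersetCard d).filter
        (fun J => (⋂ i ∈ J, K i).Nonempty)) M
    (fun S => toLex (‖p S‖, toLex ((S ∩ Q (p S)).card, - ∑ i ∈ S, ((i : ℕ) : ℤ))))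
    ?_ ?_ ?_ ?_ ?_ ?_
  · intro J hJ
    simp only [Finset.mem_filter, Finset.mem_powersetCard] at hJ
    exact hJ.1.2
  · intro J hJ
    simp only [Finset.mem_filter, Finset.mem_powersetCard] at hJ
    exact hJ.1.2
  · intro S hS
    simp only [Finset.mem_filter, Finset.mem_powersetCard] at hS
    exact hdim _ (hne_of _ (p S) (hMK S hS.2))
  · intro S hS
    exact Finset.subset_union_left
  · intro J hJ
    simp only [Finset.mem_filter, Finset.mem_powersetCard] at hJ
    have hne : (J \ Q (p J)).Nonempty := by
      rw [← Finset.card_pos]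
      have h1 := Finset.le_card_sdiff (Q (p J)) J
      have := hQ (p J)
      omega
    obtain ⟨v, hv, hmax⟩ := Finset.exists_max_image _ id hne
    simp only [id] at hmax
    rw [Finset.mem_sdiff] at hv
    have hps : p (J.erase v) = p J := by
      refine hstab J _ hJ.2 (Finset.erase_subset _ _) ?_
      intro x hx
      rw [Finset.mem_inter] at hx
      refine Finset.mem_erase.2 ⟨?_, hx.1⟩
      rintro rfl
      exact hv.2 hx.2
    have hpJ := hp J hJ.2
    refine ⟨J.erase v, ?_, Finset.erase_subset _ _, ?_⟩
    · simp only [Finset.mem_filter, Finset.mem_powersetCard, Finset.subset_univ, true_and]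
      refine ⟨by rw [Finset.card_erase_of_mem hv.1]; omega, ?_⟩
      exact hne_of _ (p J) fun i hi => hpJ.1 i (Finset.mem_of_mem_erase hi)
    · intro x hx
      simp only [M, Finset.mem_union, Finset.mem_filter, Finset.mem_univ, true_and, hps]
      by_cases hxv : x = v
      · right
        subst hxv
        refine ⟨hpJ.1 _ hx, hv.2, fun u hu huq => ?_⟩
        rw [Finset.mem_erase] at hu
        exact lt_of_le_of_ne (hmax u (Finset.mem_sdiff.2 ⟨hu.2, huq⟩)) hu.1
      · left; exact Finset.mem_erase.2 ⟨hxv, hx⟩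
  · intro S hS S' hS' hne hsub
    simp only [Finset.mem_filter, Finset.mem_powersetCard, Finset.subset_univ, true_and] at hS hS'
    have hin : ∀ i ∈ S, p S' ∈ K i := fun i hi => hMK S' hS'.2 i (hsub hi)
    have hle : ‖p S‖ ≤ ‖p S'‖ := (hp S hS.2).2 _ hin
    rw [Prod.Lex.toLex_lt_toLex]
    rcases hle.lt_or_eq with h | h
    · left; exact h
    right
    refine ⟨h, ?_⟩
    have hpp : p S' = p S := huniq S _ hin h.ge
    have hTT : S ∩ Q (p S) ⊆ S' ∩ Q (p S') := by
      intro x hx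
      rw [Finset.mem_inter] at hx
      have := hsub hx.1
      simp only [M, Finset.mem_union, Finset.mem_filter, Finset.mem_univ, true_and, hpp] at this
      rw [Finset.mem_inter, hpp]
      exact ⟨this.resolve_right fun h => h.2.1 hx.2, hx.2⟩
    rw [Prod.Lex.toLex_lt_toLex]
    rcases (Finset.card_le_card hTT).lt_or_eq with h1 | h1
    · left; exact h1
    right
    refine ⟨h1, ?_⟩
    have hTe := Finset.eq_of_subset_of_card_le hTT h1.ge
    simp only [neg_lt_neg_iff]
    refine sum_lt_of_separated S S' (by rw [hS.1, hS'.1]) hne ?_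
    intro u hu v hv
    rw [Finset.mem_sdiff] at hu hv
    have hv2 := hsub hv.1
    simp only [M, Finset.mem_union, Finset.mem_filter, Finset.mem_univ, true_and] at hv2
    refine (hv2.resolve_left hv.2).2.2 u hu.1 fun huq => hu.2 ?_
    have : u ∈ S' ∩ Q (p S') := Finset.mem_inter.2 ⟨hu.1, huq⟩
    rw [← hTe] at this
    exact (Finset.mem_inter.1 this).1

theorem separate_compact {ι : Type*} [Fintype ι] {E : Type*} [NormedAddCommGroup E]
    [NormedSpace ℝ E] (C : ι → Set E) (hcomp : ∀ i, IsCompact (C i))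
    (hconv : ∀ i, Convex ℝ (C i)) (hemp : ¬ ∃ x, ∀ i, x ∈ C i) :
    ∃ (a : ι → Module.Dual ℝ E) (b : ι → ℝ), (∀ x, ∑ i, a i x = 0) ∧ ∑ i, b i < 0 ∧
      ∀ i, ∀ x ∈ C i, a i x ≤ b i := by
  by_cases h0 : ∃ i, C i = ∅
  · obtain ⟨i0, hi0⟩ := h0
    refine ⟨fun _ => 0, Pi.single i0 (-1), by simp, by simp, ?_⟩
    intro i x hx
    have hne : i ≠ i0 := by
      rintro rfl
      rw [hi0] at hx; exact hx
    simp [hne]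
  have hne : ∀ i, (C i).Nonempty := fun i => by
    rw [Set.nonempty_iff_ne_empty]; exact fun h => h0 ⟨i, h⟩
  let D : E →L[ℝ] (ι → E) := ContinuousLinearMap.pi fun _ => ContinuousLinearMap.id ℝ E
  have hDcl : IsClosed (Set.range D) := by
    have : Set.range D = ⋂ i, ⋂ j, {y : ι → E | y i = y j} := by
      ext y
      simp only [Set.mem_range, Set.mem_iInter, Set.mem_ofPred_eq]
      constructor
      · rintro ⟨x, rfl⟩ i j; rfl
      · intro h
        by_cases hι : Nonempty ι
        · obtain ⟨i⟩ := hι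
          exact ⟨y i, funext fun j => h i j⟩
        · rw [not_nonempty_iff] at hι
          exact ⟨0, Subsingleton.elim _ _⟩
    rw [this]
    exact isClosed_iInter fun i => isClosed_iInter fun j =>
      isClosed_eq (continuous_apply i) (continuous_apply j)
  have hDconv : Convex ℝ (Set.range D) := by
    rintro _ ⟨x, rfl⟩ _ ⟨y, rfl⟩ s t _ _ _
    exact ⟨s • x + t • y, by simp⟩
  have hdisj : Disjoint (Set.univ.pi C) (Set.range D) := by
    rw [Set.disjoint_left]
    rintro _ hy ⟨x, rfl⟩
    exact hemp ⟨x, fun i => hy i (Set.mem_univ i)⟩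
  obtain ⟨f, u, v, hf1, huv, hf2⟩ := geometric_hahn_banach_compact_closed
    (convex_pi fun i _ => hconv i) (isCompact_univ_pi hcomp) hDconv hDcl hdisj
  have hv : v < 0 := by simpa using hf2 (D 0) ⟨0, rfl⟩
  have hzero : ∀ x, f (D x) = 0 := by
    intro x
    by_contra hx
    have := hf2 (D ((v / f (D x)) • x)) ⟨_, rfl⟩
    rw [map_smul, map_smul, smul_eq_mul, div_mul_cancel₀ _ hx] at this
    exact lt_irrefl _ this
  have hsum : ∀ y : ι → E, ∑ i, f (Pi.single i (y i)) = f y := by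
    intro y
    rw [← map_sum, Finset.univ_sum_single]
  have hmax : ∀ i, ∃ x ∈ C i, ∀ y ∈ C i, f (Pi.single i y) ≤ f (Pi.single i x) := by
    intro i
    have hc : Continuous (fun y : E => f (Pi.single i y)) :=
      f.continuous.comp (continuous_single (A := fun _ : ι => E) i)
    obtain ⟨x, hx, h⟩ := (hcomp i).exists_isMaxOn (hne i) hc.continuousOn
    exact ⟨x, hx, fun y hy => h hy⟩
  choose x hxC hxm using hmax
  refine ⟨fun i => f.toLinearMap ∘ₗ LinearMap.single ℝ (fun _ => E) i,
    fun i => f (Pi.single i (x i)), ?_, ?_, ?_⟩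
  · intro y
    have := hsum (D y)
    rw [hzero] at this
    simpa [D] using this
  · rw [hsum]
    have := hf1 x fun i _ => hxC i
    linarith
  · intro i y hy
    simpa using hxm i y hy

theorem separate_finset {n : ℕ} {E : Type*} [NormedAddCommGroup E]
    [NormedSpace ℝ E] (C : Fin n → Set E) (hcomp : ∀ i, IsCompact (C i))
    (hconv : ∀ i, Convex ℝ (C i)) (J : Finset (Fin n)) :
    ∃ (a : Fin n → Module.Dual ℝ E) (b : Fin n → ℝ), (∀ i, ∀ x ∈ C i, a i x ≤ b i) ∧
      ((¬ ∃ x, ∀ i ∈ J, x ∈ C i) → (∀ x, ∑ i ∈ J, a i x = 0) ∧ ∑ i ∈ J, b i < 0) := by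
  by_cases h : ∃ x, ∀ i ∈ J, x ∈ C i
  · exact ⟨0, 0, by simp, fun h' => absurd h h'⟩
  obtain ⟨a, b, h1, h2, h3⟩ := separate_compact (fun i : J => C i.1) (fun i => hcomp i)
    (fun i => hconv i) (by simpa using h)
  refine ⟨fun i => if hi : i ∈ J then a ⟨i, hi⟩ else 0,
    fun i => if hi : i ∈ J then b ⟨i, hi⟩ else 0, ?_, fun _ => ⟨?_, ?_⟩⟩
  · intro i x hx
    by_cases hi : i ∈ J
    · simpa [hi] using h3 ⟨i, hi⟩ x hx
    · simp [hi]
  · intro x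
    rw [← h1 x, ← Finset.sum_coe_sort]
    exact Finset.sum_congr rfl fun i _ => by simp
  · rw [← Finset.sum_coe_sort]
    refine lt_of_eq_of_lt ?_ h2
    exact Finset.sum_congr rfl fun i _ => by simp

theorem generic_shift {n d : ℕ} {ι : Type*} [Finite ι] {E : Type*} [AddCommGroup E] [Module ℝ E]
    [FiniteDimensional ℝ E] (hd : Module.finrank ℝ E = d)
    (a : ι → Fin n → Module.Dual ℝ E) (b : ι → Fin n → ℝ) :
    ∀ᶠ t : ℝ in nhdsWithin 0 (Set.Ioi 0), ∀ p : E,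
      (Finset.univ.filter (fun i : Fin n => ∃ J, a J i p = b J i + t ^ ((i : ℕ) + 1))).card ≤ d := by
  have hrel : ∀ (R : Finset (Fin n)) (c : Fin n → ι), ∃ l : Fin n → ℝ, R.card = d + 1 →
      (∀ p, ∑ i ∈ R, l i * a (c i) i p = 0) ∧ ∃ i ∈ R, l i ≠ 0 := by
    intro R c
    by_cases hR : R.card = d + 1
    · have hnl : ¬ LinearIndependent ℝ (fun i : R => a (c i.1) i.1) := by
        intro hl
        have := hl.fintype_card_le_finrank
        rw [Fintype.card_coe, Subspace.dual_finrank_eq, hd] at this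
        omega
      rw [Fintype.not_linearIndependent_iff] at hnl
      obtain ⟨g, hg, i0, hi0⟩ := hnl
      refine ⟨fun i => if hi : i ∈ R then g ⟨i, hi⟩ else 0, fun _ => ⟨fun p => ?_, i0.1, i0.2, ?_⟩⟩
      · have := congrArg (fun φ : Module.Dual ℝ E => φ p) hg
        simp only [LinearMap.sum_apply, LinearMap.smul_apply, LinearMap.zero_apply,
          smul_eq_mul] at this
        rw [← this, ← Finset.sum_coe_sort]
        exact Finset.sum_congr rfl fun i _ => by simp
      · simpa using hi0
    · exact ⟨0, fun h => absurd h hR⟩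
  choose l hl using hrel
  let P : Finset (Fin n) → (Fin n → ι) → Polynomial ℝ := fun R c =>
    ∑ i ∈ R, (Polynomial.C (l R c i * b (c i) i) +
      Polynomial.C (l R c i) * Polynomial.X ^ ((i : ℕ) + 1))
  have hP : ∀ R c, R.card = d + 1 → P R c ≠ 0 := by
    intro R c hR h0
    obtain ⟨i0, hi0, hne⟩ := (hl R c hR).2
    have h1 := congrArg (fun q => Polynomial.coeff q ((i0 : ℕ) + 1)) h0
    simp only [P, Polynomial.finsetSum_coeff, Polynomial.coeff_add, Polynomial.coeff_C_mul,
      Polynomial.coeff_X_pow, Polynomial.coeff_zero, Polynomial.coeff_C] at h1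
    rw [Finset.sum_eq_single i0] at h1
    · simp at h1; exact hne h1
    · intro i _ hi
      have : ¬ ((i0 : ℕ) = (i : ℕ)) := fun h => hi (Fin.ext h.symm)
      simp [this]
    · exact fun h => absurd hi0 h
  have hev : ∀ R c, R.card = d + 1 → ∀ᶠ t : ℝ in nhdsWithin 0 (Set.Ioi 0),
      (P R c).eval t ≠ 0 := by
    intro R c hR
    have hfin : ({t : ℝ | (P R c).IsRoot t} \ {0}).Finite :=
      (Polynomial.finite_setOfPred_isRoot (hP R c hR)).subset Set.sdiff_subset
    have hmem : ({t : ℝ | (P R c).IsRoot t} \ {0})ᶜ ∈ nhds (0 : ℝ) :=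
      hfin.isClosed.isOpen_compl.mem_nhds (by simp)
    filter_upwards [nhdsWithin_le_nhds hmem, self_mem_nhdsWithin] with t ht ht0 hroot
    exact ht ⟨hroot, ne_of_gt ht0⟩
  have hall : ∀ᶠ t : ℝ in nhdsWithin 0 (Set.Ioi 0), ∀ (R : Finset (Fin n)) (c : Fin n → ι),
      R.card = d + 1 → (P R c).eval t ≠ 0 := by
    rw [Filter.eventually_all]; intro R
    rw [Filter.eventually_all]; intro c
    by_cases hR : R.card = d + 1
    · filter_upwards [hev R c hR] with t ht _ using ht
    · exact Filter.Eventually.of_forall fun t h => absurd h hR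
  filter_upwards [hall] with t ht p
  by_contra hcon
  push Not at hcon
  obtain ⟨R, hRsub, hRc⟩ := Finset.exists_subset_card_eq (Nat.succ_le_of_lt hcon)
  have hRne : R.Nonempty := by rw [← Finset.card_pos]; omega
  obtain ⟨j0, hj0⟩ := hRne
  have hmemR : ∀ i ∈ R, ∃ J, a J i p = b J i + t ^ ((i : ℕ) + 1) := fun i hi => by
    simpa using hRsub hi
  obtain ⟨J0, _⟩ := hmemR j0 hj0
  have hc : ∀ i, ∃ J, i ∈ R → a J i p = b J i + t ^ ((i : ℕ) + 1) := by
    intro i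
    by_cases hi : i ∈ R
    · obtain ⟨J, hJ⟩ := hmemR i hi
      exact ⟨J, fun _ => hJ⟩
    · exact ⟨J0, fun h => absurd h hi⟩
  choose c hc using hc
  refine ht R c hRc ?_
  simp only [P, Polynomial.eval_finsetSum, Polynomial.eval_add, Polynomial.eval_mul,
    Polynomial.eval_C, Polynomial.eval_pow, Polynomial.eval_X]
  rw [← (hl R c hRc).1 p]
  refine Finset.sum_congr rfl fun i hi => ?_
  rw [hc i hi]; ring

/-- Upper bound theorem for families of convex sets (Kalai, Eckhoff), for `d`-faces. -/
theorem upper_bound_convex {n d r : ℕ} (hr : d + r ≤ n)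
    (K : Fin n → Set (EuclideanSpace ℝ (Fin d))) (hconv : ∀ i, Convex ℝ (K i))
    (hdim : ∀ I : Finset (Fin n), (⋂ i ∈ I, K i).Nonempty → I.card ≤ d + r) :
    (((Finset.univ : Finset (Fin n)).powersetCard (d + 1)).filter
        (fun J => (⋂ i ∈ J, K i).Nonempty)).card + (n - r).choose (d + 1) ≤ n.choose (d + 1) := by
  have hx : ∀ J : Finset (Fin n), ∃ x, (⋂ i ∈ J, K i).Nonempty → ∀ i ∈ J, x ∈ K i := by
    intro J
    by_cases h : (⋂ i ∈ J, K i).Nonempty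
    · obtain ⟨x, hx⟩ := h
      exact ⟨x, fun _ => by simpa using hx⟩
    · exact ⟨0, fun h' => absurd h' h⟩
  choose x hx using hx
  let V : Fin n → Set (EuclideanSpace ℝ (Fin d)) := fun i =>
    Set.image x {J | i ∈ J ∧ (⋂ i ∈ J, K i).Nonempty}
  let C : Fin n → Set (EuclideanSpace ℝ (Fin d)) := fun i => convexHull ℝ (V i)
  have hCK : ∀ i, C i ⊆ K i := by
    intro i
    refine convexHull_min ?_ (hconv i)
    rintro _ ⟨J, ⟨hi, hJ⟩, rfl⟩
    exact hx J hJ i hi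
  have hCcomp : ∀ i, IsCompact (C i) := fun i =>
    ((Set.toFinite _).image x).isCompact_convexHull ℝ
  have hsep := separate_finset C hCcomp (fun i => convex_convexHull ℝ _)
  choose a b hab hcert using hsep
  have hev1 := generic_shift (ι := Finset (Fin n)) (E := EuclideanSpace ℝ (Fin d)) (d := d)
    (by simp) a b
  have hev2 : ∀ᶠ t : ℝ in nhdsWithin 0 (Set.Ioi 0), ∀ J : Finset (Fin n),
      (¬ ∃ x, ∀ i ∈ J, x ∈ C i) → ∑ i ∈ J, (b J i + t ^ ((i : ℕ) + 1)) < 0 := by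
    rw [Filter.eventually_all]; intro J
    by_cases h : ∃ x, ∀ i ∈ J, x ∈ C i
    · exact Filter.Eventually.of_forall fun t h' => absurd h h'
    · have hc : Continuous (fun t : ℝ => ∑ i ∈ J, (b J i + t ^ ((i : ℕ) + 1))) := by fun_prop
      have h0 := hc.tendsto 0
      simp only [ne_eq, Nat.add_eq_zero_iff, one_ne_zero, and_false, not_false_eq_true, zero_pow,
        add_zero] at h0
      filter_upwards [nhdsWithin_le_nhds (h0.eventually_lt_const (hcert J h).2)] with t ht _ using ht
  obtain ⟨t, ⟨ht1, ht2⟩, ht0⟩ := ((hev1.and hev2).and self_mem_nhdsWithin).exists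
  have ht0 : 0 < t := ht0
  let K' : Fin n → Set (EuclideanSpace ℝ (Fin d)) := fun i =>
    ⋂ J, {y | a J i y ≤ b J i + t ^ ((i : ℕ) + 1)}
  have hcont : ∀ J i, Continuous (a J i) := fun J i => (a J i).continuous_of_finiteDimensional
  have hCK' : ∀ i, C i ⊆ K' i := by
    intro i y hy
    simp only [K', Set.mem_iInter, Set.mem_ofPred_eq]
    intro J
    have := hab J i y hy
    have : 0 < t ^ ((i : ℕ) + 1) := by positivity
    linarith
  have hK'K : ∀ J : Finset (Fin n), (⋂ i ∈ J, K' i).Nonempty → (⋂ i ∈ J, K i).Nonempty := by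
    intro J hJ
    by_contra hcon
    have hno : ¬ ∃ x, ∀ i ∈ J, x ∈ C i := by
      rintro ⟨y, hy⟩
      exact hcon ⟨y, by simpa using fun i hi => hCK i (hy i hi)⟩
    obtain ⟨y, hy⟩ := hJ
    simp only [K', Set.mem_iInter, Set.mem_ofPred_eq] at hy
    have h1 := ht2 J hno
    have h2 := (hcert J hno).1 y
    have h3 := Finset.sum_le_sum fun i hi => hy i hi J
    linarith
  have hKK' : ∀ J : Finset (Fin n), (⋂ i ∈ J, K i).Nonempty → (⋂ i ∈ J, K' i).Nonempty := by
    intro J hJ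
    refine ⟨x J, ?_⟩
    simp only [Set.mem_iInter]
    intro i hi
    exact hCK' i (subset_convexHull ℝ _ ⟨J, ⟨hi, hJ⟩, rfl⟩)
  have hmain := upper_bound_generic (d := d) hr K' ?_ ?_
    (fun p => Finset.univ.filter (fun i : Fin n => ∃ J, a J i p = b J i + t ^ ((i : ℕ) + 1)))
    (fun p => by convert ht1 p) ?_ (fun I hI => hdim I (hK'K I hI))
  · refine le_trans (Nat.add_le_add_right (Finset.card_le_card ?_) _) hmain
    exact Finset.monotone_filter_right _ fun J _ hJ => hKK' J hJ
  · intro i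
    exact isClosed_iInter fun J => isClosed_le (hcont J i) continuous_const
  · intro i
    exact convex_iInter fun J => convex_halfSpace_le (a J i).isLinear _
  · intro p i hp hi
    simp only [Finset.mem_filter, Finset.mem_univ, true_and, not_exists] at hi
    simp only [K', Set.mem_iInter, Set.mem_ofPred_eq] at hp
    simp only [K']
    rw [Filter.iInter_mem]
    intro J
    have hlt : a J i p < b J i + t ^ ((i : ℕ) + 1) := lt_of_le_of_ne (hp J) (hi J)
    filter_upwards [(hcont J i).continuousAt.eventually_lt_const hlt] with y hy using hy.le

/-- **The sharp fractional Helly theorem** (Katchalski–Liu; sharp constant by Kalai).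
If at least `α · C(n, d+1)` of the `(d+1)`-element subfamilies of a family of `n ≥ d+1`
convex sets in `ℝ^d` are intersecting, then some `(1 - (1-α)^{1/(d+1)}) n` of the sets
have a common point. -/
theorem fractional_helly (d n : ℕ) (hd : 1 ≤ d) (α : ℝ) (hα0 : 0 < α) (hα1 : α ≤ 1)
    (hn : d + 1 ≤ n) (K : Fin n → Set (EuclideanSpace ℝ (Fin d)))
    (hconv : ∀ i, Convex ℝ (K i))
    (hcount : α * (n.choose (d + 1) : ℝ) ≤
      (((Finset.univ : Finset (Fin n)).powersetCard (d + 1)).filter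
        (fun J => (⋂ i ∈ J, K i).Nonempty)).card) :
    ∃ I : Finset (Fin n),
      (1 - (1 - α) ^ ((1 : ℝ) / (d + 1))) * n ≤ (I.card : ℝ) ∧
      (⋂ i ∈ I, K i).Nonempty := by
  obtain ⟨I, hI, hmax⟩ := Finset.exists_max_image
    (Finset.univ.filter (fun J : Finset (Fin n) => (⋂ i ∈ J, K i).Nonempty)) Finset.card
    ⟨∅, by simp⟩
  simp only [Finset.mem_filter, Finset.mem_univ, true_and] at hI hmax
  refine ⟨I, ?_, hI⟩
  have hchoose : 0 < n.choose (d + 1) := Nat.choose_pos hn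
  have hpos : 0 < (((Finset.univ : Finset (Fin n)).powersetCard (d + 1)).filter
        (fun J => (⋂ i ∈ J, K i).Nonempty)).card := by
    have h1 : (0 : ℝ) < α * (n.choose (d + 1) : ℝ) := by positivity
    exact_mod_cast h1.trans_le hcount
  obtain ⟨J0, hJ0⟩ := Finset.card_pos.1 hpos
  simp only [Finset.mem_filter, Finset.mem_powersetCard] at hJ0
  have hId : d + 1 ≤ I.card := by rw [← hJ0.1.2]; exact hmax J0 hJ0.2
  have hIn : I.card ≤ n := by simpa using Finset.card_le_univ I
  have hub := upper_bound_convex (d := d) (r := I.card - d) (by omega) K hconv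
    (fun J hJ => by have := hmax J hJ; omega)
  have e1 : n - (I.card - d) = n - I.card + d := by omega
  rw [e1] at hub
  have hubR : ((((Finset.univ : Finset (Fin n)).powersetCard (d + 1)).filter
        (fun J => (⋂ i ∈ J, K i).Nonempty)).card : ℝ) + ((n - I.card + d).choose (d + 1) : ℝ)
        ≤ (n.choose (d + 1) : ℝ) := by exact_mod_cast hub
  have hc : ((n - I.card + d).choose (d + 1) : ℝ) ≤ (1 - α) * (n.choose (d + 1) : ℝ) := by
    linarith
  have hdf : ((n - I.card + d).descFactorial (d + 1) : ℝ) ≤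
      (1 - α) * (n.descFactorial (d + 1) : ℝ) := by
    rw [Nat.descFactorial_eq_factorial_mul_choose, Nat.descFactorial_eq_factorial_mul_choose]
    push_cast
    have : (0 : ℝ) ≤ ((d + 1).factorial : ℝ) := by positivity
    nlinarith [mul_le_mul_of_nonneg_left hc this]
  have hlow : (((n - I.card : ℕ) : ℝ)) ^ (d + 1) ≤
      ((n - I.card + d).descFactorial (d + 1) : ℝ) := by
    have := Nat.pow_sub_le_descFactorial (n - I.card + d) (d + 1)
    rw [show n - I.card + d + 1 - (d + 1) = n - I.card by omega] at this
    exact_mod_cast this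
  have hhigh : (n.descFactorial (d + 1) : ℝ) ≤ (n : ℝ) ^ (d + 1) := by
    exact_mod_cast Nat.descFactorial_le_pow n (d + 1)
  have h1α : 0 ≤ 1 - α := by linarith
  have hγ : ((1 - α) ^ ((1 : ℝ) / (d + 1))) ^ (d + 1) = 1 - α := by
    rw [← Real.rpow_natCast, ← Real.rpow_mul h1α]
    push_cast
    rw [one_div_mul_cancel (by positivity), Real.rpow_one]
  have hγ0 : 0 ≤ (1 - α) ^ ((1 : ℝ) / (d + 1)) := Real.rpow_nonneg h1α _
  have hfin : (((n - I.card : ℕ) : ℝ)) ^ (d + 1) ≤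
      ((1 - α) ^ ((1 : ℝ) / (d + 1)) * n) ^ (d + 1) := by
    rw [mul_pow, hγ]
    exact hlow.trans (hdf.trans (mul_le_mul_of_nonneg_left hhigh h1α))
  have := le_of_pow_le_pow_left₀ (Nat.succ_ne_zero d) (by positivity) hfin
  rw [Nat.cast_sub hIn] at this
  linarith
end

section
/- Let F = {K_1, ..., K_n} be a family of n convex sets in ℝ^d and let r ≥ 1 be an integer such that every d+r+1 members of F have an empty intersection. Then for every k with d ≤ k ≤ d+r-1, the number of (k+1)-element subsets S of {1,...,n} for which ⋂_{i∈S} K_i is non-empty is at most Σ_{j=k}^{d+r-1} C(j-d, k-d) · C(n-j+d-1, d). -/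
open scoped Classical


lemma ubt_hom (d n b : ℕ) (B : Finset (Fin n)) (hc : B.card ≤ b) :
    (MvPolynomial.X (Fin.last d) ^ (b - B.card) * ∏ t ∈ B, ∑ i : Fin (d+1),
      MvPolynomial.C (((t : ℕ) : ℚ) ^ (i : ℕ)) * MvPolynomial.X i :
        MvPolynomial (Fin (d+1)) ℚ).IsHomogeneous b := by
  have h1 : (∏ t ∈ B, ∑ i : Fin (d+1),
      MvPolynomial.C (((t : ℕ) : ℚ) ^ (i : ℕ)) * MvPolynomial.X i :
        MvPolynomial (Fin (d+1)) ℚ).IsHomogeneous (∑ t ∈ B, 1) := by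
    apply MvPolynomial.IsHomogeneous.prod
    intro t _
    apply MvPolynomial.IsHomogeneous.sum
    intro i _
    have := (MvPolynomial.isHomogeneous_C (Fin (d+1)) (((t : ℕ) : ℚ) ^ (i : ℕ))).mul
      (MvPolynomial.isHomogeneous_X ℚ i)
    rwa [zero_add] at this
  have h2 := ((MvPolynomial.isHomogeneous_X ℚ (Fin.last d)).pow (b - B.card)).mul h1
  have h3 : 1 * (b - B.card) + ∑ t ∈ B, 1 = b := by
    simp only [Finset.sum_const, smul_eq_mul]; omega
  rwa [h3] at h2

set_option maxHeartbeats 1000000 in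
lemma ubt_skew (d n b : ℕ) (𝒜 : Finset (Finset (Fin n))) (M : Finset (Fin n) → Finset (Fin n))
    {α : Type} [LinearOrder α] (ρ : Finset (Fin n) → α)
    (hcard : ∀ A ∈ 𝒜, A.card = d) (hsub : ∀ A ∈ 𝒜, A ⊆ M A)
    (hM : ∀ A ∈ 𝒜, n ≤ (M A).card + b)
    (hskew : ∀ A ∈ 𝒜, ∀ A' ∈ 𝒜, A ≠ A' → A ⊆ M A' → ρ A' < ρ A) :
    𝒜.card ≤ (d + b).choose d := by
  let p : Finset (Fin n) → Polynomial ℚ := fun A => ∏ a ∈ A, (Polynomial.X - Polynomial.C ((a : ℕ) : ℚ))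
  let lin : Fin n → MvPolynomial (Fin (d+1)) ℚ := fun t =>
    ∑ i : Fin (d+1), MvPolynomial.C (((t : ℕ) : ℚ) ^ (i : ℕ)) * MvPolynomial.X i
  let f : Finset (Fin n) → MvPolynomial (Fin (d+1)) ℚ := fun A =>
    MvPolynomial.X (Fin.last d) ^ (b - (M A)ᶜ.card) * ∏ t ∈ (M A)ᶜ, lin t
  let pt : Finset (Fin n) → Fin (d+1) → ℚ := fun A i => (p A).coeff i
  have hmon : ∀ A, (p A).Monic := fun A => Polynomial.monic_prod_of_monic _ _ (fun a _ => Polynomial.monic_X_sub_C _)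
  have hdeg : ∀ A ∈ 𝒜, (p A).natDegree = d := by
    intro A hA
    simp only [p]
    rw [Polynomial.natDegree_prod_of_monic _ _ (fun a _ => Polynomial.monic_X_sub_C _)]
    simp only [Polynomial.natDegree_X_sub_C, Finset.sum_const, smul_eq_mul, mul_one, hcard A hA]
  have hlin : ∀ A ∈ 𝒜, ∀ t, MvPolynomial.eval (pt A) (lin t) = (p A).eval ((t : ℕ) : ℚ) := by
    intro A hA t
    rw [Polynomial.eval_eq_sum_range' (n := d+1) (by rw [hdeg A hA]; omega), Finset.sum_range]
    simp only [lin, map_sum, map_mul, MvPolynomial.eval_C, MvPolynomial.eval_X, pt]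
    exact Finset.sum_congr rfl (fun i _ => mul_comm _ _)
  have hev : ∀ A ∈ 𝒜, ∀ t : Fin n, (p A).eval ((t : ℕ) : ℚ) = 0 ↔ t ∈ A := by
    intro A hA t
    simp only [p, Polynomial.eval_prod, Finset.prod_eq_zero_iff, Polynomial.eval_sub, Polynomial.eval_X, Polynomial.eval_C, sub_eq_zero, Nat.cast_inj]
    constructor
    · rintro ⟨a, ha, h⟩
      rwa [Fin.ext h]
    · intro h; exact ⟨t, h, rfl⟩
  have hf : ∀ A ∈ 𝒜, ∀ A', MvPolynomial.eval (pt A) (f A') ≠ 0 ↔ A ⊆ M A' := by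
    intro A hA A'
    have h1 : pt A (Fin.last d) = 1 := by
      have := hmon A
      rw [Polynomial.Monic, Polynomial.leadingCoeff, hdeg A hA] at this
      simpa [pt] using this
    simp only [f, map_mul, map_pow, map_prod, MvPolynomial.eval_X, h1, one_pow, one_mul]
    rw [Finset.prod_ne_zero_iff]
    constructor
    · intro h t ht
      by_contra hc
      exact h t (by simpa using hc) (by rw [hlin A hA, hev A hA]; exact ht)
    · intro h t ht h0
      rw [hlin A hA, hev A hA] at h0
      exact (Finset.mem_compl.mp ht) (h h0)
  let F : Finset (Fin (d+1) →₀ ℕ) := Finset.finsuppAntidiag Finset.univ b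
  let G : Finset (MvPolynomial (Fin (d+1)) ℚ) := F.image (fun m => MvPolynomial.monomial m 1)
  let W := Submodule.span ℚ (G : Set (MvPolynomial (Fin (d+1)) ℚ))
  have hW : ∀ A ∈ 𝒜, f A ∈ W := by
    intro A hA
    have hhom : (f A).IsHomogeneous b := by
      have hc : (M A)ᶜ.card ≤ b := by
        rw [Finset.card_compl, Fintype.card_fin]; have := hM A hA; omega
      exact ubt_hom d n b _ hc
    rw [(f A).as_sum]
    apply Submodule.sum_mem
    intro m hm
    have : MvPolynomial.monomial m ((f A).coeff m) = ((f A).coeff m) • (MvPolynomial.monomial m (1:ℚ)) := by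
      rw [MvPolynomial.smul_monomial]; simp
    rw [this]
    apply Submodule.smul_mem
    apply Submodule.subset_span
    simp only [G, Finset.coe_image, Set.mem_image, Finset.mem_coe]
    refine ⟨m, ?_, rfl⟩
    simp only [F, Finset.mem_finsuppAntidiag]
    refine ⟨?_, by simp⟩
    have := hhom.degree_eq_sum_deg_support hm
    rw [this]
    exact (Finset.sum_subset (Finset.subset_univ _) (by simp)).symm
  have hli : LinearIndependent ℚ (fun A : 𝒜 => (⟨f A, hW A A.2⟩ : W)) := by
    rw [Fintype.linearIndependent_iff]
    intro c hc
    by_contra hne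
    push Not at hne
    obtain ⟨A₀, hA₀⟩ := hne
    obtain ⟨A, hA, hmin⟩ := Finset.exists_min_image (Finset.univ.filter (fun A : 𝒜 => c A ≠ 0)) (fun A => ρ A) ⟨A₀, by simpa using hA₀⟩
    have h1 := congrArg (fun w : W => MvPolynomial.eval (pt A) (w : MvPolynomial (Fin (d+1)) ℚ)) hc
    simp only [Submodule.coe_sum, Submodule.coe_smul, map_sum, MvPolynomial.smul_eval, Submodule.coe_zero, map_zero] at h1
    rw [Finset.sum_eq_single A] at h1
    · rcases mul_eq_zero.mp h1 with h | h
      · simp at hA; exact hA h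
      · exact (hf A A.2 A).mpr (hsub A A.2) h
    · intro A' _ hA'
      by_cases h : c A' = 0
      · rw [h, zero_mul]
      · have h2 := hmin A' (by simpa using h)
        by_contra h3
        have h4 := (hf A A.2 A').mp (right_ne_zero_of_mul h3)
        exact absurd (hskew A A.2 A' A'.2 (fun h => hA' (Subtype.ext h.symm)) h4) (not_lt.mpr h2)
    · simp
  have h1 := hli.fintype_card_le_finrank
  have h2 : Module.finrank ℚ W ≤ G.card := finrank_span_finset_le_card G
  have h3 : G.card ≤ F.card := Finset.card_image_le
  have h4 : F.card = (d + b).choose d := by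
    simp only [F, Finset.card_finsuppAntidiag_nat_eq_choose]
    simp only [Finset.card_univ, Fintype.card_fin]
    rw [show d + 1 + b - 1 = d + b by omega, ← Nat.choose_symm_add]
  simp only [Fintype.card_coe] at h1
  omega

lemma ubt_core (d n r k : ℕ) (hr : 1 ≤ r) (hdk : d ≤ k) (hk : k ≤ d + r - 1)
    (N : Finset (Fin n) → Prop)
    (𝒜 : Finset (Finset (Fin n))) (M : Finset (Fin n) → Finset (Fin n))
    {α : Type} [LinearOrder α] (ρ : Finset (Fin n) → α)
    (hcard : ∀ A ∈ 𝒜, A.card = d) (hsub : ∀ A ∈ 𝒜, A ⊆ M A)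
    (hM : ∀ A ∈ 𝒜, (M A).card ≤ d + r)
    (hskew : ∀ A ∈ 𝒜, ∀ A' ∈ 𝒜, A ≠ A' → A ⊆ M A' → ρ A' < ρ A)
    (hcov : ∀ S, N S → d ≤ S.card → ∃ A ∈ 𝒜, A ⊆ S ∧ S ⊆ M A) :
    (((Finset.univ : Finset (Fin n)).powersetCard (k + 1)).filter (fun S => N S)).card ≤
      ∑ j ∈ Finset.Icc k (d + r - 1), (j - d).choose (k - d) * (n - j + d - 1).choose d := by
  have step1 : (((Finset.univ : Finset (Fin n)).powersetCard (k + 1)).filter (fun S => N S)).card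
      ≤ ∑ A ∈ 𝒜, ((M A).card - d).choose (k + 1 - d) := by
    have hsubset : (((Finset.univ : Finset (Fin n)).powersetCard (k + 1)).filter (fun S => N S)) ⊆
        𝒜.biUnion (fun A => ((M A \ A).powersetCard (k + 1 - d)).image (fun T => A ∪ T)) := by
      intro S hS
      simp only [Finset.mem_filter, Finset.mem_powersetCard, Finset.subset_univ, true_and] at hS
      obtain ⟨A, hA, hAS, hSM⟩ := hcov S hS.2 (by omega)
      simp only [Finset.mem_biUnion, Finset.mem_image, Finset.mem_powersetCard]
      refine ⟨A, hA, S \ A, ⟨Finset.sdiff_subset_sdiff hSM (le_refl _), ?_⟩, Finset.union_sdiff_of_subset hAS⟩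
      rw [Finset.card_sdiff_of_subset hAS, hcard A hA, hS.1]
    refine (Finset.card_le_card hsubset).trans (Finset.card_biUnion_le.trans ?_)
    apply Finset.sum_le_sum
    intro A hA
    refine Finset.card_image_le.trans ?_
    rw [Finset.card_powersetCard, Finset.card_sdiff_of_subset (hsub A hA), hcard A hA]
  have step2 : ∀ A ∈ 𝒜, ((M A).card - d).choose (k + 1 - d) ≤
      ∑ j ∈ Finset.Icc k (d + r - 1), if j + 1 ≤ (M A).card then (j - d).choose (k - d) else 0 := by
    intro A hA
    rw [← Finset.sum_filter]
    by_cases h : (M A).card ≤ d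
    · rw [Nat.choose_eq_zero_of_lt (by omega)]; exact Nat.zero_le _
    · have h1 := Nat.sum_Icc_choose ((M A).card - d - 1) (k - d)
      rw [show (M A).card - d - 1 + 1 = (M A).card - d by omega, show k - d + 1 = k + 1 - d by omega] at h1
      rw [← h1]
      apply le_of_eq
      have := hM A hA
      refine Finset.sum_nbij' (fun m => m + d) (fun j => j - d) ?_ ?_ ?_ ?_ ?_
      all_goals
        intro a ha
        simp only [Finset.mem_Icc, Finset.mem_filter] at ha ⊢
      all_goals first | omega | (congr 1; omega)
  refine step1.trans ((Finset.sum_le_sum step2).trans ?_)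
  rw [Finset.sum_comm]
  apply Finset.sum_le_sum
  intro j hj
  rw [← Finset.sum_filter, Finset.sum_const, smul_eq_mul, mul_comm]
  apply Nat.mul_le_mul_left
  by_cases hjn : j + 1 ≤ n
  · have := ubt_skew d n (n - j - 1) (𝒜.filter (fun A => j + 1 ≤ (M A).card)) M ρ
      (fun A hA => hcard A (Finset.mem_filter.mp hA).1)
      (fun A hA => hsub A (Finset.mem_filter.mp hA).1)
      (fun A hA => by have := (Finset.mem_filter.mp hA).2; omega)
      (fun A hA A' hA' => hskew A (Finset.mem_filter.mp hA).1 A' (Finset.mem_filter.mp hA').1)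
    rwa [show d + (n - j - 1) = n - j + d - 1 by omega] at this
  · rw [Finset.filter_eq_empty_iff.mpr]
    · simp
    · intro A _ h
      have := Finset.card_le_univ (M A)
      rw [Fintype.card_fin] at this
      omega

lemma ubt_small {n : ℕ} (U : Finset (Fin n)) (m : ℕ) (hm : m ≤ U.card) :
    ∃ T ⊆ U, T.card = m ∧ ∀ t ∈ T, ∀ s ∈ U, s ∉ T → t < s := by
  induction m with
  | zero => exact ⟨∅, by simp, by simp, by simp⟩
  | succ m ih =>
    obtain ⟨T, hTU, hT, hlt⟩ := ih (by omega)
    have hne : (U \ T).Nonempty := by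
      rw [← Finset.card_pos, Finset.card_sdiff_of_subset hTU]; omega
    have hmem := Finset.min'_mem (U \ T) hne
    set u := (U \ T).min' hne with hu
    rw [Finset.mem_sdiff] at hmem
    refine ⟨insert u T, Finset.insert_subset hmem.1 hTU, by
      rw [Finset.card_insert_of_notMem hmem.2, hT], ?_⟩
    intro t ht s hs hsT
    rw [Finset.mem_insert, not_or] at hsT
    rcases Finset.mem_insert.mp ht with rfl | ht
    · exact lt_of_le_of_ne (Finset.min'_le _ _ (Finset.mem_sdiff.mpr ⟨hs, hsT.2⟩)) (Ne.symm hsT.1)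
    · exact hlt t ht s hs hsT.2

lemma ubt_sum_lt {n : ℕ} (T T' : Finset (Fin n)) (hc : T.card = T'.card) (hne : T ≠ T')
    (h : ∀ t ∈ T, t ∈ T' ∨ ∀ s ∈ T', s < t) :
    ∑ t ∈ T', (t : ℕ) < ∑ t ∈ T, (t : ℕ) := by
  have h1 : (T \ T').card = (T' \ T).card := by
    have := Finset.card_sdiff_add_card_inter T T'
    have := Finset.card_sdiff_add_card_inter T' T
    rw [Finset.inter_comm] at this
    omega
  have hT'ne : (T' \ T).Nonempty := by
    rw [Finset.sdiff_nonempty]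
    intro hs
    exact hne (Finset.eq_of_subset_of_card_le hs (le_of_eq hc)).symm
  have h2 : ∑ t ∈ T' \ T, (t : ℕ) < ∑ t ∈ T \ T', (t : ℕ) := by
    have e := Finset.equivOfCardEq h1.symm
    rw [← Finset.sum_coe_sort (T' \ T), ← Finset.sum_coe_sort (T \ T'),
      ← Equiv.sum_comp e (fun i : ↥(T \ T') => ((i : Fin n) : ℕ))]
    have key : ∀ i : ↥(T' \ T), ((i : Fin n) : ℕ) < ((e i : Fin n) : ℕ) := by
      intro i
      have hi := Finset.mem_sdiff.mp i.2
      have hei := Finset.mem_sdiff.mp (e i).2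
      rcases h _ hei.1 with h3 | h3
      · exact absurd h3 hei.2
      · exact h3 _ hi.1
    obtain ⟨u, hu⟩ := hT'ne
    exact Finset.sum_lt_sum (fun i _ => (key i).le) ⟨⟨u, hu⟩, Finset.mem_univ _, key _⟩
  have h3 := Finset.sum_sdiff (f := fun t : Fin n => (t : ℕ)) (Finset.inter_subset_left : T ∩ T' ⊆ T)
  have h4 := Finset.sum_sdiff (f := fun t : Fin n => (t : ℕ)) (Finset.inter_subset_left : T' ∩ T ⊆ T')
  rw [Finset.sdiff_inter_self_left] at h3 h4
  rw [Finset.inter_comm T' T] at h4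
  omega

lemma ubt_comb (d n r k : ℕ) (hr : 1 ≤ r) (hdk : d ≤ k) (hk : k ≤ d + r - 1)
    (Q : Fin n → Set (EuclideanSpace ℝ (Fin d)))
    (xm : Finset (Fin n) → EuclideanSpace ℝ (Fin d))
    (A0 : EuclideanSpace ℝ (Fin d) → Finset (Fin n))
    (h1 : ∀ S : Finset (Fin n), (∃ x, ∀ i ∈ S, x ∈ Q i) →
      (∀ i ∈ S, xm S ∈ Q i) ∧ ∀ y, (∀ i ∈ S, y ∈ Q i) → ‖xm S‖ ≤ ‖y‖ ∧ (‖y‖ = ‖xm S‖ → y = xm S))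
    (h2 : ∀ S : Finset (Fin n), (∃ x, ∀ i ∈ S, x ∈ Q i) → A0 (xm S) ⊆ S ∧ (A0 (xm S)).card ≤ d)
    (h3 : ∀ S A : Finset (Fin n), (∃ x, ∀ i ∈ S, x ∈ Q i) → A0 (xm S) ⊆ A → A ⊆ S → xm A = xm S)
    (hN : ∀ S : Finset (Fin n), (∃ x, ∀ i ∈ S, x ∈ Q i) → S.card ≤ d + r) :
    (((Finset.univ : Finset (Fin n)).powersetCard (k + 1)).filter
        (fun S => ∃ x, ∀ i ∈ S, x ∈ Q i)).card ≤
      ∑ j ∈ Finset.Icc k (d + r - 1), (j - d).choose (k - d) * (n - j + d - 1).choose d := by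
  let M : Finset (Fin n) → Finset (Fin n) := fun A => Finset.univ.filter (fun i => xm A ∈ Q i ∧
    (i ∈ A ∨ ∀ t ∈ A \ A0 (xm A), t < i))
  let ρ : Finset (Fin n) → Lex (ℝ × ℕ) := fun A =>
    toLex (-‖xm A‖, ∑ t ∈ A \ A0 (xm A), (t : ℕ))
  refine ubt_core d n r k hr hdk hk _
    (Finset.univ.filter (fun A => A.card = d ∧ ∃ x, ∀ i ∈ A, x ∈ Q i)) M ρ ?_ ?_ ?_ ?_ ?_
  · intro A hA
    exact (Finset.mem_filter.mp hA).2.1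
  · intro A hA i hi
    have hA := (Finset.mem_filter.mp hA).2.2
    simp only [M, Finset.mem_filter, Finset.mem_univ, true_and]
    exact ⟨(h1 A hA).1 i hi, Or.inl hi⟩
  · intro A hA
    apply hN
    refine ⟨xm A, fun i hi => ?_⟩
    simp only [M, Finset.mem_filter] at hi
    exact hi.2.1
  · intro A hA A' hA' hne hsub
    have hA := (Finset.mem_filter.mp hA).2
    have hA' := (Finset.mem_filter.mp hA').2
    have hmem : ∀ i ∈ A, xm A' ∈ Q i ∧ (i ∈ A' ∨ ∀ t ∈ A' \ A0 (xm A'), t < i) := by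
      intro i hi
      have := hsub hi
      simp only [M, Finset.mem_filter] at this
      exact this.2
    have hx := (h1 A hA.2).2 (xm A') (fun i hi => (hmem i hi).1)
    simp only [ρ, Prod.Lex.toLex_lt_toLex]
    rcases hx.1.lt_or_eq with hlt | heq
    · left; simpa using hlt
    · right
      have hxx := hx.2 heq.symm
      refine ⟨by rw [heq], ?_⟩
      rw [hxx] at hmem ⊢
      have hs := (h2 A hA.2).1
      have hs' := (h2 A' hA'.2).1
      rw [hxx] at hs'
      apply ubt_sum_lt
      · rw [Finset.card_sdiff_of_subset hs, Finset.card_sdiff_of_subset hs', hA.1, hA'.1]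
      · intro he
        apply hne
        rw [← Finset.sdiff_union_of_subset hs, he, Finset.sdiff_union_of_subset hs']
      · intro t ht
        rw [Finset.mem_sdiff] at ht
        rcases (hmem t ht.1).2 with h | h
        · left; exact Finset.mem_sdiff.mpr ⟨h, ht.2⟩
        · right; exact h
  · intro S hS hcS
    obtain ⟨hs, hc⟩ := h2 S hS
    obtain ⟨T, hTU, hT, hlt⟩ := ubt_small (S \ A0 (xm S)) (d - (A0 (xm S)).card) (by
      rw [Finset.card_sdiff_of_subset hs]; omega)
    have hAS : A0 (xm S) ∪ T ⊆ S := Finset.union_subset hs (hTU.trans Finset.sdiff_subset)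
    have hdisj : Disjoint (A0 (xm S)) T := by
      rw [Finset.disjoint_right]
      intro t ht
      exact (Finset.mem_sdiff.mp (hTU ht)).2
    have hxA : xm (A0 (xm S) ∪ T) = xm S := h3 S _ hS Finset.subset_union_left hAS
    refine ⟨A0 (xm S) ∪ T, ?_, hAS, ?_⟩
    · simp only [Finset.mem_filter, Finset.mem_univ, true_and]
      refine ⟨by rw [Finset.card_union_of_disjoint hdisj, hT]; omega, ?_⟩
      obtain ⟨x, hx⟩ := hS
      exact ⟨x, fun i hi => hx i (hAS hi)⟩
    · intro i hi
      simp only [M, Finset.mem_filter, Finset.mem_univ, true_and, hxA]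
      refine ⟨(h1 S hS).1 i hi, ?_⟩
      by_cases hiA : i ∈ A0 (xm S) ∪ T
      · exact Or.inl hiA
      · right
        intro t ht
        rw [Finset.mem_union, not_or] at hiA
        have ht' : t ∈ T := by
          rw [Finset.mem_sdiff, Finset.mem_union] at ht
          tauto
        exact hlt t ht' i (Finset.mem_sdiff.mpr ⟨hi, hiA.1⟩) hiA.2

lemma ubt_kkt {E : Type} [NormedAddCommGroup E] [InnerProductSpace ℝ E] [FiniteDimensional ℝ E]
    {J : Type} [Fintype J] (a : J → E) (b : J → ℝ) (R : J → Prop) (x : E)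
    (hgen : LinearIndepOn ℝ a {j | inner ℝ (a j) x = b j})
    (hx : ∀ j, R j → inner ℝ (a j) x ≤ b j)
    (hmin : ∀ y, (∀ j, R j → inner ℝ (a j) y ≤ b j) → inner ℝ x x ≤ inner ℝ x y) :
    ∃ l : J → ℝ, (∀ j, 0 ≤ l j) ∧ (∀ j, l j ≠ 0 → R j ∧ inner ℝ (a j) x = b j) ∧
      ∑ j, l j • a j = -x := by
  let T : Finset J := Finset.univ.filter (fun j => R j ∧ inner ℝ (a j) x = b j)
  have hT : LinearIndepOn ℝ a (T : Set J) := by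
    apply hgen.mono
    intro j hj
    simp only [T, Finset.coe_filter, Set.mem_setOf_eq] at hj
    exact hj.2.2
  have hvar : ∀ v, (∀ j ∈ T, inner ℝ (a j) v ≤ 0) → 0 ≤ inner ℝ x v := by
    intro v hv
    have hev : ∀ᶠ e : ℝ in nhdsWithin 0 (Set.Ioi 0), ∀ j, R j → inner ℝ (a j) (x + e • v) ≤ b j := by
      rw [Filter.eventually_all]
      intro j
      by_cases hj : R j ∧ inner ℝ (a j) x = b j
      · filter_upwards [self_mem_nhdsWithin] with e he _
        rw [inner_add_right, inner_smul_right, hj.2]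
        have h1 := hv j (by simpa [T] using hj)
        have h2 : (0:ℝ) < e := he
        nlinarith
      · by_cases hR : R j
        · have hlt : inner ℝ (a j) x < b j := lt_of_le_of_ne (hx j hR) (fun h => hj ⟨hR, h⟩)
          have hcont : Continuous (fun e : ℝ => inner ℝ (a j) (x + e • v)) := by fun_prop
          have h0 : inner ℝ (a j) (x + (0:ℝ) • v) < b j := by simpa using hlt
          have := (hcont.tendsto 0).eventually (gt_mem_nhds h0)
          filter_upwards [nhdsWithin_le_nhds this] with e he _
          exact he.le
        · exact Filter.Eventually.of_forall (fun e h => absurd h hR)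
    obtain ⟨e, he, hpos⟩ := (hev.and self_mem_nhdsWithin).exists
    have h2 : (0:ℝ) < e := hpos
    have h1 := hmin _ he
    rw [inner_add_right, inner_smul_right] at h1
    have h3 : 0 ≤ e * inner ℝ x v := by linarith
    exact nonneg_of_mul_nonneg_right h3 h2
  have hspan : x ∈ Submodule.span ℝ (a '' (T : Set J)) := by
    obtain ⟨y, hy, z, hz, hxyz⟩ := (Submodule.span ℝ (a '' (T : Set J))).exists_add_mem_mem_orthogonal x
    have h1 := hvar (-z) (by
      intro j hj
      rw [inner_neg_right, (Submodule.mem_orthogonal _ _).mp hz (a j) (Submodule.subset_span ⟨j, hj, rfl⟩)]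
      simp)
    rw [hxyz, inner_neg_right, inner_add_left, (Submodule.mem_orthogonal _ _).mp hz y hy, zero_add] at h1
    have h2 : inner ℝ z z = 0 := le_antisymm (by linarith) real_inner_self_nonneg
    rw [inner_self_eq_zero] at h2
    rw [hxyz, h2, add_zero]
    exact hy
  obtain ⟨c, hc⟩ := (Submodule.mem_span_image_finset_iff_exists_fun' ℝ).mp hspan
  have hcx : ∀ v, inner ℝ x v = ∑ j ∈ T, c j * inner ℝ (a j) v := by
    intro v
    rw [← hc, sum_inner]
    simp [inner_smul_left]
  have hneg : ∀ k ∈ T, c k ≤ 0 := by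
    intro k hk
    have hk' := hT.notMem_span (i := k) hk
    obtain ⟨y, hy, z, hz, hxyz⟩ := (Submodule.span ℝ (a '' ((T : Set J) \ {k}))).exists_add_mem_mem_orthogonal (a k)
    have hzne : z ≠ 0 := by
      rintro rfl
      rw [add_zero] at hxyz
      exact hk' (hxyz ▸ hy)
    have hpos : 0 < inner ℝ z z := real_inner_self_pos.mpr hzne
    have hj0 : ∀ j ∈ T, j ≠ k → inner ℝ (a j) z = 0 := fun j hj hjk =>
      (Submodule.mem_orthogonal _ _).mp hz (a j) (Submodule.subset_span ⟨j, ⟨hj, hjk⟩, rfl⟩)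
    have hk0 : inner ℝ (a k) z = inner ℝ z z := by
      rw [hxyz, inner_add_left, (Submodule.mem_orthogonal _ _).mp hz y hy, zero_add]
    have h1 := hvar (-z) (by
      intro j hj
      rw [inner_neg_right]
      by_cases hjk : j = k
      · rw [hjk, hk0]; linarith
      · rw [hj0 j hj hjk]; simp)
    rw [inner_neg_right, hcx, Finset.sum_eq_single k, hk0] at h1
    · nlinarith
    · intro j hj hjk
      rw [hj0 j hj hjk, mul_zero]
    · intro h; exact absurd hk h
  refine ⟨fun j => if j ∈ T then - c j else 0, ?_, ?_, ?_⟩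
  · intro j
    dsimp only
    split_ifs with h
    · linarith [hneg j h]
    · exact le_refl _
  · intro j hj
    have : j ∈ T := by
      by_contra h
      simp [h] at hj
    simpa [T] using this
  · simp only [ite_smul, zero_smul, Finset.sum_ite_mem, Finset.univ_inter]
    rw [← hc, ← Finset.sum_neg_distrib]
    simp

lemma ubt_sys (d n : ℕ) {J : Type} [Fintype J] (own : J → Fin n)
    (a : J → EuclideanSpace ℝ (Fin d)) (b : J → ℝ)
    (hgen : ∀ x, LinearIndepOn ℝ a {j | inner ℝ (a j) x = b j})
    (Q : Fin n → Set (EuclideanSpace ℝ (Fin d)))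
    (hQ : ∀ i, Q i = {x | ∀ j, own j = i → inner ℝ (a j) x ≤ b j}) :
    ∃ (xm : Finset (Fin n) → EuclideanSpace ℝ (Fin d))
    (A0 : EuclideanSpace ℝ (Fin d) → Finset (Fin n)),
    (∀ S : Finset (Fin n), (∃ x, ∀ i ∈ S, x ∈ Q i) →
      (∀ i ∈ S, xm S ∈ Q i) ∧ ∀ y, (∀ i ∈ S, y ∈ Q i) → ‖xm S‖ ≤ ‖y‖ ∧ (‖y‖ = ‖xm S‖ → y = xm S)) ∧
    (∀ S : Finset (Fin n), (∃ x, ∀ i ∈ S, x ∈ Q i) → A0 (xm S) ⊆ S ∧ (A0 (xm S)).card ≤ d) ∧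
    (∀ S A : Finset (Fin n), (∃ x, ∀ i ∈ S, x ∈ Q i) → A0 (xm S) ⊆ A → A ⊆ S → xm A = xm S) := by
  have hQmem : ∀ (S : Finset (Fin n)) x, (∀ i ∈ S, x ∈ Q i) ↔ ∀ j, own j ∈ S → inner ℝ (a j) x ≤ b j := by
    intro S x
    simp only [hQ, Set.mem_setOf_eq]
    constructor
    · intro h j hj; exact h _ hj j rfl
    · intro h i hi j hj; exact h j (hj ▸ hi)
  have hex : ∀ S : Finset (Fin n), (∃ x, ∀ i ∈ S, x ∈ Q i) →
      ∃ x, (∀ i ∈ S, x ∈ Q i) ∧ ∀ y, (∀ i ∈ S, y ∈ Q i) → inner ℝ x x ≤ inner ℝ x y := by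
    intro S hS
    have hconv : Convex ℝ {x | ∀ j, own j ∈ S → inner ℝ (a j) x ≤ b j} := by
      simp only [Set.setOf_forall]
      refine convex_iInter fun j => convex_iInter fun _ => ?_
      exact convex_halfSpace_le (innerₗ _ (a j)).isLinear _
    have hclosed : IsClosed {x | ∀ j, own j ∈ S → inner ℝ (a j) x ≤ b j} := by
      simp only [Set.setOf_forall]
      refine isClosed_iInter fun j => isClosed_iInter fun _ => ?_
      exact isClosed_le (by fun_prop) continuous_const
    obtain ⟨x₀, hx₀⟩ := hS
    obtain ⟨x, hx, hxi⟩ := exists_norm_eq_iInf_of_complete_convex (K := {x | ∀ j, own j ∈ S → inner ℝ (a j) x ≤ b j})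
      ⟨x₀, (hQmem S x₀).mp hx₀⟩ hclosed.isComplete hconv 0
    rw [norm_eq_iInf_iff_real_inner_le_zero hconv hx] at hxi
    refine ⟨x, (hQmem S x).mpr hx, fun y hy => ?_⟩
    have := hxi y ((hQmem S y).mp hy)
    rw [zero_sub, inner_neg_left, inner_sub_right] at this
    linarith
  have hprop : ∀ x y : EuclideanSpace ℝ (Fin d), inner ℝ x x ≤ inner ℝ x y →
      ‖x‖ ≤ ‖y‖ ∧ (‖y‖ = ‖x‖ → y = x) := by
    intro x y h
    have e := norm_sub_sq_real y x
    rw [real_inner_self_eq_norm_sq] at h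
    rw [real_inner_comm] at e
    constructor
    · apply le_of_sq_le_sq _ (norm_nonneg y)
      nlinarith [sq_nonneg ‖y - x‖]
    · intro h2
      rw [h2] at e
      have : ‖y - x‖ = 0 := by
        have : ‖y - x‖ ^ 2 ≤ 0 := by linarith
        nlinarith [norm_nonneg (y - x)]
      exact sub_eq_zero.mp (norm_eq_zero.mp this)
  let xm : Finset (Fin n) → EuclideanSpace ℝ (Fin d) := fun S =>
    if h : (∃ x, ∀ i ∈ S, x ∈ Q i) then Classical.choose (hex S h) else 0
  have hxm : ∀ S : Finset (Fin n), (∃ x, ∀ i ∈ S, x ∈ Q i) → (∀ i ∈ S, xm S ∈ Q i) ∧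
      ∀ y, (∀ i ∈ S, y ∈ Q i) → inner ℝ (xm S) (xm S) ≤ inner ℝ (xm S) y := by
    intro S h
    simp only [xm, dif_pos h]
    exact Classical.choose_spec (hex S h)
  let cert : EuclideanSpace ℝ (Fin d) → (J → ℝ) → Prop := fun x l =>
    (∀ j, 0 ≤ l j) ∧ (∀ j, l j ≠ 0 → inner ℝ (a j) x = b j) ∧ ∑ j, l j • a j = -x
  have huniq : ∀ x l l', cert x l → cert x l' → l = l' := by
    rintro x l l' ⟨_, h1, h2⟩ ⟨_, h1', h2'⟩
    have hg : LinearIndepOn ℝ a ((Finset.univ.filter (fun j => inner ℝ (a j) x = b j) : Finset J) : Set J) := by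
      convert hgen x
      simp
    rw [linearIndepOn_finset_iffₛ] at hg
    have hz : ∀ l : J → ℝ, (∀ j, l j ≠ 0 → inner ℝ (a j) x = b j) →
        ∑ j ∈ Finset.univ.filter (fun j => inner ℝ (a j) x = b j), l j • a j = ∑ j, l j • a j := by
      intro l hl
      apply Finset.sum_subset (Finset.subset_univ _)
      intro j _ hj
      have : l j = 0 := by
        by_contra h
        exact hj (by simpa using hl j h)
      rw [this, zero_smul]
    have := hg l l' (by rw [hz l h1, hz l' h1', h2, h2'])
    funext j
    by_cases hj : inner ℝ (a j) x = b j
    · exact this j (by simpa using hj)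
    · rw [not_imp_comm.mp (h1 j) hj, not_imp_comm.mp (h1' j) hj]
  let lam : EuclideanSpace ℝ (Fin d) → J → ℝ := fun x =>
    if h : ∃ l, cert x l then Classical.choose h else 0
  have hlam : ∀ x l, cert x l → lam x = l := by
    intro x l hl
    have h : ∃ l, cert x l := ⟨l, hl⟩
    simp only [lam, dif_pos h]
    exact huniq x _ _ (Classical.choose_spec h) hl
  let A0 : EuclideanSpace ℝ (Fin d) → Finset (Fin n) := fun x =>
    (Finset.univ.filter (fun j => lam x j ≠ 0)).image own
  have hS : ∀ S : Finset (Fin n), (∃ x, ∀ i ∈ S, x ∈ Q i) → cert (xm S) (lam (xm S)) ∧ A0 (xm S) ⊆ S := by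
    intro S h
    obtain ⟨hm1, hm2⟩ := hxm S h
    obtain ⟨l, hl0, hl1, hl2⟩ := ubt_kkt a b (fun j => own j ∈ S) (xm S) (hgen _)
      ((hQmem S _).mp hm1) (fun y hy => hm2 y ((hQmem S y).mpr hy))
    have hcert : cert (xm S) l := ⟨hl0, fun j hj => (hl1 j hj).2, hl2⟩
    have := hlam _ _ hcert
    refine ⟨this ▸ hcert, ?_⟩
    intro i hi
    simp only [A0, Finset.mem_image, Finset.mem_filter, Finset.mem_univ, true_and, this] at hi
    obtain ⟨j, hj, rfl⟩ := hi
    exact (hl1 j hj).1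
  refine ⟨xm, A0, fun S h => ⟨(hxm S h).1, fun y hy => hprop _ _ ((hxm S h).2 y hy)⟩,
    fun S h => ⟨(hS S h).2, ?_⟩, ?_⟩
  · refine Finset.card_image_le.trans ?_
    obtain ⟨_, hc, _⟩ := (hS S h).1
    have hli : LinearIndepOn ℝ a ((Finset.univ.filter (fun j => lam (xm S) j ≠ 0) : Finset J) : Set J) := by
      apply (hgen (xm S)).mono
      intro j hj
      simp only [Finset.coe_filter, Set.mem_setOf_eq, Finset.mem_univ, true_and] at hj
      exact hc j hj
    have := LinearIndependent.fintype_card_le_finrank hli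
    simpa using this
  · intro S A h hA0 hAS
    obtain ⟨hl0, hl1, hl2⟩ := (hS S h).1
    have hAx : ∀ i ∈ A, xm S ∈ Q i := fun i hi => (hxm S h).1 i (hAS hi)
    have hmin : ∀ y, (∀ i ∈ A, y ∈ Q i) → inner ℝ (xm S) (xm S) ≤ inner ℝ (xm S) y := by
      intro y hy
      have hy' := (hQmem A y).mp hy
      have hin : ∀ v, inner ℝ (xm S) v = - ∑ j, lam (xm S) j * inner ℝ (a j) v := by
        intro v
        have : xm S = - ∑ j, lam (xm S) j • a j := by rw [hl2, neg_neg]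
        conv_lhs => rw [this]
        rw [inner_neg_left, sum_inner]
        simp [inner_smul_left]
      rw [hin, hin, neg_le_neg_iff]
      apply Finset.sum_le_sum
      intro j _
      by_cases hj : lam (xm S) j = 0
      · rw [hj, zero_mul, zero_mul]
      · apply mul_le_mul_of_nonneg_left _ (hl0 j)
        rw [hl1 j hj]
        apply hy'
        apply hA0
        simp only [A0, Finset.mem_image, Finset.mem_filter, Finset.mem_univ, true_and]
        exact ⟨j, hj, rfl⟩
    have hAne : ∃ x, ∀ i ∈ A, x ∈ Q i := ⟨xm S, hAx⟩
    have e1 := hprop _ _ ((hxm A hAne).2 _ hAx)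
    have e2 := hprop _ _ (hmin _ (hxm A hAne).1)
    exact (e1.2 (le_antisymm e2.1 e1.1)).symm

/-- Generic perturbation of the right-hand sides. -/
lemma ubt_generic {E : Type} [NormedAddCommGroup E] [InnerProductSpace ℝ E]
    {J : Type} [Fintype J] (a : J → E) (b : J → ℝ) (δ : ℝ) (hδ : 0 < δ) :
    ∃ b' : J → ℝ, (∀ j, b j ≤ b' j ∧ b' j ≤ b j + δ) ∧
      ∀ x, LinearIndepOn ℝ a {j | inner ℝ (a j) x = b' j} := by
  let e := Fintype.equivFin J
  have hμ : ∀ T : Finset J, ∃ μ : J → ℝ, ¬ LinearIndepOn ℝ a (T : Set J) →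
      (∑ j ∈ T, μ j • a j = 0 ∧ ∃ j ∈ T, μ j ≠ 0) := by
    intro T
    by_cases h : LinearIndepOn ℝ a (T : Set J)
    · exact ⟨0, fun h' => absurd h h'⟩
    · obtain ⟨μ, h1⟩ := not_linearIndepOn_finset_iff.mp h
      exact ⟨μ, fun _ => h1⟩
  choose μ hμ using hμ
  let p : Finset J → Polynomial ℝ := fun T =>
    ∑ j ∈ T, Polynomial.C (μ T j) * (Polynomial.C (b j) + Polynomial.X ^ ((e j : ℕ) + 1))
  have hp : ∀ T : Finset J, ¬ LinearIndepOn ℝ a (T : Set J) → p T ≠ 0 := by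
    intro T hT h0
    obtain ⟨_, j, hj, hne⟩ := hμ T hT
    have hc := congrArg (fun q => Polynomial.coeff q ((e j : ℕ) + 1)) h0
    simp only [p, Polynomial.finset_sum_coeff, Polynomial.coeff_C_mul, Polynomial.coeff_add,
      Polynomial.coeff_C_succ, Polynomial.coeff_X_pow, zero_add, Polynomial.coeff_zero] at hc
    rw [Finset.sum_eq_single j] at hc
    · simp at hc; exact hne hc
    · intro i _ hij
      rw [if_neg, mul_zero]
      intro h
      exact hij (e.injective (Fin.ext (by omega))).symm
    · intro h; exact absurd hj h
  obtain ⟨t, ht, htn⟩ := (Set.Ioo_infinite (show (0:ℝ) < min δ 1 by positivity)).exists_notMem_finset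
    (Finset.univ.biUnion (fun T => (p T).roots.toFinset))
  obtain ⟨ht0, ht1⟩ := ht
  rw [lt_min_iff] at ht1
  refine ⟨fun j => b j + t ^ ((e j : ℕ) + 1), fun j => ⟨?_, ?_⟩, ?_⟩
  · have := pow_pos ht0 ((e j : ℕ) + 1)
    linarith
  · have : t ^ ((e j : ℕ) + 1) ≤ t := by
      rw [pow_succ]
      exact mul_le_of_le_one_left ht0.le (pow_le_one₀ ht0.le ht1.2.le)
    linarith [ht1.1]
  · intro x
    by_contra hcon
    let T : Finset J := Finset.univ.filter (fun j => inner ℝ (a j) x = b j + t ^ ((e j : ℕ) + 1))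
    have hT : ¬ LinearIndepOn ℝ a (T : Set J) := by
      convert hcon
      simp [T]
    obtain ⟨h1, -⟩ := hμ T hT
    apply htn
    simp only [Finset.mem_biUnion, Finset.mem_univ, true_and, Multiset.mem_toFinset]
    refine ⟨T, ?_⟩
    rw [Polynomial.mem_roots (hp T hT), Polynomial.IsRoot.def]
    simp only [p, Polynomial.eval_finset_sum, Polynomial.eval_mul, Polynomial.eval_C,
      Polynomial.eval_add, Polynomial.eval_pow, Polynomial.eval_X]
    have h2 := congrArg (fun v => inner ℝ v x) h1
    simp only [sum_inner, inner_smul_left, inner_zero_left] at h2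
    rw [← h2]
    apply Finset.sum_congr rfl
    intro j hj
    have : inner ℝ (a j) x = b j + t ^ ((e j : ℕ) + 1) := by simpa [T] using hj
    rw [this]; simp

/-- Simultaneous separation of compact convex sets with empty intersection. -/
lemma ubt_sep {E : Type} [NormedAddCommGroup E] [InnerProductSpace ℝ E] [FiniteDimensional ℝ E]
    {ι : Type} [Fintype ι] (K : ι → Set E) (hK : ∀ i, IsCompact (K i))
    (hconv : ∀ i, Convex ℝ (K i)) (hempty : ¬ ∃ x, ∀ i, x ∈ K i) :
    ∃ (a : ι → E) (b : ι → ℝ), (∀ i, ∀ x ∈ K i, inner ℝ (a i) x ≤ b i) ∧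
      ∑ i, a i = 0 ∧ ∑ i, b i < 0 := by
  by_cases hne : ∃ i, ¬ (K i).Nonempty
  · obtain ⟨i₀, hi₀⟩ := hne
    rw [Set.not_nonempty_iff_eq_empty] at hi₀
    refine ⟨0, fun i => if i = i₀ then -1 else 0, ?_, by simp, by simp⟩
    intro i x hx
    have : i ≠ i₀ := by rintro rfl; rw [hi₀] at hx; exact hx
    simp [this]
  push Not at hne
  have hne' : Nonempty ι ∨ IsEmpty ι := (isEmpty_or_nonempty ι).symm
  rcases hne' with hι | hι
  swap
  · exact absurd ⟨0, fun i => (hι.false i).elim⟩ hempty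
  let D : Submodule ℝ (ι → E) := LinearMap.range (LinearMap.pi (fun _ : ι => (LinearMap.id : E →ₗ[ℝ] E)))
  have hdisj : Disjoint (Set.univ.pi K) (D : Set (ι → E)) := by
    rw [Set.disjoint_left]
    rintro y hy ⟨x, rfl⟩
    exact hempty ⟨x, fun i => hy i (Set.mem_univ i)⟩
  obtain ⟨f, u, v, hfu, huv, hfv⟩ := geometric_hahn_banach_compact_closed
    (convex_pi (fun i _ => hconv i)) (isCompact_univ_pi hK) D.convex D.closed_of_finiteDimensional hdisj
  have hD : ∀ y ∈ D, f y = 0 := by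
    intro y hy
    by_contra h
    have h1 := hfv ((v / f y) • y) (D.smul_mem _ hy)
    rw [map_smul, smul_eq_mul, div_mul_cancel₀ _ h] at h1
    exact lt_irrefl _ h1
  have hv : v < 0 := by simpa using hfv 0 D.zero_mem
  let g : ι → StrongDual ℝ E := fun i => f.comp (ContinuousLinearMap.single ℝ (fun _ : ι => E) i)
  have hfg : ∀ y : ι → E, f y = ∑ i, g i (y i) := by
    intro y
    conv_lhs => rw [← Finset.univ_sum_single y]
    rw [map_sum]
    rfl
  let a : ι → E := fun i => (InnerProductSpace.toDual ℝ E).symm (g i)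
  have ha : ∀ i x, inner ℝ (a i) x = g i x := fun i x => InnerProductSpace.toDual_symm_apply
  have hmax : ∀ i, ∃ z ∈ K i, ∀ x ∈ K i, inner ℝ (a i) x ≤ inner ℝ (a i) z := by
    intro i
    obtain ⟨z, hz, hzm⟩ := (hK i).exists_isMaxOn (hne i)
      (f := fun x => inner ℝ (a i) x) (by fun_prop)
    exact ⟨z, hz, fun x hx => hzm hx⟩
  choose z hz hzm using hmax
  refine ⟨a, fun i => inner ℝ (a i) (z i), hzm, ?_, ?_⟩
  · apply ext_inner_right ℝ
    intro x
    rw [sum_inner, inner_zero_left]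
    simp only [ha]
    rw [← hfg (fun _ => x)]
    exact hD _ ⟨x, rfl⟩
  · simp only [ha]
    rw [← hfg z]
    have := hfu z (fun i _ => hz i)
    linarith

/-- Replace the nerve of convex sets by the nerve of generic polyhedra. -/
lemma ubt_reduce (d n : ℕ) (K : Fin n → Set (EuclideanSpace ℝ (Fin d)))
    (hconv : ∀ i, Convex ℝ (K i)) :
    ∃ (a : Finset (Fin n) × Fin n → EuclideanSpace ℝ (Fin d)) (b : Finset (Fin n) × Fin n → ℝ),
      (∀ x, LinearIndepOn ℝ a {j | inner ℝ (a j) x = b j}) ∧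
      ∀ S : Finset (Fin n), (∃ x, ∀ i ∈ S, x ∈ {x | ∀ j, j.2 = i → inner ℝ (a j) x ≤ b j}) ↔
        (∃ x, ∀ i ∈ S, x ∈ K i) := by
  have hp : ∀ S : Finset (Fin n), ∃ x, (∃ x, ∀ i ∈ S, x ∈ K i) → ∀ i ∈ S, x ∈ K i := by
    intro S
    by_cases h : ∃ x, ∀ i ∈ S, x ∈ K i
    · obtain ⟨x, hx⟩ := h
      exact ⟨x, fun _ => hx⟩
    · exact ⟨0, fun h' => absurd h' h⟩
  choose p hp using hp
  let K' : Fin n → Set (EuclideanSpace ℝ (Fin d)) := fun i =>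
    convexHull ℝ (p '' {S | i ∈ S ∧ ∃ x, ∀ i ∈ S, x ∈ K i})
  have hK'c : ∀ i, IsCompact (K' i) := fun i =>
    ((Set.toFinite _).image p).isCompact_convexHull ℝ
  have hK'K : ∀ i, K' i ⊆ K i := by
    intro i
    apply convexHull_min _ (hconv i)
    rintro _ ⟨S, ⟨hi, hS⟩, rfl⟩
    exact hp S hS i hi
  have hpK' : ∀ S : Finset (Fin n), (∃ x, ∀ i ∈ S, x ∈ K i) → ∀ i ∈ S, p S ∈ K' i := by
    intro S hS i hi
    exact subset_convexHull ℝ _ ⟨S, ⟨hi, hS⟩, rfl⟩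
  have hsep : ∀ S : Finset (Fin n), ∃ (a : Fin n → EuclideanSpace ℝ (Fin d)) (b : Fin n → ℝ),
      (∀ i, ∀ x ∈ K' i, inner ℝ (a i) x ≤ b i) ∧
      ((¬ ∃ x, ∀ i ∈ S, x ∈ K i) → ∑ i ∈ S, a i = 0 ∧ ∑ i ∈ S, b i < 0) := by
    intro S
    by_cases h : ∃ x, ∀ i ∈ S, x ∈ K i
    · exact ⟨0, 0, by simp, fun h' => absurd h h'⟩
    · obtain ⟨a, b, h1, h2, h3⟩ := ubt_sep (fun i : S => K' i) (fun i => hK'c i)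
        (fun i => convex_convexHull ℝ _) (by
          rintro ⟨x, hx⟩
          exact h ⟨x, fun i hi => hK'K i (hx ⟨i, hi⟩)⟩)
      refine ⟨fun i => if hi : i ∈ S then a ⟨i, hi⟩ else 0, fun i => if hi : i ∈ S then b ⟨i, hi⟩ else 0, ?_, fun _ => ⟨?_, ?_⟩⟩
      · intro i x hx
        by_cases hi : i ∈ S
        · simp only [dif_pos hi]
          exact h1 ⟨i, hi⟩ x hx
        · simp [hi]
      · rw [← Finset.sum_coe_sort, ← h2]
        exact Finset.sum_congr rfl (fun i _ => by simp)
      · rw [← Finset.sum_coe_sort]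
        refine lt_of_eq_of_lt ?_ h3
        exact Finset.sum_congr rfl (fun i _ => by simp)
  choose a b hab hnon using hsep
  have hδ : ∃ δ : ℝ, 0 < δ ∧ ∀ S : Finset (Fin n), (¬ ∃ x, ∀ i ∈ S, x ∈ K i) →
      ∑ i ∈ S, b S i + S.card * δ < 0 := by
    have hev : ∀ᶠ δ : ℝ in nhdsWithin 0 (Set.Ioi 0), ∀ S : Finset (Fin n),
        (¬ ∃ x, ∀ i ∈ S, x ∈ K i) → ∑ i ∈ S, b S i + S.card * δ < 0 := by
      rw [Filter.eventually_all]
      intro S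
      by_cases hS : ∃ x, ∀ i ∈ S, x ∈ K i
      · exact Filter.Eventually.of_forall (fun _ h => absurd hS h)
      · have hcont : Continuous (fun δ : ℝ => ∑ i ∈ S, b S i + S.card * δ) := by fun_prop
        have h0 : ∑ i ∈ S, b S i + S.card * (0:ℝ) < 0 := by simpa using (hnon S hS).2
        have := (hcont.tendsto 0).eventually (gt_mem_nhds h0)
        filter_upwards [nhdsWithin_le_nhds this] with δ h _
        exact h
    obtain ⟨δ, h, hpos⟩ := (hev.and self_mem_nhdsWithin).exists
    exact ⟨δ, hpos, h⟩
  obtain ⟨δ, hδ0, hδ⟩ := hδ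
  obtain ⟨b', hb', hgen⟩ := ubt_generic (fun j : Finset (Fin n) × Fin n => a j.1 j.2)
    (fun j => b j.1 j.2) δ hδ0
  refine ⟨fun j => a j.1 j.2, b', hgen, fun S => ⟨?_, ?_⟩⟩
  · rintro ⟨x, hx⟩
    by_contra hS
    have h1 : ∑ i ∈ S, inner ℝ (a S i) x ≤ ∑ i ∈ S, (b S i + δ) := by
      apply Finset.sum_le_sum
      intro i hi
      exact (hx i hi (S, i) rfl).trans (hb' (S, i)).2
    rw [← sum_inner, (hnon S hS).1, inner_zero_left, Finset.sum_add_distrib, Finset.sum_const,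
      nsmul_eq_mul] at h1
    exact absurd (hδ S hS) (not_lt.mpr h1)
  · intro hS
    refine ⟨p S, fun i hi j hj => ?_⟩
    subst hj
    exact (hab j.1 j.2 _ (hpK' S hS _ hi)).trans (hb' j).1

/-- **The upper bound theorem** for families of convex sets (Kalai, Eckhoff; conjectured by
Katchalski and Perles). If every `d+r+1` members of a family of `n` convex sets in `ℝ^d`
have empty intersection, then for `d ≤ k ≤ d+r-1` the number of intersecting
`(k+1)`-element subfamilies is at most
`∑_{j=k}^{d+r-1} C(j-d, k-d) · C(n-j+d-1, d)`. -/
theorem upper_bound_theorem (d n r : ℕ) (hr : 1 ≤ r)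
    (K : Fin n → Set (EuclideanSpace ℝ (Fin d)))
    (hconv : ∀ i, Convex ℝ (K i))
    (hempty : ∀ S : Finset (Fin n), S.card = d + r + 1 → (⋂ i ∈ S, K i) = ∅) :
    ∀ k : ℕ, d ≤ k → k ≤ d + r - 1 →
      (((Finset.univ : Finset (Fin n)).powersetCard (k + 1)).filter
        (fun S => (⋂ i ∈ S, K i).Nonempty)).card ≤
      ∑ j ∈ Finset.Icc k (d + r - 1), (j - d).choose (k - d) * (n - j + d - 1).choose d := by
  intro k hdk hk
  obtain ⟨a, b, hgen, hiff⟩ := ubt_reduce d n K hconv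
  obtain ⟨xm, A0, h1, h2, h3⟩ := ubt_sys d n (fun j : Finset (Fin n) × Fin n => j.2) a b hgen
    (fun i => {x | ∀ j, j.2 = i → inner ℝ (a j) x ≤ b j}) (fun i => rfl)
  have hnon : ∀ S : Finset (Fin n), (⋂ i ∈ S, K i).Nonempty ↔
      ∃ x, ∀ i ∈ S, x ∈ {x | ∀ j : Finset (Fin n) × Fin n, j.2 = i → inner ℝ (a j) x ≤ b j} := by
    intro S
    rw [hiff S]
    simp only [Set.Nonempty, Set.mem_iInter]
  have hN : ∀ S : Finset (Fin n), (∃ x, ∀ i ∈ S, x ∈ {x | ∀ j : Finset (Fin n) × Fin n,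
      j.2 = i → inner ℝ (a j) x ≤ b j}) → S.card ≤ d + r := by
    intro S hS
    by_contra hlt
    obtain ⟨T, hTS, hT⟩ := Finset.exists_subset_card_eq (show d + r + 1 ≤ S.card by omega)
    obtain ⟨x, hx⟩ := (hnon S).mpr hS
    have hxT : x ∈ ⋂ i ∈ T, K i := by
      simp only [Set.mem_iInter] at hx ⊢
      exact fun i hi => hx i (hTS hi)
    rw [hempty T hT] at hxT
    exact hxT
  have := ubt_comb d n r k hr hdk hk _ xm A0 h1 h2 h3 hN
  simpa only [hnon] using this
end

section
/- Let K = {K_1, ..., K_n} and K' = {K'_1, ..., K'_n} be two families of n compact convex sets in ℝ^d. For J ⊆ {1,...,n} write d_K(J) for the dimension of ⋂_{j∈J} K_j and d_{K'}(J) for the dimension of ⋂_{j∈J} K'_j. If d_K(J) = d_{K'}(J) for every J ⊆ {1,...,n} with |J| ≤ d+1, then d_K(J) = d_{K'}(J) for every J ⊆ {1,...,n}. -/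
set_option linter.unusedSectionVars false

open scoped Classical in
/-- The dimension of a convex set in `ℝ^d`: the dimension of its affine hull, with the
convention that the empty set has dimension `-1`. -/
noncomputable def convexSetDim (d : ℕ) (s : Set (EuclideanSpace ℝ (Fin d))) : ℤ :=
  if s.Nonempty then (Module.finrank ℝ (affineSpan ℝ s).direction : ℤ) else -1



namespace Katch

section Supp
variable {ι : Type} [Fintype ι] [DecidableEq ι]

/-- `S` is the support of a nonnegative element of `L`. -/
def NSupp (L : Submodule ℝ (ι → ℝ)) (S : Finset ι) : Prop :=
  ∃ l ∈ L, (∀ i ∈ S, 0 < l i) ∧ ∀ i ∉ S, l i = 0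

/-- `S` is a minimal nonempty nonnegative support. -/
def MSupp (L : Submodule ℝ (ι → ℝ)) (S : Finset ι) : Prop :=
  S.Nonempty ∧ NSupp L S ∧ ∀ T ⊆ S, T.Nonempty → NSupp L T → T = S

lemma NSupp.of_nonneg {L : Submodule ℝ (ι → ℝ)} {l : ι → ℝ} (hl : l ∈ L) (h0 : ∀ i, 0 ≤ l i) :
    NSupp L (Finset.univ.filter fun i => l i ≠ 0) := by
  refine ⟨l, hl, ?_, ?_⟩
  · intro i hi
    exact lt_of_le_of_ne (h0 i) (Ne.symm (by simpa using hi))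
  · intro i hi
    simpa using hi

lemma exists_msupp {L : Submodule ℝ (ι → ℝ)} {S : Finset ι} (hS : S.Nonempty) (h : NSupp L S) :
    ∃ v ⊆ S, MSupp L v := by
  induction S using Finset.strongInduction with
  | H S ih =>
    by_cases hm : MSupp L S
    · exact ⟨S, subset_rfl, hm⟩
    · have : ∃ T ⊆ S, T.Nonempty ∧ NSupp L T ∧ T ≠ S := by
        by_contra hc
        push Not at hc
        exact hm ⟨hS, h, fun T hT hn hs => hc T hT hn hs⟩
      obtain ⟨T, hT, hn, hs, hne⟩ := this
      obtain ⟨v, hv, hm⟩ := ih T (lt_of_le_of_ne hT hne) hn hs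
      exact ⟨v, hv.trans hT, hm⟩

/-- Subtract the largest possible multiple. -/
lemma exists_sub {S T : Finset ι} (hT : T.Nonempty) (hTS : T ⊆ S) {l r : ι → ℝ}
    (hl : ∀ i ∈ S, 0 < l i) (hr : ∀ i ∈ T, 0 < r i) (hr0 : ∀ i ∉ T, r i = 0) :
    ∃ a > 0, (∀ i ∈ S, 0 ≤ l i - a * r i) ∧ ∃ j ∈ T, l j - a * r j = 0 := by
  obtain ⟨j, hj, hmin⟩ := T.exists_min_image (fun i => l i / r i) hT
  have hlj := hl j (hTS hj)
  have hrj := hr j hj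
  refine ⟨l j / r j, by positivity, ?_, j, hj, by field_simp; simp⟩
  intro i hi
  by_cases hiT : i ∈ T
  · have h1 := hmin i hiT
    have := hr i hiT
    have h2 : l j / r j * r i ≤ l i := by
      calc l j / r j * r i ≤ l i / r i * r i := by gcongr
        _ = l i := by field_simp
    linarith
  · rw [hr0 i hiT]; have := hl i hi; simp; linarith

/-- Conformal decomposition. -/
lemma exists_decomp {L : Submodule ℝ (ι → ℝ)} (S : Finset ι) (l : ι → ℝ) (hl : l ∈ L)
    (hpos : ∀ i ∈ S, 0 < l i) (h0 : ∀ i ∉ S, l i = 0) :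
    ∃ f : Finset ι → ι → ℝ, (∀ v, f v ∈ L) ∧
      (∀ v, f v = 0 ∨ (MSupp L v ∧ (∀ i ∈ v, 0 < f v i) ∧ ∀ i ∉ v, f v i = 0)) ∧
      ∑ v, f v = l := by
  induction S using Finset.strongInduction generalizing l with
  | H S ih =>
    rcases S.eq_empty_or_nonempty with rfl | hne
    · refine ⟨0, by simp, by simp, ?_⟩
      funext i; simp [h0 i]
    · obtain ⟨v, hvS, hv⟩ := exists_msupp hne ⟨l, hl, hpos, h0⟩
      obtain ⟨r, hrL, hr, hr0⟩ := hv.2.1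
      obtain ⟨a, ha, hge, j, hj, hj0⟩ := exists_sub hv.1 hvS hpos hr hr0
      have hl' : l - a • r ∈ L := L.sub_mem hl (L.smul_mem _ hrL)
      obtain ⟨f, hfL, hf, hfs⟩ := ih (S.filter fun i => l i - a * r i ≠ 0) (by
          refine Finset.filter_ssubset.2 ⟨j, hvS hj, by simpa using hj0⟩) (l - a • r) hl' (by
          intro i hi
          rw [Finset.mem_filter] at hi
          exact lt_of_le_of_ne (hge i hi.1) (Ne.symm hi.2)) (by
          intro i hi
          rw [Finset.mem_filter] at hi
          by_cases hiS : i ∈ S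
          · simpa [hiS] using hi
          · have : i ∉ v := fun h => hiS (hvS h)
            simp [h0 i hiS, hr0 i this])
      refine ⟨f + Pi.single v (a • r), ?_, ?_, ?_⟩
      · intro u
        by_cases hu : u = v
        · subst hu; simpa using L.add_mem (hfL u) (L.smul_mem a hrL)
        · simpa [hu] using hfL u
      · intro u
        by_cases hu : u = v
        · subst hu
          right
          refine ⟨hv, ?_, ?_⟩
          · intro i hi
            have := mul_pos ha (hr i hi)
            rcases hf u with h | ⟨_, h, _⟩
            · simpa [h] using this
            · have := h i hi; simp; linarith
          · intro i hi
            rcases hf u with h | ⟨_, _, h⟩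
            · simp [h, hr0 i hi]
            · simp [h i hi, hr0 i hi]
        · simpa [hu] using hf u
      · simp [Finset.sum_add_distrib, hfs]

lemma exists_cover {L : Submodule ℝ (ι → ℝ)} {S : Finset ι} (h : NSupp L S) {j : ι} (hj : j ∈ S) :
    ∃ v ⊆ S, MSupp L v ∧ j ∈ v := by
  obtain ⟨l, hl, hpos, h0⟩ := h
  obtain ⟨f, hfL, hf, hfs⟩ := exists_decomp S l hl hpos h0
  have hnn : ∀ v i, 0 ≤ f v i := by
    intro v i
    rcases hf v with h | ⟨_, h, h'⟩
    · simp [h]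
    · by_cases hi : i ∈ v
      · exact (h i hi).le
      · exact (h' i hi).ge
  have : ∃ v, f v j ≠ 0 := by
    by_contra hc
    push Not at hc
    have := congrFun hfs j
    simp [hc] at this
    exact (hpos j hj).ne this
  obtain ⟨v, hv⟩ := this
  rcases hf v with h | ⟨hm, h, h'⟩
  · simp [h] at hv
  refine ⟨v, ?_, hm, ?_⟩
  · intro i hi
    by_contra hiS
    have h1 := congrFun hfs i
    rw [h0 i hiS, Finset.sum_apply, Finset.sum_eq_zero_iff_of_nonneg (fun v _ => hnn v i)] at h1
    exact (h i hi).ne' (h1 v (Finset.mem_univ _))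
  · by_contra hc; exact hv (h' j hc)

lemma nsupp_empty (L : Submodule ℝ (ι → ℝ)) : NSupp L ∅ := ⟨0, L.zero_mem, by simp, by simp⟩

lemma NSupp.union {L : Submodule ℝ (ι → ℝ)} {S T : Finset ι} (hS : NSupp L S) (hT : NSupp L T) :
    NSupp L (S ∪ T) := by
  obtain ⟨l, hl, hp, h0⟩ := hS
  obtain ⟨l', hl', hp', h0'⟩ := hT
  refine ⟨l + l', L.add_mem hl hl', ?_, ?_⟩
  · intro i hi
    have h1 : 0 ≤ l i := by
      by_cases h : i ∈ S
      · exact (hp i h).le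
      · exact (h0 i h).ge
    have h2 : 0 ≤ l' i := by
      by_cases h : i ∈ T
      · exact (hp' i h).le
      · exact (h0' i h).ge
    rcases Finset.mem_union.1 hi with h | h
    · have := hp i h; simp; linarith
    · have := hp' i h; simp; linarith
  · intro i hi
    simp at hi
    simp [h0 i hi.1, h0' i hi.2]

lemma nsupp_of_msupp {L L' : Submodule ℝ (ι → ℝ)} (h : ∀ v, MSupp L v → MSupp L' v)
    {S : Finset ι} (hS : NSupp L S) : NSupp L' S := by
  have key : ∀ U ⊆ S, ∃ W, U ⊆ W ∧ W ⊆ S ∧ NSupp L' W := by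
    intro U
    induction U using Finset.induction_on with
    | empty => intro _; exact ⟨∅, by simp, by simp, nsupp_empty _⟩
    | insert a U ha ih =>
      intro hU
      obtain ⟨W, h1, h2, h3⟩ := ih ((Finset.subset_insert _ _).trans hU)
      obtain ⟨v, hv, hm, hj⟩ := exists_cover hS (hU (Finset.mem_insert_self _ _))
      refine ⟨W ∪ v, ?_, Finset.union_subset h2 hv, h3.union (h v hm).2.1⟩
      intro i hi
      rcases Finset.mem_insert.1 hi with rfl | hi
      · exact Finset.mem_union_right _ hj
      · exact Finset.mem_union_left _ (h1 hi)
  obtain ⟨W, h1, h2, h3⟩ := key S subset_rfl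
  rwa [Finset.Subset.antisymm h1 h2]

/-- vectors supported in `S`. -/
def sup (S : Finset ι) : Submodule ℝ (ι → ℝ) where
  carrier := {l | ∀ i ∉ S, l i = 0}
  add_mem' := by intro a b ha hb i hi; simp [ha i hi, hb i hi]
  zero_mem' := by intro i _; rfl
  smul_mem' := by intro c a ha i hi; simp [ha i hi]

lemma mem_sup {S : Finset ι} {l : ι → ℝ} : l ∈ sup S ↔ ∀ i ∉ S, l i = 0 := Iff.rfl

lemma finrank_step {L : Submodule ℝ (ι → ℝ)} {S T : Finset ι} (hS : NSupp L S) (hT : NSupp L T)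
    (hTS : T ⊂ S) (hmax : ∀ U, T ⊆ U → U ⊂ S → NSupp L U → U = T) :
    Module.finrank ℝ (L ⊓ sup S : Submodule ℝ (ι → ℝ))
      = Module.finrank ℝ (L ⊓ sup T : Submodule ℝ (ι → ℝ)) + 1 := by
  obtain ⟨m, hm, hmp, hm0⟩ := hS
  obtain ⟨r, hr, hrp, hr0⟩ := hT
  obtain ⟨j, hjS, hjT⟩ := Finset.exists_of_ssubset hTS
  have hmT : m ∉ (L ⊓ sup T : Submodule ℝ (ι → ℝ)) := by
    intro h
    exact (hmp j hjS).ne' (h.2 j hjT)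
  have heq : (L ⊓ sup S : Submodule ℝ (ι → ℝ)) = (L ⊓ sup T) ⊔ (Submodule.span ℝ {m}) := by
    apply le_antisymm
    · rintro l ⟨hl, hlS⟩
      obtain ⟨k, hk, hmin⟩ := (S \ T).exists_min_image (fun i => l i / m i)
        ⟨j, Finset.mem_sdiff.2 ⟨hjS, hjT⟩⟩
      rw [Finset.mem_sdiff] at hk
      set a := l k / m k with ha
      have hge : ∀ i ∈ S \ T, 0 ≤ l i - a * m i := by
        intro i hi
        have h1 := hmin i hi
        have := hmp i (Finset.mem_sdiff.1 hi).1
        have : a * m i ≤ l i := by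
          calc a * m i ≤ l i / m i * m i := by gcongr
            _ = l i := by field_simp
        linarith
      have hk0 : l k - a * m k = 0 := by
        have := hmp k hk.1
        rw [ha]; field_simp; simp
      -- large multiple
      obtain ⟨M, hM⟩ : ∃ M : ℝ, ∀ i ∈ T, 0 < l i - a * m i + M * r i := by
        have : ∀ i ∈ T, ∀ᶠ M : ℝ in Filter.atTop, 0 < l i - a * m i + M * r i := by
          intro i hi
          have h1 : Filter.Tendsto (fun M : ℝ => l i - a * m i + M * r i) Filter.atTop
              Filter.atTop :=
            Filter.tendsto_atTop_add_const_left _ _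
              (Filter.tendsto_id.atTop_mul_const (hrp i hi))
          exact h1.eventually_gt_atTop 0
        have h2 := (Filter.eventually_all_finset T).2 this
        exact h2.exists
      set q : ι → ℝ := l - a • m + M • r with hq
      have hqL : q ∈ L := L.add_mem (L.sub_mem hl (L.smul_mem _ hm)) (L.smul_mem _ hr)
      have hqe : ∀ i, q i = l i - a * m i + M * r i := fun i => by simp [hq]
      have hqT : ∀ i ∈ T, 0 < q i := fun i hi => by rw [hqe]; exact hM i hi
      have hqS : ∀ i ∉ S, q i = 0 := fun i hi => by
        rw [hqe, hlS i hi, hm0 i hi, hr0 i (fun h => hi (hTS.1 h))]; simp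
      have hqn : ∀ i, 0 ≤ q i := by
        intro i
        by_cases hiT : i ∈ T
        · exact (hqT i hiT).le
        by_cases hiS : i ∈ S
        · rw [hqe, hr0 i hiT]; simpa using hge i (Finset.mem_sdiff.2 ⟨hiS, hiT⟩)
        · exact (hqS i hiS).ge
      have hU := hmax _ (fun i hi => by simpa using (hqT i hi).ne') (by
        refine Finset.ssubset_iff_subset_ne.2 ⟨?_, ?_⟩
        · intro i hi
          by_contra hc
          simp [hqS i hc] at hi
        · intro h
          have : k ∈ Finset.univ.filter fun i => q i ≠ 0 := h ▸ hk.1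
          simp [hqe, hk0, hr0 k hk.2] at this) (NSupp.of_nonneg hqL hqn)
      have hz : ∀ i ∉ T, l i - a * m i = 0 := by
        intro i hi
        have : i ∉ Finset.univ.filter fun i => q i ≠ 0 := hU ▸ hi
        simpa [hqe, hr0 i hi] using this
      have : l = (l - a • m) + a • m := by simp
      rw [this]
      refine Submodule.add_mem_sup ⟨L.sub_mem hl (L.smul_mem _ hm), ?_⟩
        (Submodule.smul_mem _ _ (Submodule.mem_span_singleton_self m))
      intro i hi
      simpa using hz i hi
    · refine sup_le (inf_le_inf_left _ ?_) ?_
      · intro l hl i hi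
        exact hl i (fun h => hi (hTS.1 h))
      · rw [Submodule.span_singleton_le_iff_mem]
        exact ⟨hm, hm0⟩
  rw [heq]
  have hd : (L ⊓ sup T) ⊓ (Submodule.span ℝ {m}) = ⊥ := by
    rw [eq_bot_iff]
    rintro x ⟨hx, hx'⟩
    obtain ⟨c, rfl⟩ := Submodule.mem_span_singleton.1 hx'
    by_cases hc : c = 0
    · simp [hc]
    · exact absurd ((Submodule.smul_mem_iff _ hc).1 hx) hmT
  have h1 := Submodule.finrank_sup_add_finrank_inf_eq (L ⊓ sup T) (Submodule.span ℝ {m})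
  rw [hd, finrank_bot, finrank_span_singleton (by rintro rfl; exact hmT (zero_mem _))] at h1
  simpa using h1

lemma finrank_eq_of_nsupp {L L' : Submodule ℝ (ι → ℝ)} (h : ∀ S, NSupp L S ↔ NSupp L' S)
    (S : Finset ι) (hS : NSupp L S) :
    Module.finrank ℝ (L ⊓ sup S : Submodule ℝ (ι → ℝ))
      = Module.finrank ℝ (L' ⊓ sup S : Submodule ℝ (ι → ℝ)) := by
  induction S using Finset.strongInduction with
  | H S ih =>
    rcases S.eq_empty_or_nonempty with rfl | hne
    · have : (sup ∅ : Submodule ℝ (ι → ℝ)) = ⊥ := by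
        rw [eq_bot_iff]; intro l hl; funext i; exact hl i (by simp)
      rw [this, inf_bot_eq, inf_bot_eq]
    · classical
      obtain ⟨T, hT, hTmax⟩ := (Finset.univ.filter fun T => T ⊂ S ∧ NSupp L T).exists_maximal
        ⟨∅, by simpa using ⟨hne, nsupp_empty L⟩⟩
      simp only [Finset.mem_filter, Finset.mem_univ, true_and] at hT hTmax
      have hmax : ∀ U, T ⊆ U → U ⊂ S → NSupp L U → U = T := fun U h1 h2 h3 =>
        Finset.Subset.antisymm (hTmax ⟨h2, h3⟩ h1) h1
      rw [finrank_step hS hT.2 hT.1 hmax,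
        finrank_step ((h _).1 hS) ((h _).1 hT.2) hT.1
          (fun U h1 h2 h3 => hmax U h1 h2 ((h _).2 h3)), ih T hT.1 hT.2]

lemma finrank_eq_of_msupp {L L' : Submodule ℝ (ι → ℝ)} {J : Finset ι} (hL : L ≤ sup J)
    (hL' : L' ≤ sup J) (h : ∀ v, MSupp L v ↔ MSupp L' v) (hJ : NSupp L J) :
    Module.finrank ℝ L = Module.finrank ℝ L' := by
  have := finrank_eq_of_nsupp (fun S => ⟨nsupp_of_msupp (fun v => (h v).1),
    nsupp_of_msupp (fun v => (h v).2)⟩) J hJ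
  rwa [inf_eq_left.2 hL, inf_eq_left.2 hL'] at this

end Supp
end Katch

namespace Katch

section Dep
variable {ι : Type} [Fintype ι] [DecidableEq ι]
variable {E : Type} [NormedAddCommGroup E] [InnerProductSpace ℝ E] [FiniteDimensional ℝ E]

lemma MSupp.unique {L : Submodule ℝ (ι → ℝ)} {v : Finset ι} (hv : MSupp L v) {m l : ι → ℝ}
    (hm : m ∈ L) (hmp : ∀ i ∈ v, 0 < m i) (hm0 : ∀ i ∉ v, m i = 0)
    (hl : l ∈ L) (hl0 : ∀ i ∉ v, l i = 0) : ∃ c : ℝ, l = c • m := by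
  obtain ⟨k, hk, hmin⟩ := v.exists_min_image (fun i => l i / m i) hv.1
  refine ⟨l k / m k, ?_⟩
  set a := l k / m k with ha
  by_contra hne
  have hge : ∀ i, 0 ≤ (l - a • m) i := by
    intro i
    by_cases hi : i ∈ v
    · have h1 := hmin i hi
      have := hmp i hi
      have : a * m i ≤ l i := by
        calc a * m i ≤ l i / m i * m i := by gcongr
          _ = l i := by field_simp
      simp; linarith
    · simp [hl0 i hi, hm0 i hi]
  have hk0 : (l - a • m) k = 0 := by
    have := hmp k hk
    simp [ha]; field_simp; simp
  have h1 := NSupp.of_nonneg (L.sub_mem hl (L.smul_mem a hm)) hge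
  have h2 := hv.2.2 _ (by
    intro i hi
    by_contra hc
    simp [hl0 i hc, hm0 i hc] at hi) (by
    by_contra hc
    rw [Finset.not_nonempty_iff_eq_empty, Finset.filter_eq_empty_iff] at hc
    apply hne
    funext i
    have := hc (Finset.mem_univ i)
    simp [sub_eq_zero] at this
    simpa using this) h1
  rw [← h2] at hk
  simp only [Finset.mem_filter] at hk
  exact hk.2 hk0

/-- linear dependencies of `y` supported in `S`. -/
noncomputable def Lam (S : Finset ι) (y : ι → E) : Submodule ℝ (ι → ℝ) :=
  sup S ⊓ LinearMap.ker (Fintype.linearCombination ℝ y)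

lemma mem_Lam {S : Finset ι} {y : ι → E} {l : ι → ℝ} :
    l ∈ Lam S y ↔ (∀ i ∉ S, l i = 0) ∧ ∑ i, l i • y i = 0 := by
  rw [Lam, Submodule.mem_inf, LinearMap.mem_ker, Fintype.linearCombination_apply, mem_sup]

lemma Lam_le_sup (S : Finset ι) (y : ι → E) : Lam S y ≤ sup S := inf_le_left

lemma Lam_mono {S T : Finset ι} (h : S ⊆ T) (y : ι → E) : Lam S y ≤ Lam T y := by
  intro l hl
  rw [mem_Lam] at hl ⊢
  exact ⟨fun i hi => hl.1 i (fun hc => hi (h hc)), hl.2⟩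

lemma finrank_Lam (S : Finset ι) (y : ι → E) :
    Module.finrank ℝ (Lam S y) + Module.finrank ℝ (Submodule.span ℝ (y '' S)) = S.card := by
  set g : (S → ℝ) →ₗ[ℝ] E := Fintype.linearCombination ℝ (fun i : S => y i) with hg
  set e : (S → ℝ) →ₗ[ℝ] (ι → ℝ) := Function.ExtendByZero.linearMap ℝ ((↑) : S → ι) with he
  have hin : ∀ (x : S → ℝ) (i : S), e x i = x i := by
    intro x i
    simp only [he, Function.ExtendByZero.linearMap_apply]
    exact Subtype.val_injective.extend_apply x 0 i
  have hout : ∀ (x : S → ℝ) (i : ι), i ∉ S → e x i = 0 := by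
    intro x i hi
    simp only [he, Function.ExtendByZero.linearMap_apply]
    rw [Function.extend_apply']
    · rfl
    · rintro ⟨a, rfl⟩; exact hi a.2
  have hinj : Function.Injective e := by
    intro a b hab
    funext i
    rw [← hin a, ← hin b, hab]
  have hsum : ∀ l : ι → ℝ, (∀ i ∉ S, l i = 0) → ∑ i, l i • y i = ∑ i : S, l i • y i := by
    intro l hl
    rw [← Finset.sum_subset (Finset.subset_univ S)]
    · exact (Finset.sum_coe_sort S (fun i => l i • y i)).symm
    · intro i _ hi; simp [hl i hi]
  have hmap : (LinearMap.ker g).map e = Lam S y := by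
    ext l
    rw [Submodule.mem_map, mem_Lam]
    constructor
    · rintro ⟨x, hx, rfl⟩
      refine ⟨hout x, ?_⟩
      rw [hsum _ (hout x)]
      simp only [hin]
      rw [LinearMap.mem_ker, hg, Fintype.linearCombination_apply] at hx
      exact hx
    · rintro ⟨h0, hs⟩
      refine ⟨fun i => l i, ?_, ?_⟩
      · rw [LinearMap.mem_ker, hg, Fintype.linearCombination_apply, ← hs, hsum _ h0]
      · funext i
        by_cases hi : i ∈ S
        · exact hin _ ⟨i, hi⟩
        · rw [hout _ i hi, h0 i hi]
  have h1 := LinearMap.finrank_range_add_finrank_ker g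
  have h2 : LinearMap.range g = Submodule.span ℝ (y '' S) := by
    rw [hg, Fintype.range_linearCombination]
    congr 1
    ext x; simp
  have h3 : Module.finrank ℝ (Lam S y) = Module.finrank ℝ (LinearMap.ker g) := by
    rw [← hmap]
    exact (Submodule.equivMapOfInjective e hinj _).finrank_eq.symm
  rw [h3, ← h2, add_comm, h1]
  simp

/-- the members of `𝓥_y` -/
abbrev MV (J : Finset ι) (y : ι → E) (v : Finset ι) : Prop := MSupp (Lam J y) v

lemma MV.subset {J : Finset ι} {y : ι → E} {v : Finset ι} (h : MV J y v) : v ⊆ J := by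
  obtain ⟨l, hl, hp, h0⟩ := h.2.1
  intro i hi
  by_contra hc
  exact (hp i hi).ne' ((mem_Lam.1 hl).1 i hc)

lemma MV.exists_pos {J : Finset ι} {y : ι → E} {v : Finset ι} (h : MV J y v) :
    ∃ m ∈ Lam v y, (∀ i ∈ v, 0 < m i) ∧ ∀ i ∉ v, m i = 0 := by
  obtain ⟨l, hl, hp, h0⟩ := h.2.1
  exact ⟨l, mem_Lam.2 ⟨h0, (mem_Lam.1 hl).2⟩, hp, h0⟩

lemma MV.finrank_Lam_eq {J : Finset ι} {y : ι → E} {v : Finset ι} (h : MV J y v) :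
    Module.finrank ℝ (Lam v y) = 1 := by
  obtain ⟨m, hm, hp, h0⟩ := h.exists_pos
  have : Lam v y = Submodule.span ℝ {m} := by
    apply le_antisymm
    · intro l hl
      obtain ⟨c, rfl⟩ := MSupp.unique h (Lam_mono h.subset y hm) hp h0 (Lam_mono h.subset y hl)
        (mem_Lam.1 hl).1
      exact Submodule.smul_mem _ _ (Submodule.mem_span_singleton_self m)
    · rwa [Submodule.span_singleton_le_iff_mem]
  rw [this, finrank_span_singleton]
  rintro rfl
  obtain ⟨i, hi⟩ := h.1
  exact (hp i hi).ne' rfl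

/-- If `y i` for `i ∈ v` lie in a subspace of dim `< |v|` they are dependent. -/
lemma exists_dep {v : Finset ι} {y : ι → E} {W : Submodule ℝ E} (hW : ∀ i ∈ v, y i ∈ W)
    (hc : Module.finrank ℝ W < v.card) : ∃ l ∈ Lam v y, l ≠ 0 := by
  have h1 := finrank_Lam v y
  have h2 : Module.finrank ℝ (Submodule.span ℝ (y '' v)) ≤ Module.finrank ℝ W := by
    apply Submodule.finrank_mono
    rw [Submodule.span_le]
    rintro _ ⟨i, hi, rfl⟩
    exact hW i hi
  have h3 : Lam v y ≠ ⊥ := by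
    intro h
    rw [h, finrank_bot] at h1
    omega
  exact Submodule.exists_mem_ne_zero_of_ne_bot h3

end Dep

section Cone
variable {ι : Type} [Fintype ι] [DecidableEq ι]
variable {E : Type} [NormedAddCommGroup E] [InnerProductSpace ℝ E] [FiniteDimensional ℝ E]

/-- sum of cones -/
noncomputable def Ns (N : ι → PointedCone ℝ E) (S : Finset ι) : PointedCone ℝ E := ⨆ i ∈ S, N i

/-- lineality space of the sum -/
noncomputable def lin (N : ι → PointedCone ℝ E) (S : Finset ι) : Submodule ℝ E := (Ns N S).lineal

noncomputable def ell (N : ι → PointedCone ℝ E) (S : Finset ι) : ℕ := Module.finrank ℝ (lin N S)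

lemma le_Ns (N : ι → PointedCone ℝ E) {S : Finset ι} {i : ι} (hi : i ∈ S) : N i ≤ Ns N S :=
  le_iSup₂_of_le i hi le_rfl

lemma Ns_mono (N : ι → PointedCone ℝ E) {S T : Finset ι} (h : S ⊆ T) : Ns N S ≤ Ns N T :=
  iSup₂_le fun _ hi => le_Ns N (h hi)

lemma lin_mono (N : ι → PointedCone ℝ E) {S T : Finset ι} (h : S ⊆ T) : lin N S ≤ lin N T :=
  fun _ hx => ⟨Ns_mono N h hx.1, Ns_mono N h hx.2⟩

lemma ell_mono (N : ι → PointedCone ℝ E) {S T : Finset ι} (h : S ⊆ T) : ell N S ≤ ell N T :=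
  Submodule.finrank_mono (lin_mono N h)

lemma mem_lin {N : ι → PointedCone ℝ E} {S : Finset ι} {x : E} :
    x ∈ lin N S ↔ x ∈ Ns N S ∧ -x ∈ Ns N S := PointedCone.mem_lineal

/-- elements of the sum of cones -/
lemma mem_Ns {N : ι → PointedCone ℝ E} {S : Finset ι} {x : E} :
    x ∈ Ns N S ↔ ∃ n : ι → E, (∀ i, n i ∈ N i) ∧ (∀ i ∉ S, n i = 0) ∧ ∑ i, n i = x := by
  rw [Ns, Submodule.mem_iSup_finset_iff_exists_sum]
  constructor
  · rintro ⟨m, hm⟩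
    refine ⟨fun i => if i ∈ S then m i else 0, ?_, ?_, ?_⟩
    · intro i
      dsimp only
      split_ifs
      · exact (m i).2
      · exact zero_mem _
    · intro i hi; simp [hi]
    · rw [← hm]; simp
  · rintro ⟨n, h1, h2, h3⟩
    refine ⟨fun i => ⟨n i, h1 i⟩, ?_⟩
    rw [← h3]
    exact Finset.sum_subset (Finset.subset_univ S) (fun i _ hi => h2 i hi)

lemma face {N : ι → PointedCone ℝ E} {S : Finset ι} {u v : E} (hu : u ∈ Ns N S)
    (hv : v ∈ Ns N S) (h : u + v ∈ lin N S) : u ∈ lin N S := by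
  rw [mem_lin] at h ⊢
  refine ⟨hu, ?_⟩
  have : -u = v + -(u + v) := by abel
  rw [this]
  exact add_mem hv h.2

/-- zero-sum selections -/
def Om (N : ι → PointedCone ℝ E) (S : Finset ι) (y : ι → E) : Prop :=
  (∀ i, y i ∈ N i) ∧ (∀ i ∉ S, y i = 0) ∧ ∑ i, y i = 0

lemma Om.mem_Ns {N : ι → PointedCone ℝ E} {S : Finset ι} {n : ι → E} (hn : ∀ i, n i ∈ N i)
    (hn0 : ∀ i ∉ S, n i = 0) (i : ι) : n i ∈ Ns N S := by
  by_cases hi : i ∈ S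
  · exact le_Ns N hi (hn i)
  · rw [hn0 i hi]; exact zero_mem _

lemma rep_mem_lin {N : ι → PointedCone ℝ E} {S : Finset ι} {n : ι → E} (hn : ∀ i, n i ∈ N i)
    (hn0 : ∀ i ∉ S, n i = 0) (h : ∑ i, n i ∈ lin N S) (i : ι) : n i ∈ lin N S := by
  apply face (Om.mem_Ns hn hn0 i) (v := ∑ j ∈ Finset.univ.erase i, n j)
  · exact sum_mem fun j _ => Om.mem_Ns hn hn0 j
  · rwa [Finset.add_sum_erase _ _ (Finset.mem_univ i)]

lemma Om.mem_lin {N : ι → PointedCone ℝ E} {S : Finset ι} {y : ι → E} (h : Om N S y) (i : ι) :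
    y i ∈ lin N S := rep_mem_lin h.1 h.2.1 (by rw [h.2.2]; exact zero_mem _) i

/-- relative interior points of cones -/
lemma exists_relint (C : PointedCone ℝ E) :
    ∃ p ∈ C, ∀ z ∈ C, ∃ ε > (0 : ℝ), p - ε • z ∈ C := by
  obtain ⟨t, ht, hts, _⟩ := exists_linearIndependent ℝ (C : Set E)
  rename_i hli
  have hfin : t.Finite := hli.setFinite
  lift t to Finset E using hfin
  refine ⟨∑ b ∈ t, b, sum_mem fun b hb => ht hb, ?_⟩
  intro z hz
  have hz' : z ∈ Submodule.span ℝ (t : Set E) := by rw [hts]; exact Submodule.subset_span hz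
  obtain ⟨c, _, hc⟩ := Submodule.mem_span_finset.1 hz'
  set M : ℝ := 1 + ∑ b ∈ t, |c b| with hM
  have hM0 : 0 < M := by
    have : 0 ≤ ∑ b ∈ t, |c b| := Finset.sum_nonneg fun _ _ => abs_nonneg _
    linarith
  refine ⟨M⁻¹, by positivity, ?_⟩
  rw [← hc, Finset.smul_sum, ← Finset.sum_sub_distrib]
  refine sum_mem fun b hb => ?_
  have h1 : b - M⁻¹ • c b • b = (1 - M⁻¹ * c b) • b := by
    rw [sub_smul, one_smul, smul_smul]
  rw [h1]
  refine PointedCone.smul_mem C ?_ (ht hb)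
  have h2 : c b ≤ M := by
    have h3 := Finset.single_le_sum (f := fun b => |c b|) (fun i _ => abs_nonneg (c i)) hb
    have := le_abs_self (c b)
    linarith
  have : M⁻¹ * c b ≤ M⁻¹ * M := by gcongr
  rw [inv_mul_cancel₀ hM0.ne'] at this
  linarith

end Cone
end Katch

namespace Katch

section Core
variable {ι : Type} [Fintype ι] [DecidableEq ι]
variable {E : Type} [NormedAddCommGroup E] [InnerProductSpace ℝ E] [FiniteDimensional ℝ E]

/-- generic zero-sum selections -/
def Valid (N : ι → PointedCone ℝ E) (S : Finset ι) (y : ι → E) : Prop :=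
  Om N S y ∧ ∀ j ∈ S, ∀ z ∈ N j, z ∈ lin N S → ∃ ε > (0 : ℝ), y j - ε • z ∈ N j

lemma exists_valid (N : ι → PointedCone ℝ E) (S : Finset ι) : ∃ y, Valid N S y := by
  have h1 : ∀ j, ∃ p ∈ N j ⊓ (lin N S : PointedCone ℝ E), ∀ z ∈ N j ⊓ (lin N S : PointedCone ℝ E),
      ∃ ε > (0 : ℝ), p - ε • z ∈ N j ⊓ (lin N S : PointedCone ℝ E) := fun j => exists_relint _
  choose p hp hpe using h1
  have h2 : ∀ j, ∃ n : ι → E, (∀ i, n i ∈ N i) ∧ (∀ i ∉ S, n i = 0) ∧ ∑ i, n i = - p j := by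
    intro j
    have : p j ∈ lin N S := (hp j).2
    exact mem_Ns.1 (mem_lin.1 this).2
  choose n hn hn0 hns using h2
  refine ⟨fun i => (if i ∈ S then p i else 0) + ∑ j ∈ S, n j i, ⟨?_, ?_, ?_⟩, ?_⟩
  · intro i
    refine add_mem ?_ (sum_mem fun j _ => hn j i)
    split_ifs
    · exact (hp i).1
    · exact zero_mem _
  · intro i hi
    simp [hi, hn0 _ i hi]
  · rw [Finset.sum_add_distrib, Finset.sum_comm]
    simp [hns]
  · intro j hj z hz hz'
    obtain ⟨ε, hε, h⟩ := hpe j z ⟨hz, hz'⟩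
    refine ⟨ε, hε, ?_⟩
    have : (if j ∈ S then p j else 0) + ∑ k ∈ S, n k j - ε • z
        = (p j - ε • z) + ∑ k ∈ S, n k j := by rw [if_pos hj]; abel
    simp only [this]
    exact add_mem h.1 (sum_mem fun k _ => hn k j)

lemma Valid.combine {N : ι → PointedCone ℝ E} {S : Finset ι} {y z : ι → E} (hy : Valid N S y)
    (hz : Om N S z) {s : ℝ} (hs : 0 ≤ s) (hs1 : s < 1) :
    Valid N S (fun i => (1 - s) • y i + s • z i) := by
  have h1s : 0 < 1 - s := by linarith
  refine ⟨⟨?_, ?_, ?_⟩, ?_⟩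
  · intro i
    exact add_mem (PointedCone.smul_mem _ h1s.le (hy.1.1 i)) (PointedCone.smul_mem _ hs (hz.1 i))
  · intro i hi
    simp [hy.1.2.1 i hi, hz.2.1 i hi]
  · rw [Finset.sum_add_distrib, ← Finset.smul_sum, ← Finset.smul_sum, hy.1.2.2, hz.2.2]
    simp
  · intro j hj w hw hw'
    obtain ⟨ε, hε, h⟩ := hy.2 j hj w hw hw'
    refine ⟨(1 - s) * ε, by positivity, ?_⟩
    have : (1 - s) • y j + s • z j - ((1 - s) * ε) • w = (1 - s) • (y j - ε • w) + s • z j := by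
      rw [smul_sub, smul_smul]; abel
    simp only [this]
    exact add_mem (PointedCone.smul_mem _ h1s.le h) (PointedCone.smul_mem _ hs (hz.1 j))

lemma Om.mono {N : ι → PointedCone ℝ E} {S T : Finset ι} (h : S ⊆ T) {y : ι → E} (hy : Om N S y) :
    Om N T y := ⟨hy.1, fun i hi => hy.2.1 i (fun hc => hi (h hc)), hy.2.2⟩

/-- hypothesis (H) -/
def HH (N : ι → PointedCone ℝ E) (J : Finset ι) : Prop :=
  ∀ S ⊆ J, S.Nonempty → ell N S + 1 ≤ S.card

lemma MV.facts {N : ι → PointedCone ℝ E} {J : Finset ι} (H : HH N J) {y : ι → E}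
    (hy : ∀ i, y i ∈ N i) {v : Finset ι} (hv : MV J y v) :
    (∀ i ∈ v, y i ∈ lin N v) ∧ Submodule.span ℝ (y '' v) = lin N v ∧ ell N v + 1 = v.card := by
  obtain ⟨m, hm, hp, h0⟩ := hv.exists_pos
  have hmn : ∀ i, 0 ≤ m i := by
    intro i
    by_cases hi : i ∈ v
    · exact (hp i hi).le
    · exact (h0 i hi).ge
  have hOm : Om N v (fun i => m i • y i) := by
    refine ⟨fun i => PointedCone.smul_mem _ (hmn i) (hy i), fun i hi => by simp [h0 i hi],
      (mem_Lam.1 hm).2⟩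
  have h1 : ∀ i ∈ v, y i ∈ lin N v := fun i hi =>
    (Submodule.smul_mem_iff _ (hp i hi).ne').1 (hOm.mem_lin i)
  have h2 : Submodule.span ℝ (y '' v) ≤ lin N v := by
    rw [Submodule.span_le]; rintro _ ⟨i, hi, rfl⟩; exact h1 i hi
  have h3 := finrank_Lam v y
  rw [hv.finrank_Lam_eq] at h3
  have h4 := H v hv.subset hv.1
  have h5 := Submodule.finrank_mono h2
  have h6 : ell N v = Module.finrank ℝ (lin N v) := rfl
  refine ⟨h1, Submodule.eq_of_le_of_finrank_le h2 (by omega), by omega⟩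

lemma Valid.dom_mem {N : ι → PointedCone ℝ E} {J : Finset ι} (H : HH N J) {y : ι → E}
    (hy : Valid N J y) {v : Finset ι} (hv : MV J y v) {j : ι} (hj : j ∈ v) {z : E}
    (hz : z ∈ N j) (hz' : z ∈ lin N J) : z ∈ lin N v := by
  obtain ⟨ε, hε, h⟩ := hy.2 j (hv.subset hj) z hz hz'
  have h1 := (hv.facts H hy.1.1).1 j hj
  refine (Submodule.smul_mem_iff _ hε.ne').1 (face (v := y j - ε • z) ?_ (le_Ns N hj h) ?_)
  · exact PointedCone.smul_mem _ hε.le (le_Ns N hj hz)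
  · simpa using h1

lemma Om.nsupp {N : ι → PointedCone ℝ E} {J : Finset ι} {y : ι → E} (hy : Om N J y) :
    NSupp (Lam J y) J := by
  refine ⟨fun i => if i ∈ J then 1 else 0, mem_Lam.2 ⟨fun i hi => by simp [hi], ?_⟩,
    fun i hi => by simp [hi], fun i hi => by simp [hi]⟩
  rw [← hy.2.2]
  refine Finset.sum_congr rfl fun i _ => ?_
  split_ifs with h
  · simp
  · simp [hy.2.1 i h]

lemma Valid.span_eq {N : ι → PointedCone ℝ E} {J : Finset ι} (H : HH N J) {y : ι → E}
    (hy : Valid N J y) : Submodule.span ℝ (y '' J) = lin N J := by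
  apply le_antisymm
  · rw [Submodule.span_le]; rintro _ ⟨i, hi, rfl⟩; exact hy.1.mem_lin i
  · intro w hw
    obtain ⟨n, hn, hn0, rfl⟩ := mem_Ns.1 (mem_lin.1 hw).1
    refine sum_mem fun i _ => ?_
    by_cases hi : i ∈ J
    · obtain ⟨v, hvJ, hv, hiv⟩ := exists_cover hy.1.nsupp hi
      have h1 := hy.dom_mem H hv hiv (hn i) (rep_mem_lin hn hn0 hw i)
      rw [← (MV.facts H hy.1.1 hv).2.1] at h1
      exact Submodule.span_mono (Set.image_mono (by exact_mod_cast hvJ)) h1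
    · rw [hn0 i hi]; exact zero_mem _

lemma HH.mono {N : ι → PointedCone ℝ E} {J X : Finset ι} (H : HH N J) (h : X ⊆ J) : HH N X :=
  fun S hS hn => H S (hS.trans h) hn

/-- dependencies of a valid vector on a tight set are constant -/
lemma Valid.const {N : ι → PointedCone ℝ E} {X : Finset ι} (H : HH N X) (hX : X.Nonempty)
    (hc : ell N X + 1 = X.card) {z : ι → E} (hz : Valid N X z) {l : ι → ℝ} (hl : l ∈ Lam X z) :
    ∃ c : ℝ, ∀ i ∈ X, l i = c := by
  have h1 := finrank_Lam X z
  rw [hz.span_eq H] at h1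
  have h2 : ell N X = Module.finrank ℝ (lin N X) := rfl
  have h3 : Module.finrank ℝ (Lam X z) = 1 := by omega
  have hone : (fun i => if i ∈ X then (1 : ℝ) else 0) ∈ Lam X z := by
    refine mem_Lam.2 ⟨fun i hi => by simp [hi], ?_⟩
    rw [← hz.1.2.2]
    refine Finset.sum_congr rfl fun i _ => ?_
    split_ifs with h
    · simp
    · simp [hz.1.2.1 i h]
  obtain ⟨x, hx⟩ := hX
  obtain ⟨c, hc⟩ := (finrank_eq_one_iff_of_nonzero' (⟨_, hone⟩ : Lam X z) (by
    intro h
    have := congrFun (congrArg Subtype.val h) x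
    simp [hx] at this)).1 h3 ⟨l, hl⟩
  refine ⟨c, fun i hi => ?_⟩
  have := congrFun (congrArg Subtype.val hc) i
  simpa [hi] using this.symm

lemma Valid.eq_of_subset {N : ι → PointedCone ℝ E} {J : Finset ι} (H : HH N J) {y : ι → E}
    (hy : Valid N J y) {v X : Finset ι} (hv : MV J y v) (hvX : v ⊆ X) (hXJ : X ⊆ J)
    (hc : ell N X + 1 = X.card) : v = X := by
  obtain ⟨z, hz⟩ := exists_valid N X
  have h1 : ∀ i ∈ v, z i ∈ lin N v := fun i hi =>
    hy.dom_mem H hv hi (hz.1.1 i) (lin_mono N hXJ (hz.1.mem_lin i))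
  have h2 := (hv.facts H hy.1.1).2.2
  have h3 : ell N v = Module.finrank ℝ (lin N v) := rfl
  obtain ⟨l, hl, hne⟩ := exists_dep h1 (by omega)
  obtain ⟨c, hcc⟩ := hz.const (H.mono hXJ) (hv.1.mono hvX) hc (Lam_mono hvX z hl)
  by_contra hvx
  obtain ⟨x, hx, hxv⟩ := Finset.exists_of_ssubset (lt_of_le_of_ne hvX hvx)
  have : c = 0 := by rw [← hcc x hx]; exact (mem_Lam.1 hl).1 x hxv
  apply hne
  funext i
  by_cases hi : i ∈ v
  · rw [hcc i (hvX hi), this]; rfl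
  · exact (mem_Lam.1 hl).1 i hi

lemma MV.transfer {N : ι → PointedCone ℝ E} {J : Finset ι} (H : HH N J) {y t : ι → E}
    (hy : Valid N J y) (ht : Valid N J t) {v : Finset ι} (hv : MV J y v) {l : ι → ℝ}
    (hl : l ∈ Lam v t) (hl0 : ∀ i, 0 ≤ l i) (hne : l ≠ 0) : MV J t v := by
  have h1 := NSupp.of_nonneg (Lam_mono hv.subset t hl) hl0
  have hsub : (Finset.univ.filter fun i => l i ≠ 0) ⊆ v := by
    intro i hi
    by_contra hc
    simp [(mem_Lam.1 hl).1 i hc] at hi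
  obtain ⟨u, hu, hum⟩ := exists_msupp (by
    by_contra hc
    rw [Finset.not_nonempty_iff_eq_empty, Finset.filter_eq_empty_iff] at hc
    apply hne
    funext i
    simpa using hc (Finset.mem_univ i)) h1
  have huv := hu.trans hsub
  have h2 : ∀ i ∈ u, y i ∈ lin N u := fun i hi =>
    ht.dom_mem H hum hi (hy.1.1 i) (hy.1.mem_lin i)
  have h3 := (MV.facts H ht.1.1 hum).2.2
  have h4 : ell N u = Module.finrank ℝ (lin N u) := rfl
  obtain ⟨k, hk, hkne⟩ := exists_dep h2 (by omega)
  obtain ⟨m, hm, hp, h0⟩ := hv.exists_pos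
  obtain ⟨c, rfl⟩ := hv.unique (Lam_mono hv.subset y hm) hp h0 (Lam_mono (huv.trans hv.subset) y hk)
    (fun i hi => (mem_Lam.1 hk).1 i (fun h => hi (huv h)))
  have hc : c ≠ 0 := by rintro rfl; simp at hkne
  have : u = v := by
    refine Finset.Subset.antisymm huv fun i hi => ?_
    by_contra hiu
    have h5 := (mem_Lam.1 hk).1 i hiu
    simp [hc] at h5
    exact (hp i hi).ne' h5
  rwa [← this]

end Core
end Katch

namespace Katch

lemma isClosed_ex {Y : Type} [TopologicalSpace Y] {A : Set Y} (hA : IsCompact A)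
    {R : Set (ℝ × Y)} (hR : IsClosed R) : IsClosed {s : ℝ | ∃ y ∈ A, (s, y) ∈ R} := by
  have : CompactSpace A := isCompact_iff_compactSpace.1 hA
  have h1 : IsClosed ((fun p : ℝ × A => (p.1, (p.2 : Y))) ⁻¹' R) :=
    hR.preimage (by fun_prop)
  have h2 := isClosedMap_fst_of_compactSpace (X := ℝ) (Y := A) _ h1
  convert h2 using 1
  ext s
  constructor
  · rintro ⟨y, hy, h⟩
    exact ⟨(s, ⟨y, hy⟩), h, rfl⟩
  · rintro ⟨⟨s', y⟩, h, rfl⟩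
    exact ⟨y, y.2, h⟩

section Core
variable {ι : Type} [Fintype ι] [DecidableEq ι]
variable {E : Type} [NormedAddCommGroup E] [InnerProductSpace ℝ E] [FiniteDimensional ℝ E]

open scoped InnerProductSpace

/-- Gordan-type alternative. -/
lemma gordan {v : Finset ι} (hv : v.Nonempty) (W : Submodule ℝ E) (t : ι → E)
    (ht : ∀ i ∈ v, t i ∈ W)
    (hP : ¬ ∃ l ∈ stdSimplex ℝ ι ∩ (sup v : Set (ι → ℝ)), ∑ i, l i • t i = 0) :
    ∃ w ∈ (W : Set E) ∩ Metric.sphere 0 1, ∀ i ∈ v, 0 ≤ ⟪w, t i⟫_ℝ := by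
  set A := stdSimplex ℝ ι ∩ (sup v : Set (ι → ℝ)) with hA
  have hAc : IsCompact A :=
    (isCompact_stdSimplex ℝ ι).inter_right (Submodule.closed_of_finiteDimensional _)
  have hAx : Convex ℝ A := (convex_stdSimplex ℝ ι).inter (Submodule.convex _)
  set f := Fintype.linearCombination ℝ t with hf
  have hfc : Continuous f := f.continuous_of_finiteDimensional
  set C := f '' A with hC
  have hCc : IsCompact C := hAc.image hfc
  have hCx : Convex ℝ C := hAx.linear_image f
  have hsingle : ∀ i ∈ v, t i ∈ C := by
    intro i hi
    refine ⟨Pi.single i 1, ⟨single_mem_stdSimplex ℝ i, ?_⟩, ?_⟩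
    · intro j hj
      have : j ≠ i := by rintro rfl; exact hj hi
      simp [this]
    · simp [hf]
  have hCW : C ⊆ W := by
    rintro _ ⟨l, hl, rfl⟩
    rw [hf, Fintype.linearCombination_apply]
    refine sum_mem fun i _ => ?_
    by_cases hi : i ∈ v
    · exact W.smul_mem _ (ht i hi)
    · rw [hl.2 i hi]; simp
  obtain ⟨i0, hi0⟩ := hv
  obtain ⟨x, hx, hxm⟩ := exists_norm_eq_iInf_of_complete_convex ⟨_, hsingle i0 hi0⟩
    hCc.isComplete hCx 0
  rw [norm_eq_iInf_iff_real_inner_le_zero hCx hx] at hxm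
  have hx0 : x ≠ 0 := by
    rintro rfl
    obtain ⟨l, hl, h⟩ := hx
    exact hP ⟨l, hl, h⟩
  refine ⟨‖x‖⁻¹ • x, ⟨W.smul_mem _ (hCW hx), ?_⟩, ?_⟩
  · simp [norm_smul, hx0]
  · intro i hi
    have h1 := hxm (t i) (hsingle i hi)
    rw [zero_sub, inner_neg_left, inner_sub_right] at h1
    have h2 : 0 ≤ ⟪x, x⟫_ℝ := real_inner_self_nonneg
    rw [inner_smul_left]
    have h3 : 0 ≤ ⟪x, t i⟫_ℝ := by linarith
    simp only [map_inv₀, conj_trivial]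
    positivity

lemma MV.const {N : ι → PointedCone ℝ E} {J : Finset ι} (H : HH N J) {y y1 : ι → E}
    (hy : Valid N J y) (hy1 : Valid N J y1) {v : Finset ι} (hv : MV J y v) : MV J y1 v := by
  set t : ℝ → ι → E := fun r i => (1 - r) • y i + r • y1 i with ht
  have htv : ∀ r ∈ Set.Icc (0 : ℝ) 1, Valid N J (t r) := by
    intro r hr
    rcases eq_or_lt_of_le hr.2 with h | h
    · have : t r = y1 := by funext i; simp [ht, h]
      rwa [this]
    · exact hy.combine hy1.1 hr.1 h
  have htc : ∀ i, Continuous fun r => t r i := by intro i; simp only [ht]; fun_prop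
  set A := stdSimplex ℝ ι ∩ (sup v : Set (ι → ℝ)) with hA
  have hAc : IsCompact A :=
    (isCompact_stdSimplex ℝ ι).inter_right (Submodule.closed_of_finiteDimensional _)
  set B := (lin N v : Set E) ∩ Metric.sphere 0 1 with hB
  have hBc : IsCompact B :=
    (isCompact_sphere _ _).inter_left (Submodule.closed_of_finiteDimensional _)
  set P : Set ℝ := {r | ∃ l ∈ A, (r, l) ∈ {p : ℝ × (ι → ℝ) | ∑ i, p.2 i • t p.1 i = 0}} with hP
  set Q : Set ℝ := {r | ∃ w ∈ B, (r, w) ∈ {p : ℝ × E | ∀ i ∈ v, 0 ≤ ⟪p.2, t p.1 i⟫_ℝ}} with hQ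
  have hPc : IsClosed P := isClosed_ex hAc (by
    refine isClosed_eq ?_ continuous_const
    simp only [ht]; fun_prop)
  have hQc : IsClosed Q := isClosed_ex hBc (by
    simp only [Set.ofPred_forall]
    refine isClosed_biInter fun i _ => ?_
    refine isClosed_le continuous_const ?_
    simp only [ht]; fun_prop)
  have hPm : ∀ r ∈ Set.Icc (0 : ℝ) 1, r ∈ P → MV J (t r) v := by
    rintro r hr ⟨l, hl, h⟩
    refine hv.transfer H hy (htv r hr) (l := l) (mem_Lam.2 ⟨hl.2, h⟩) hl.1.1 ?_
    rintro rfl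
    have := hl.1.2
    simp at this
  have htW : ∀ r ∈ Set.Icc (0 : ℝ) 1, ∀ i ∈ v, t r i ∈ lin N v := by
    intro r hr i hi
    exact hy.dom_mem H hv hi ((htv r hr).1.1 i) ((htv r hr).1.mem_lin i)
  have hcov : Set.Icc (0 : ℝ) 1 ⊆ P ∪ Q := by
    intro r hr
    by_contra hc
    rw [Set.mem_union, not_or] at hc
    exact hc.2 (gordan hv.1 (lin N v) (t r) (htW r hr) hc.1)
  have hdisj : ¬ (Set.Icc (0 : ℝ) 1 ∩ (P ∩ Q)).Nonempty := by
    rintro ⟨r, hr, hrP, w, hw, hwi⟩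
    have hm := hPm r hr hrP
    obtain ⟨m, hmL, hp, h0⟩ := hm.exists_pos
    have hwi' : ∀ i ∈ v, 0 ≤ ⟪w, t r i⟫_ℝ := hwi
    have h1 : ∑ i ∈ v, m i * ⟪w, t r i⟫_ℝ = 0 := by
      have h2 := congrArg (fun x => ⟪w, x⟫_ℝ) (mem_Lam.1 hmL).2
      simp only [inner_sum, inner_smul_right, inner_zero_right] at h2
      rw [← h2]
      exact Finset.sum_subset (Finset.subset_univ v) (fun i _ hi => by simp [h0 i hi])
    rw [Finset.sum_eq_zero_iff_of_nonneg
      (fun i hi => mul_nonneg (hp i hi).le (hwi' i hi))] at h1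
    have h3 : ∀ i ∈ v, ⟪w, t r i⟫_ℝ = 0 := fun i hi =>
      (mul_eq_zero.1 (h1 i hi)).resolve_left (hp i hi).ne'
    have h4 : w ∈ Submodule.span ℝ (t r '' v) := by
      rw [(hm.facts H (htv r hr).1.1).2.1]; exact hw.1
    have h5 : ∀ x ∈ Submodule.span ℝ (t r '' v), ⟪w, x⟫_ℝ = 0 := by
      intro x hx
      induction hx using Submodule.span_induction with
      | mem x hx => obtain ⟨i, hi, rfl⟩ := hx; exact h3 i hi
      | zero => simp
      | add x y _ _ hx hy => rw [inner_add_right, hx, hy]; simp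
      | smul a x _ hx => rw [inner_smul_right, hx]; simp
    have h6 := h5 w h4
    rw [inner_self_eq_zero] at h6
    have h7 := hw.2
    rw [h6] at h7
    simp at h7
  have h0P : (0 : ℝ) ∈ P := by
    obtain ⟨m, hmL, hp, h0⟩ := hv.exists_pos
    have hmn : ∀ i, 0 ≤ m i := by
      intro i
      by_cases hi : i ∈ v
      · exact (hp i hi).le
      · exact (h0 i hi).ge
    have hs : 0 < ∑ i, m i := by
      obtain ⟨i, hi⟩ := hv.1
      exact Finset.sum_pos' (fun i _ => hmn i) ⟨i, Finset.mem_univ i, hp i hi⟩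
    refine ⟨(∑ i, m i)⁻¹ • m, ⟨⟨?_, ?_⟩, ?_⟩, ?_⟩
    · intro i
      have := hmn i
      simp; positivity
    · simp [← Finset.mul_sum, hs.ne']
    · exact Submodule.smul_mem _ _ h0
    · have := (mem_Lam.1 hmL).2
      simp [ht, mul_smul, ← Finset.smul_sum, this]
  have h1P : (1 : ℝ) ∈ P := by
    by_contra hc
    have h1Q : (1 : ℝ) ∈ Q := (hcov (by simp)).resolve_left hc
    exact hdisj (isPreconnected_closed_iff.1 isPreconnected_Icc P Q hPc hQc hcov
      ⟨0, by simp, h0P⟩ ⟨1, by simp, h1Q⟩)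
  have := hPm 1 (by simp) h1P
  have h : t 1 = y1 := by funext i; simp [ht]
  rwa [h] at this

lemma Valid.exists_super {N : ι → PointedCone ℝ E} {J : Finset ι} (H : HH N J) {y : ι → E}
    (hy : Valid N J y) {X : Finset ι} (hXn : X.Nonempty) (hXJ : X ⊆ J)
    (hX : ell N X + 1 = X.card) : ∃ v, MV J y v ∧ X ⊆ v := by
  obtain ⟨z, hz⟩ := exists_valid N X
  have hzJ : Om N J z := hz.1.mono hXJ
  set t : ℝ → ι → E := fun r i => (1 - r) • y i + r • z i with ht
  set o : ι → ℝ := fun i => if i ∈ J then 1 else 0 with ho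
  set R : Set (ℝ × (Finset ι → ι → ℝ)) := {p | (∀ v, ¬ MV J y v → p.2 v = 0) ∧
    (∀ v, ∀ i ∉ v, p.2 v i = 0) ∧ (∑ v, p.2 v = o) ∧ ∀ v, ∑ i, p.2 v i • t p.1 i = 0} with hR
  have hRc : IsClosed R := by
    simp only [hR, Set.ofPred_and, Set.ofPred_forall]
    refine IsClosed.inter ?_ (IsClosed.inter ?_ (IsClosed.inter ?_ ?_))
    · exact isClosed_iInter fun v => isClosed_iInter fun _ =>
        isClosed_eq (by fun_prop) continuous_const
    · exact isClosed_iInter fun v => isClosed_iInter fun i => isClosed_iInter fun _ =>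
        isClosed_eq (by fun_prop) continuous_const
    · exact isClosed_eq (by fun_prop) continuous_const
    · exact isClosed_iInter fun v => isClosed_eq (by simp only [ht]; fun_prop) continuous_const
  have hcl := isClosed_ex (isCompact_Icc (a := (0 : Finset ι → ι → ℝ)) (b := 1)) hRc
  have hsub : Set.Ico (0 : ℝ) 1 ⊆ {s | ∃ f ∈ Set.Icc (0 : Finset ι → ι → ℝ) 1, (s, f) ∈ R} := by
    intro s hs
    have hv := hy.combine hzJ hs.1 hs.2
    obtain ⟨f, hfL, hf, hfs⟩ := exists_decomp (L := Lam J (t s)) J o (by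
      refine mem_Lam.2 ⟨fun i hi => by simp [ho, hi], ?_⟩
      rw [← hv.1.2.2]
      refine Finset.sum_congr rfl fun i _ => ?_
      simp only [ho]
      split_ifs with h
      · simp [ht]
      · exact (zero_smul _ _).trans (hv.1.2.1 i h).symm) (fun i hi => by simp [ho, hi]) (fun i hi => by simp [ho, hi])
    have hnn : ∀ v i, 0 ≤ f v i := by
      intro v i
      rcases hf v with h | ⟨_, h, h'⟩
      · simp [h]
      · by_cases hi : i ∈ v
        · exact (h i hi).le
        · exact (h' i hi).ge
    refine ⟨f, ⟨fun v i => hnn v i, fun v i => ?_⟩, ?_, ?_, hfs, ?_⟩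
    · have h1 := congrFun hfs i
      rw [Finset.sum_apply] at h1
      have h2 := Finset.single_le_sum (f := fun v => f v i) (fun v _ => hnn v i)
        (Finset.mem_univ v)
      have h3 : o i ≤ 1 := by simp only [ho]; split_ifs <;> norm_num
      calc f v i ≤ ∑ v, f v i := h2
        _ = o i := h1
        _ ≤ 1 := h3
    · intro v hnv
      rcases hf v with h | ⟨h, _⟩
      · exact h
      · exact absurd (MV.const H hv hy h) hnv
    · intro v i hi
      rcases hf v with h | ⟨_, _, h⟩
      · simp [h]
      · exact h i hi
    · intro v
      exact (mem_Lam.1 (hfL v)).2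
  have h1 : (1 : ℝ) ∈ closure (Set.Ico (0 : ℝ) 1) := by
    rw [closure_Ico (by norm_num)]; simp
  obtain ⟨f, _, hf1, hf2, hf3, hf4⟩ := hcl.closure_subset_iff.2 hsub h1
  simp only at hf1 hf2 hf3 hf4
  obtain ⟨x, hx⟩ := hXn
  have : ∃ v, f v x ≠ 0 := by
    by_contra hc
    push Not at hc
    have := congrFun hf3 x
    simp [hc, ho, hXJ hx] at this
  obtain ⟨v, hv⟩ := this
  refine ⟨v, ?_, ?_⟩
  · by_contra hc
    rw [hf1 v hc] at hv
    simp at hv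
  · have hL : (fun i => if i ∈ X then f v i else 0) ∈ Lam X z := by
      refine mem_Lam.2 ⟨fun i hi => by simp [hi], ?_⟩
      rw [← hf4 v]
      refine Finset.sum_congr rfl fun i _ => ?_
      split_ifs with h
      · simp [ht]
      · simp [ht, hz.1.2.1 i h]
    obtain ⟨c, hc⟩ := hz.const (H.mono hXJ) ⟨x, hx⟩ hX hL
    intro i hi
    by_contra hiv
    have h2 := hc i hi
    have h3 := hc x hx
    simp only [hi, hx, if_true] at h2 h3
    rw [hf2 v i hiv] at h2
    rw [← h2] at h3
    exact hv h3

lemma Valid.mv_iff {N : ι → PointedCone ℝ E} {J : Finset ι} (H : HH N J) {y : ι → E}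
    (hy : Valid N J y) (v : Finset ι) : MV J y v ↔ v ⊆ J ∧ v.Nonempty ∧ ell N v + 1 = v.card ∧
      ∀ X ⊆ J, v ⊆ X → ell N X + 1 = X.card → v = X := by
  constructor
  · intro hv
    exact ⟨hv.subset, hv.1, (hv.facts H hy.1.1).2.2, fun X hXJ hvX hX =>
      hy.eq_of_subset H hv hvX hXJ hX⟩
  · rintro ⟨h1, h2, h3, h4⟩
    obtain ⟨u, hu, hvu⟩ := hy.exists_super H h2 h1 h3
    rwa [h4 u hu.subset hvu (hu.facts H hy.1.1).2.2]

theorem core {N N' : ι → PointedCone ℝ E} {J : Finset ι} (H : HH N J) (H' : HH N' J)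
    (hJ : ell N J + 2 ≤ J.card) (hJ' : ell N' J + 2 ≤ J.card)
    (heq : ∀ S ⊂ J, ell N S = ell N' S) : ell N J = ell N' J := by
  obtain ⟨y, hy⟩ := exists_valid N J
  obtain ⟨y', hy'⟩ := exists_valid N' J
  have hc : ∀ X ⊆ J, (ell N X + 1 = X.card ↔ ell N' X + 1 = X.card) := by
    intro X hX
    rcases eq_or_ne X J with rfl | hne
    · omega
    · rw [heq X (lt_of_le_of_ne hX hne)]
  have hiff : ∀ v, MSupp (Lam J y) v ↔ MSupp (Lam J y') v := by
    intro v
    refine (hy.mv_iff H v).trans (Iff.trans ?_ (hy'.mv_iff H' v).symm)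
    constructor
    · rintro ⟨h1, h2, h3, h4⟩
      exact ⟨h1, h2, (hc v h1).1 h3, fun X hX hv h => h4 X hX hv ((hc X hX).2 h)⟩
    · rintro ⟨h1, h2, h3, h4⟩
      exact ⟨h1, h2, (hc v h1).2 h3, fun X hX hv h => h4 X hX hv ((hc X hX).1 h)⟩
  have h1 := finrank_eq_of_msupp (Lam_le_sup J y) (Lam_le_sup J y') hiff hy.1.nsupp
  have h2 := finrank_Lam J y
  have h3 := finrank_Lam J y'
  rw [hy.span_eq H] at h2
  rw [hy'.span_eq H'] at h3
  have h4 : ell N J = Module.finrank ℝ (lin N J) := rfl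
  have h5 : ell N' J = Module.finrank ℝ (lin N' J) := rfl
  omega

end Core
end Katch

namespace Katch

section ThmA
variable {ι : Type} [Fintype ι] [DecidableEq ι]
variable {E : Type} [NormedAddCommGroup E] [InnerProductSpace ℝ E] [FiniteDimensional ℝ E]

lemma exists_proj (W : Submodule ℝ E) : ∃ p : E →ₗ[ℝ] E, LinearMap.ker p = W := by
  refine ⟨(Wᗮ.starProjection : E →L[ℝ] E).toLinearMap, ?_⟩
  ext x
  rw [LinearMap.mem_ker]
  have h := Submodule.starProjection_apply_eq_zero_iff (K := Wᗮ) (v := x)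
  rw [Submodule.orthogonal_orthogonal] at h
  exact h

lemma finrank_map_of_ker {p : E →ₗ[ℝ] E} {L : Submodule ℝ E} (h : LinearMap.ker p ≤ L) :
    Module.finrank ℝ (L.map p) + Module.finrank ℝ (LinearMap.ker p) = Module.finrank ℝ L := by
  have h1 := LinearMap.finrank_range_add_finrank_ker (p.domRestrict L)
  rw [LinearMap.range_domRestrict] at h1
  have h2 : LinearMap.ker (p.domRestrict L) = (LinearMap.ker p).comap L.subtype := by
    ext x; simp
  rw [h2, (Submodule.comapSubtypeEquivOfLe h).finrank_eq] at h1
  exact h1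

lemma exists_contract (N : ι → PointedCone ℝ E) (S : Finset ι) :
    ∃ N' : ι → PointedCone ℝ E, ∀ T : Finset ι, T.Nonempty →
      ell N' T + ell N S = ell N (S ∪ T) := by
  obtain ⟨p, hp⟩ := exists_proj (lin N S)
  refine ⟨fun i => (N i ⊔ Ns N S).map p, ?_⟩
  intro T hT
  have h1 : Ns (fun i => (N i ⊔ Ns N S).map p) T = (Ns N (S ∪ T)).map p := by
    apply le_antisymm
    · refine iSup₂_le fun i hi => ?_
      refine Submodule.map_mono (sup_le ?_ ?_)
      · exact le_Ns N (Finset.mem_union_right _ hi)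
      · exact Ns_mono N Finset.subset_union_left
    · obtain ⟨t, ht⟩ := hT
      rintro _ ⟨x, hx, rfl⟩
      obtain ⟨n, hn, hn0, rfl⟩ := mem_Ns.1 hx
      rw [map_sum]
      refine sum_mem fun i _ => ?_
      by_cases hiT : i ∈ T
      · refine le_Ns (fun i => (N i ⊔ Ns N S).map p) hiT ?_
        exact ⟨n i, (le_sup_left : N i ≤ N i ⊔ Ns N S) (hn i), rfl⟩
      by_cases hiS : i ∈ S
      · refine le_Ns (fun i => (N i ⊔ Ns N S).map p) ht ?_
        exact ⟨n i, (le_sup_right : Ns N S ≤ N t ⊔ Ns N S) (le_Ns N hiS (hn i)), rfl⟩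
      · rw [hn0 i (by simp [hiT, hiS])]
        simp
  have h2 : lin (fun i => (N i ⊔ Ns N S).map p) T = (lin N (S ∪ T)).map p := by
    ext u
    rw [mem_lin, h1, PointedCone.mem_map, PointedCone.mem_map, Submodule.mem_map]
    constructor
    · rintro ⟨⟨a, ha, rfl⟩, b, hb, hab⟩
      refine ⟨a, mem_lin.2 ⟨ha, ?_⟩, rfl⟩
      have h3 : a + b ∈ lin N S := by
        rw [← hp, LinearMap.mem_ker, map_add, hab]; simp
      have h4 : -a = b + -(a + b) := by abel
      rw [h4]
      exact add_mem hb (Ns_mono N Finset.subset_union_left (mem_lin.1 h3).2)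
    · rintro ⟨a, ha, rfl⟩
      rw [mem_lin] at ha
      exact ⟨⟨a, ha.1, rfl⟩, -a, ha.2, by simp⟩
  have h3 := finrank_map_of_ker (p := p) (L := lin N (S ∪ T))
    (by rw [hp]; exact lin_mono N Finset.subset_union_left)
  rw [hp, ← h2] at h3
  exact h3

lemma ell_empty (N : ι → PointedCone ℝ E) : ell N ∅ = 0 := by
  have : lin N ∅ = ⊥ := by
    rw [eq_bot_iff]
    intro x hx
    obtain ⟨n, _, hn0, rfl⟩ := mem_Ns.1 (mem_lin.1 hx).1
    simp [hn0]
  rw [ell, this, finrank_bot]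

theorem thmA (d : ℕ) : ∀ (J : Finset ι) (N N' : ι → PointedCone ℝ E), ell N J ≤ d → ell N' J ≤ d →
    (∀ S ⊆ J, S.card ≤ d + 1 → ell N S = ell N' S) → ell N J = ell N' J := by
  induction d using Nat.strong_induction_on with
  | _ d ihd =>
  intro J
  induction J using Finset.strongInduction with
  | H J ihJ =>
  intro N N' hd hd' h
  by_cases hJ : J.card ≤ d + 1
  · exact h J subset_rfl hJ
  push Not at hJ
  have hprop : ∀ S ⊂ J, ell N S = ell N' S := by
    intro S hS
    exact ihJ S hS N N' ((ell_mono N hS.1).trans hd) ((ell_mono N' hS.1).trans hd')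
      (fun T hT hc => h T (hT.trans hS.1) hc)
  by_cases hH : HH N J
  · refine core hH ?_ (by omega) (by omega) hprop
    intro S hS hn
    rcases eq_or_ne S J with rfl | hne
    · omega
    · rw [← hprop S (lt_of_le_of_ne hS hne)]; exact hH S hS hn
  · unfold HH at hH
    push Not at hH
    obtain ⟨S, hSJ, hSn, hS⟩ := hH
    have hSd : ell N S ≤ d := (ell_mono N hSJ).trans hd
    have hS1 : 1 ≤ S.card := hSn.card_pos
    have hSS : ell N S = ell N' S := h S hSJ (by omega)
    obtain ⟨M, hM⟩ := exists_contract N S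
    obtain ⟨M', hM'⟩ := exists_contract N' S
    have hne : (J \ S).Nonempty := by
      rw [Finset.sdiff_nonempty]
      intro hc
      have := Finset.card_le_card hc
      omega
    have hU : S ∪ (J \ S) = J := Finset.union_sdiff_of_subset hSJ
    have e1 := hM _ hne
    have e2 := hM' _ hne
    rw [hU] at e1 e2
    have := ihd (d - ell N S) (by omega) (J \ S) M M' (by omega) (by omega) (by
      intro T hT hTc
      rcases T.eq_empty_or_nonempty with rfl | hTn
      · rw [ell_empty, ell_empty]
      · have e3 := hM T hTn
        have e4 := hM' T hTn
        have e5 := h (S ∪ T) (Finset.union_subset hSJ (hT.trans Finset.sdiff_subset)) (by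
          have := Finset.card_union_le S T
          omega)
        omega)
    omega

end ThmA
end Katch

namespace Katch

section Farkas
variable {F : Type} [NormedAddCommGroup F] [NormedSpace ℝ F] [FiniteDimensional ℝ F]

lemma mem_hull_range {κ : Type} [Fintype κ] {a : κ → F} {x : F} :
    x ∈ PointedCone.hull ℝ (Set.range a) ↔ ∃ c : κ → ℝ, (∀ k, 0 ≤ c k) ∧ ∑ k, c k • a k = x := by
  rw [Submodule.mem_span_range_iff_exists_fun]
  constructor
  · rintro ⟨c, hc⟩
    exact ⟨fun k => (c k : ℝ), fun k => (c k).2, hc⟩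
  · rintro ⟨c, h0, hc⟩
    exact ⟨fun k => ⟨c k, h0 k⟩, hc⟩

lemma isClosed_hull {κ : Type} [Fintype κ] [DecidableEq κ] (a : κ → F) :
    IsClosed (PointedCone.hull ℝ (Set.range a) : Set F) := by
  classical
  set f := Fintype.linearCombination ℝ a with hf
  have hfa : ∀ c, f c = ∑ k, c k • a k := fun c => by rw [hf, Fintype.linearCombination_apply]
  let I : Set (Finset κ) := {S | ∀ l ∈ sup S, f l = 0 → l = 0}
  have key : (PointedCone.hull ℝ (Set.range a) : Set F)
      = ⋃ S ∈ I, (f.domRestrict (sup S)) '' {c | ∀ k, 0 ≤ (c : κ → ℝ) k} := by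
    ext x
    simp only [SetLike.mem_coe, Set.mem_iUnion, Set.mem_image, mem_hull_range]
    constructor
    · intro hx
      -- choose support of minimal size
      have hex : ∃ m : ℕ, ∃ S : Finset κ, S.card = m ∧ ∃ c ∈ sup S, (∀ k, 0 ≤ c k) ∧ f c = x := by
        obtain ⟨c, h0, hc⟩ := hx
        exact ⟨_, Finset.univ, rfl, c, by simp [mem_sup], h0, by rw [hfa, hc]⟩
      obtain ⟨S, hS, c, hcS, hc0, hcx⟩ := Nat.find_spec hex
      refine ⟨S, ?_, ⟨c, hcS⟩, hc0, hcx⟩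
      by_contra hI
      have : ∃ l ∈ sup S, f l = 0 ∧ ∃ k, 0 < l k := by
        simp only [I, Set.mem_ofPred_eq] at hI
        push Not at hI
        obtain ⟨l, hl, hl0, hne⟩ := hI
        obtain ⟨k, hk⟩ := Function.ne_iff.1 hne
        rcases lt_or_gt_of_ne hk with h | h
        · exact ⟨-l, Submodule.neg_mem _ hl, by rw [map_neg, hl0, neg_zero], k, by simpa using h⟩
        · exact ⟨l, hl, hl0, k, h⟩
      obtain ⟨l, hl, hl0, k, hk⟩ := this
      obtain ⟨j, hj, hmin⟩ := (Finset.univ.filter fun i => 0 < l i).exists_min_image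
        (fun i => c i / l i) ⟨k, by simpa using hk⟩
      simp only [Finset.mem_filter, Finset.mem_univ, true_and] at hj hmin
      have hjS : j ∈ S := by
        by_contra h
        exact hj.ne' (hl j h)
      set t := c j / l j with ht
      have ht0 : 0 ≤ t := div_nonneg (hc0 j) hj.le
      refine Nat.find_min hex (m := (S.erase j).card) ?_ ⟨S.erase j, rfl, c - t • l, ?_, ?_, ?_⟩
      · rw [← hS]; exact Finset.card_erase_lt_of_mem hjS
      · intro i hi
        by_cases hij : i = j
        · subst hij
          simp only [Pi.sub_apply, Pi.smul_apply, smul_eq_mul, ht]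
          field_simp
          simp
        · have : i ∉ S := fun h => hi (Finset.mem_erase.2 ⟨hij, h⟩)
          simp [hcS i this, hl i this]
      · intro i
        simp only [Pi.sub_apply, Pi.smul_apply, smul_eq_mul]
        rcases lt_or_ge 0 (l i) with h | h
        · have h1 := hmin i h
          have : t * l i ≤ c i := by
            calc t * l i ≤ c i / l i * l i := by gcongr
              _ = c i := by field_simp
          linarith
        · have := mul_nonpos_of_nonneg_of_nonpos ht0 h
          have := hc0 i
          linarith
      · rw [map_sub, map_smul, hl0, hcx]; simp
    · rintro ⟨S, _, c, h0, rfl⟩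
      exact ⟨c, h0, (hfa _).symm⟩
  rw [key]
  refine Set.Finite.isClosed_biUnion (Set.toFinite _) fun S hS => ?_
  have hinj : LinearMap.ker (f.domRestrict (sup S)) = ⊥ := by
    rw [LinearMap.ker_eq_bot']
    intro m hm
    exact Subtype.ext (hS m m.2 hm)
  refine (LinearMap.isClosedEmbedding_of_injective hinj).isClosedMap _ ?_
  simp only [Set.ofPred_forall]
  refine isClosed_iInter fun k => isClosed_le continuous_const ?_
  exact (continuous_apply k).comp continuous_subtype_val

lemma farkas {s : Set F} (hs : s.Finite) {x : F} (hx : x ∉ PointedCone.hull ℝ s) :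
    ∃ f : F →L[ℝ] ℝ, f x < 0 ∧ ∀ b ∈ s, 0 ≤ f b := by
  classical
  have := hs.fintype
  have hcl := isClosed_hull (fun k : s => (k : F))
  rw [Subtype.range_coe] at hcl
  obtain ⟨f, u, h1, h2⟩ := geometric_hahn_banach_point_closed
    (PointedCone.convex (PointedCone.hull ℝ s)) hcl hx
  have hu : u < 0 := by simpa using h2 0 (zero_mem _)
  refine ⟨f, by linarith, fun b hb => ?_⟩
  by_contra hneg
  push Not at hneg
  have h3 := h2 ((u / f b) • b) (PointedCone.smul_mem _ (div_nonneg_of_nonpos hu.le hneg.le)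
    (PointedCone.subset_hull hb))
  rw [map_smul, smul_eq_mul, div_mul_cancel₀ _ hneg.ne] at h3
  exact lt_irrefl _ h3

end Farkas

section Geo
variable {ι : Type} [Fintype ι] [DecidableEq ι]
variable {E : Type} [NormedAddCommGroup E] [InnerProductSpace ℝ E] [FiniteDimensional ℝ E]
open scoped InnerProductSpace

/-- dual cone of a set -/
def dcone (G : Set E) : PointedCone ℝ E where
  carrier := {y | ∀ a ∈ G, 0 ≤ ⟪y, a⟫_ℝ}
  add_mem' := by
    intro x y hx hy a ha
    rw [inner_add_left]
    exact add_nonneg (hx a ha) (hy a ha)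
  zero_mem' := by intro a _; simp
  smul_mem' := by
    intro c x hx a ha
    have : c • x = (c : ℝ) • x := rfl
    rw [this, inner_smul_left]
    exact mul_nonneg (by simpa using c.2) (hx a ha)

lemma mem_dcone {G : Set E} {y : E} : y ∈ dcone G ↔ ∀ a ∈ G, 0 ≤ ⟪y, a⟫_ℝ := Iff.rfl

lemma dcone_hull {G : Set E} {y : E} (hy : y ∈ dcone G) {a : E} (ha : a ∈ PointedCone.hull ℝ G) :
    0 ≤ ⟪y, a⟫_ℝ := by
  induction ha using Submodule.span_induction with
  | mem x hx => exact hy x hx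
  | zero => simp
  | add x z _ _ h1 h2 => rw [inner_add_right]; exact add_nonneg h1 h2
  | smul c x _ h =>
    have : c • x = (c : ℝ) • x := rfl
    rw [this, inner_smul_right]
    exact mul_nonneg c.2 h

lemma dual_inter {G : ι → Set E} (hG : ∀ i, (G i).Finite) (S : Finset ι) {w : E}
    (hw : ∀ x, (∀ i ∈ S, x ∈ PointedCone.hull ℝ (G i)) → 0 ≤ ⟪w, x⟫_ℝ) :
    w ∈ Ns (fun i => dcone (G i)) S := by
  let T : E →ₗ[ℝ] (ι → E) × ℝ :=
    { toFun := fun x => (fun i => if i ∈ S then x else 0, ⟪w, x⟫_ℝ)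
      map_add' := by
        intro x y
        ext i
        · by_cases hi : i ∈ S <;> simp [hi]
        · simp [inner_add_right]
      map_smul' := by
        intro c x
        ext i
        · by_cases hi : i ∈ S <;> simp [hi]
        · simp [inner_smul_right] }
  let b := Module.finBasis ℝ E
  let g : Set ((ι → E) × ℝ) := (⋃ i ∈ S, (fun a => (Pi.single i a, (0 : ℝ))) '' G i) ∪
    (Set.range (fun k => T (b k)) ∪ Set.range (fun k => - T (b k)))
  have hg : g.Finite := by
    refine Set.Finite.union ?_ ((Set.finite_range _).union (Set.finite_range _))
    exact S.finite_toSet.biUnion fun i _ => (hG i).image _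
  have hnot : ((0, 1) : (ι → E) × ℝ) ∉ PointedCone.hull ℝ g := by
    intro hmem
    have : ∀ p ∈ PointedCone.hull ℝ g, ∃ x : E, p.2 = ⟪w, x⟫_ℝ ∧
        ∀ i ∈ S, p.1 i - x ∈ PointedCone.hull ℝ (G i) := by
      intro p hp
      induction hp using Submodule.span_induction with
      | mem p hp =>
        rcases hp with hp | hp | hp
        · simp only [Set.mem_iUnion] at hp
          obtain ⟨i, hi, a, ha, rfl⟩ := hp
          refine ⟨0, by simp, fun j hj => ?_⟩
          by_cases hij : j = i
          · subst hij; simpa using PointedCone.subset_hull ha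
          · simp [hij]
        · obtain ⟨k, rfl⟩ := hp
          exact ⟨b k, rfl, fun i hi => by simp [T, hi]⟩
        · obtain ⟨k, rfl⟩ := hp
          exact ⟨-b k, by simp [T], fun i hi => by simp [T, hi]⟩
      | zero => exact ⟨0, by simp, by simp⟩
      | add p q _ _ h1 h2 =>
        obtain ⟨x, hx, hx'⟩ := h1
        obtain ⟨y, hy, hy'⟩ := h2
        refine ⟨x + y, by simp [hx, hy, inner_add_right], fun i hi => ?_⟩
        have : (p + q).1 i - (x + y) = (p.1 i - x) + (q.1 i - y) := by
          simp only [Prod.fst_add, Pi.add_apply]; abel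
        rw [this]
        exact add_mem (hx' i hi) (hy' i hi)
      | smul c p _ h =>
        obtain ⟨x, hx, hx'⟩ := h
        refine ⟨(c : ℝ) • x, ?_, fun i hi => ?_⟩
        · rw [inner_smul_right, ← hx]; rfl
        · have : (c • p).1 i - (c : ℝ) • x = (c : ℝ) • (p.1 i - x) := by
            rw [smul_sub]; rfl
          rw [this]
          exact PointedCone.smul_mem _ c.2 (hx' i hi)
    obtain ⟨x, hx, hx'⟩ := this _ hmem
    have := hw (-x) (fun i hi => by simpa using hx' i hi)
    rw [inner_neg_right, ← hx] at this
    norm_num at this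
  obtain ⟨f, hf1, hf2⟩ := farkas hg hnot
  have hfT : ∀ x, f (T x) = 0 := by
    have h1 : (f.toLinearMap ∘ₗ T) = 0 := by
      apply b.ext
      intro k
      have h1 := hf2 (T (b k)) (Or.inr (Or.inl ⟨k, rfl⟩))
      have h2 := hf2 (-T (b k)) (Or.inr (Or.inr ⟨k, rfl⟩))
      rw [map_neg] at h2
      simp only [LinearMap.comp_apply, LinearMap.zero_apply, ContinuousLinearMap.coe_coe]
      linarith
    intro x
    exact LinearMap.congr_fun h1 x
  have hy : ∀ i, ∃ y : E, ∀ x, ⟪y, x⟫_ℝ = f (Pi.single i x, 0) := by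
    intro i
    let q : E →L[ℝ] ℝ := LinearMap.toContinuousLinearMap
      (f.toLinearMap ∘ₗ LinearMap.inl ℝ (ι → E) ℝ ∘ₗ LinearMap.single ℝ (fun _ => E) i)
    refine ⟨(InnerProductSpace.toDual ℝ E).symm q, fun x => ?_⟩
    rw [InnerProductSpace.toDual_symm_apply]
    rfl
  choose y hy using hy
  set β := - f (0, 1) with hβ
  have hβ0 : 0 < β := by linarith
  refine mem_Ns.2 ⟨fun i => if i ∈ S then β⁻¹ • y i else 0, ?_, ?_, ?_⟩
  · intro i
    dsimp only
    split_ifs with hi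
    · refine PointedCone.smul_mem _ (by positivity) ?_
      intro a ha
      rw [hy]
      refine hf2 _ (Or.inl ?_)
      simp only [Set.mem_iUnion]
      exact ⟨i, hi, a, ha, rfl⟩
    · exact zero_mem _
  · intro i hi; simp [hi]
  · apply ext_inner_right ℝ
    intro x
    rw [sum_inner]
    have h1 : T x = ∑ i ∈ S, ((Pi.single i x, 0) : (ι → E) × ℝ) + ⟪w, x⟫_ℝ • (0, 1) := by
      ext j
      · simp [T, Prod.fst_sum, Finset.sum_apply, Pi.single_apply]
      · simp [T, Prod.snd_sum]
    have h2 := hfT x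
    rw [h1, map_add, map_sum, map_smul] at h2
    simp only [← hy, smul_eq_mul] at h2
    have h3 : ∑ i ∈ S, ⟪y i, x⟫_ℝ = β * ⟪w, x⟫_ℝ := by rw [hβ]; linarith
    have h4 : ∀ i, ⟪if i ∈ S then β⁻¹ • y i else 0, x⟫_ℝ
        = if i ∈ S then β⁻¹ * ⟪y i, x⟫_ℝ else 0 := by
      intro i
      split_ifs
      · rw [inner_smul_left]; simp
      · simp
    simp only [h4]
    rw [Finset.sum_ite_mem, Finset.univ_inter, ← Finset.mul_sum, h3]
    field_simp

lemma exists_fin_span (s : Set E) : ∃ t : Set E, t.Finite ∧ t ⊆ s ∧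
    Submodule.span ℝ t = Submodule.span ℝ s := by
  obtain ⟨t, ht, hts, hli⟩ := exists_linearIndependent ℝ s
  exact ⟨t, hli.setFinite, ht, hts⟩

lemma exists_eps {C : Set E} (hC : Convex ℝ C) {x0 : E} (h0 : x0 ∈ C) {G : Set E}
    (hG : ∀ a ∈ G, x0 + a ∈ C) {x : E} (hx : x ∈ PointedCone.hull ℝ G) :
    ∃ ε > (0 : ℝ), x0 + ε • x ∈ C := by
  induction hx using Submodule.span_induction with
  | mem x hx => exact ⟨1, one_pos, by simpa using hG x hx⟩
  | zero => exact ⟨1, one_pos, by simpa using h0⟩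
  | add x y _ _ h1 h2 =>
    obtain ⟨ε, hε, h1⟩ := h1
    obtain ⟨δ, hδ, h2⟩ := h2
    refine ⟨ε * δ / (ε + δ), by positivity, ?_⟩
    have h3 := hC h1 h2 (a := δ / (ε + δ)) (b := ε / (ε + δ)) (by positivity) (by positivity)
      (by field_simp; ring)
    convert h3 using 1
    have e1 : (1 : ℝ) = δ / (ε + δ) + ε / (ε + δ) := by field_simp; ring
    have e2 : x0 = (δ / (ε + δ)) • x0 + (ε / (ε + δ)) • x0 := by
      rw [← add_smul, ← e1, one_smul]
    have e3 : (ε * δ / (ε + δ)) • (x + y) =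
        (δ / (ε + δ)) • (ε • x) + (ε / (ε + δ)) • (δ • y) := by
      rw [smul_smul, smul_smul, smul_add]
      congr 2 <;> ring
    rw [e3]
    nth_rewrite 1 [e2]
    rw [smul_add, smul_add]
    abel
  | smul c x _ h =>
    obtain ⟨ε, hε, h⟩ := h
    have hc : c • x = (c : ℝ) • x := rfl
    rcases eq_or_lt_of_le (show (0 : ℝ) ≤ c from c.2) with h0' | hpos
    · exact ⟨1, one_pos, by rw [hc, ← h0']; simpa using h0⟩
    · refine ⟨ε / c, by positivity, ?_⟩
      rw [hc, smul_smul, div_mul_cancel₀ _ hpos.ne']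
      exact h

theorem exists_cones {K : ι → Set E} (hK : ∀ i, Convex ℝ (K i)) {J : Finset ι}
    (hne : (⋂ i ∈ J, K i).Nonempty) : ∃ N : ι → PointedCone ℝ E, ∀ S ⊆ J,
      ell N S + Module.finrank ℝ (affineSpan ℝ (⋂ i ∈ S, K i)).direction = Module.finrank ℝ E := by
  obtain ⟨x0, hx0⟩ := hne
  simp only [Set.mem_iInter] at hx0
  set V : Finset ι → Set E := fun S => {a | x0 + a ∈ ⋂ i ∈ S, K i} with hV
  choose g hgf hgs hgspan using fun S => exists_fin_span (V S)
  set G : ι → Set E := fun i => ⋃ S ∈ {S : Finset ι | i ∈ S}, g S with hG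
  have hGf : ∀ i, (G i).Finite := fun i => Set.Finite.biUnion (Set.toFinite _) fun S _ => hgf S
  have hGK : ∀ i, ∀ a ∈ G i, x0 + a ∈ K i := by
    intro i a ha
    simp only [hG, Set.mem_iUnion] at ha
    obtain ⟨S, hS, ha⟩ := ha
    have := hgs S ha
    simp only [hV, Set.mem_ofPred_eq, Set.mem_iInter] at this
    exact this i hS
  refine ⟨fun i => dcone (G i), fun S hS => ?_⟩
  have hdir : (affineSpan ℝ (⋂ i ∈ S, K i)).direction = Submodule.span ℝ (V S) := by
    have hx : x0 ∈ ⋂ i ∈ S, K i := by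
      simp only [Set.mem_iInter]; exact fun i hi => hx0 i (hS hi)
    rw [direction_affineSpan, vectorSpan_eq_span_vsub_set_right ℝ hx]
    congr 1
    ext a
    simp only [Set.mem_image, hV, Set.mem_ofPred_eq]
    constructor
    · rintro ⟨y, hy, rfl⟩; simpa using hy
    · intro h; exact ⟨_, h, by simp⟩
  have hinter : ∀ x, (∀ i ∈ S, x ∈ PointedCone.hull ℝ (G i)) → x ∈ Submodule.span ℝ (V S) := by
    intro x hx
    have h1 : ∀ i ∈ S, ∃ ε > (0 : ℝ), x0 + ε • x ∈ K i := fun i hi =>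
      exists_eps (hK i) (hx0 i (hS hi)) (hGK i) (hx i hi)
    have h2 : ∃ ε > (0 : ℝ), ∀ i ∈ S, x0 + ε • x ∈ K i := by
      choose! e he hek using h1
      rcases S.eq_empty_or_nonempty with rfl | hSn
      · exact ⟨1, one_pos, by simp⟩
      · obtain ⟨j, hj, hmin⟩ := S.exists_min_image e hSn
        refine ⟨e j, he j hj, fun i hi => ?_⟩
        have hei := he i hi
        have hej := he j hj
        have h3 := (hK i).add_smul_mem (hx0 i (hS hi)) (hek i hi)
          (t := e j / e i) ⟨by positivity, (div_le_one hei).2 (hmin i hi)⟩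
        rwa [smul_smul, div_mul_cancel₀ _ hei.ne'] at h3
    obtain ⟨ε, hε, h3⟩ := h2
    have h4 : ε • x ∈ V S := by
      simp only [hV, Set.mem_ofPred_eq, Set.mem_iInter]; exact h3
    exact (Submodule.smul_mem_iff _ hε.ne').1 (Submodule.subset_span h4)
  have hlin : lin (fun i => dcone (G i)) S = (Submodule.span ℝ (V S))ᗮ := by
    ext w
    constructor
    · intro hw
      rw [mem_lin] at hw
      have h1 : ∀ w ∈ Ns (fun i => dcone (G i)) S, ∀ a ∈ g S, 0 ≤ ⟪w, a⟫_ℝ := by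
        intro w hw a ha
        obtain ⟨n, hn, hn0, rfl⟩ := mem_Ns.1 hw
        rw [sum_inner]
        refine Finset.sum_nonneg fun i _ => ?_
        by_cases hi : i ∈ S
        · refine hn i a ?_
          simp only [hG, Set.mem_iUnion]
          exact ⟨S, hi, ha⟩
        · rw [hn0 i hi]; simp
      rw [← hgspan S, Submodule.mem_orthogonal']
      intro u hu
      induction hu using Submodule.span_induction with
      | mem a ha =>
        have h2 := h1 _ hw.1 a ha
        have h3 := h1 _ hw.2 a ha
        rw [inner_neg_left] at h3
        linarith
      | zero => simp
      | add x y _ _ hx hy => rw [inner_add_right, hx, hy]; simp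
      | smul c x _ hx => rw [inner_smul_right, hx]; simp
    · intro hw
      rw [Submodule.mem_orthogonal'] at hw
      refine mem_lin.2 ⟨dual_inter hGf S fun x hx => ?_, dual_inter hGf S fun x hx => ?_⟩
      · rw [hw x (hinter x hx)]
      · rw [inner_neg_left, hw x (hinter x hx)]; simp
  have h1 := Submodule.finrank_add_finrank_orthogonal (Submodule.span ℝ (V S))
  rw [hdir, ell, hlin, add_comm]
  exact h1

end Geo

lemma helly_nonempty {d n : ℕ} {K K' : Fin n → Set (EuclideanSpace ℝ (Fin d))}
    (hK'conv : ∀ i, Convex ℝ (K' i))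
    (h : ∀ J : Finset (Fin n), J.card ≤ d + 1 →
      convexSetDim d (⋂ j ∈ J, K j) = convexSetDim d (⋂ j ∈ J, K' j)) (J : Finset (Fin n))
    (hne : (⋂ j ∈ J, K j).Nonempty) : (⋂ j ∈ J, K' j).Nonempty := by
  refine Convex.helly_theorem' (𝕜 := ℝ) (fun i _ => hK'conv i) fun I hI hc => ?_
  rw [finrank_euclideanSpace_fin] at hc
  have h1 := h I hc
  by_contra hno
  have hn : (⋂ j ∈ I, K j).Nonempty := hne.mono (Set.biInter_subset_biInter_left hI)
  unfold convexSetDim at h1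
  rw [if_pos hn, if_neg hno] at h1
  omega

end Katch

theorem katchalski_reconstruction (d n : ℕ)
    (K K' : Fin n → Set (EuclideanSpace ℝ (Fin d)))
    (hKcomp : ∀ i, IsCompact (K i)) (hKconv : ∀ i, Convex ℝ (K i))
    (hK'comp : ∀ i, IsCompact (K' i)) (hK'conv : ∀ i, Convex ℝ (K' i))
    (h : ∀ J : Finset (Fin n), J.card ≤ d + 1 →
      convexSetDim d (⋂ j ∈ J, K j) = convexSetDim d (⋂ j ∈ J, K' j)) :
    ∀ J : Finset (Fin n),
      convexSetDim d (⋂ j ∈ J, K j) = convexSetDim d (⋂ j ∈ J, K' j) := by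
  intro J
  by_cases hne : (⋂ j ∈ J, K j).Nonempty
  · have hne' := Katch.helly_nonempty hK'conv h J hne
    obtain ⟨N, hN⟩ := Katch.exists_cones hKconv hne
    obtain ⟨N', hN'⟩ := Katch.exists_cones hK'conv hne'
    have hfr : Module.finrank ℝ (EuclideanSpace ℝ (Fin d)) = d := finrank_euclideanSpace_fin
    rw [hfr] at hN hN'
    have e1 := hN J subset_rfl
    have e2 := hN' J subset_rfl
    have key := Katch.thmA d J N N' (by omega) (by omega) (by
      intro S hS hc
      have e3 := hN S hS
      have e4 := hN' S hS
      have e5 := h S hc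
      unfold convexSetDim at e5
      have m1 : (⋂ j ∈ S, K j).Nonempty := hne.mono (Set.biInter_subset_biInter_left hS)
      have m2 : (⋂ j ∈ S, K' j).Nonempty := hne'.mono (Set.biInter_subset_biInter_left hS)
      rw [if_pos m1, if_pos m2] at e5
      omega)
    unfold convexSetDim
    rw [if_pos hne, if_pos hne']
    omega
  · have hne' : ¬ (⋂ j ∈ J, K' j).Nonempty := fun hc =>
      hne (Katch.helly_nonempty hKconv (fun I hI => (h I hI).symm) J hc)
    unfold convexSetDim
    rw [if_neg hne, if_neg hne']
end

section
/- Let F be a finite family of convex sets in ℝ^d with |F| ≥ 2d, such that the intersection of any 2d sets from F has Lebesgue measure (volume) at least 1. Then the intersection of all members of F has volume at least d^{-2d²}. -/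
open MeasureTheory

theorem auerbach_aux {V ι : Type*} [NormedAddCommGroup V] [NormedSpace ℝ V] [FiniteDimensional ℝ V]
    [Fintype ι] (e : Module.Basis ι ℝ V) {X : Set V} (hX : IsCompact X)
    (hspan : ⊤ ≤ Submodule.span ℝ X) :
    ∃ b : Module.Basis ι ℝ V, (∀ i, b i ∈ X) ∧ ∀ x ∈ X, ∀ i, |b.repr x i| ≤ 1 := by
  classical
  have hcont : Continuous fun v : ι → V => |e.det v| := by
    apply Continuous.abs
    have hdet : (fun v : ι → V => e.det v) = fun v => (e.toMatrix v).det := by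
      funext v; exact e.det_apply v
    change Continuous fun v : ι → V => e.det v
    rw [hdet]
    apply Continuous.matrix_det
    refine continuous_matrix fun i j => ?_
    exact (LinearMap.continuous_of_finiteDimensional (e.coord i)).comp (continuous_apply j)
  -- a basis inside X
  obtain ⟨b0, hb0⟩ : ∃ b0 : Module.Basis ι ℝ V, ∀ i, b0 i ∈ X := by
    let b1 := Module.Basis.ofSpan hspan
    refine ⟨b1.reindex (b1.indexEquiv e), fun i => ?_⟩
    apply Module.Basis.ofSpan_subset hspan
    simp [b1]
  have hcomp : IsCompact (Set.univ.pi fun _ : ι => X) := isCompact_univ_pi fun _ => hX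
  obtain ⟨v, hv, hmax⟩ := hcomp.exists_isMaxOn ⟨b0, fun i _ => hb0 i⟩ hcont.continuousOn
  have h0 : 0 < |e.det b0| := abs_pos.2 (e.isUnit_det b0).ne_zero
  have hvpos : 0 < |e.det v| := lt_of_lt_of_le h0 (hmax (show (b0 : ι → V) ∈ _ from fun i _ => hb0 i))
  have hu : IsUnit (e.det v) := isUnit_iff_ne_zero.2 (abs_pos.1 hvpos)
  obtain ⟨hli, hsp⟩ := e.is_basis_iff_det.2 hu
  let b := Module.Basis.mk hli hsp.ge
  have hb : (b : ι → V) = v := Module.Basis.coe_mk _ _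
  refine ⟨b, fun i => by rw [hb]; exact hv i trivial, fun x hx i => ?_⟩
  have hup : e.det (Function.update v i x) = b.repr x i * e.det v := by
    conv_lhs => rw [← b.sum_repr x, hb]
    rw [AlternatingMap.map_update_sum, Finset.sum_eq_single i]
    · rw [AlternatingMap.map_update_smul]; simp
    · intro j _ hj
      rw [AlternatingMap.map_update_smul, AlternatingMap.map_update_self _ _ hj.symm]; simp
    · simp
  have hm := hmax (show Function.update v i x ∈ _ from fun j _ => by
    by_cases h : j = i
    · subst h; simpa using hx
    · simpa [h] using hv j trivial)
  simp only [Set.mem_ofPred_eq, hup, abs_mul] at hm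
  by_contra! h
  nlinarith

theorem cone_carath {V : Type*} [AddCommGroup V] [Module ℝ V] [FiniteDimensional ℝ V]
    {X : Set V} {y : V} (hy : y ∈ convexHull ℝ X) :
    ∃ T : Finset V, ↑T ⊆ X ∧ T.card ≤ Module.finrank ℝ V ∧ ∃ w : V → ℝ, (∀ x ∈ T, 0 ≤ w x) ∧
      ∑ x ∈ T, w x ≤ 1 ∧ ∑ x ∈ T, w x • x = y := by
  classical
  let Q : Finset V → Prop := fun T => ↑T ⊆ X ∧ ∃ w : V → ℝ, (∀ x ∈ T, 0 ≤ w x) ∧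
      ∑ x ∈ T, w x ≤ 1 ∧ ∑ x ∈ T, w x • x = y
  have hex : ∃ k, ∃ T, Q T ∧ T.card = k := by
    rw [convexHull_eq_union_convexHull_finite_subsets] at hy
    simp only [Set.mem_iUnion] at hy
    obtain ⟨T, hT, hy⟩ := hy
    obtain ⟨w, h0, h1, h2⟩ := Finset.mem_convexHull.1 hy
    refine ⟨_, T, ⟨hT, w, h0, h1.le, ?_⟩, rfl⟩
    rw [Finset.centerMass_eq_of_sum_1 _ _ h1] at h2
    simpa using h2
  obtain ⟨T, ⟨hTX, w, h0, h1, h2⟩, hcard⟩ := Nat.find_spec hex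
  refine ⟨T, hTX, ?_, w, h0, h1, h2⟩
  by_contra! hlt
  obtain ⟨f, hf0, hfs, x1, hx1, hfx1⟩ : ∃ f : V → ℝ, ∑ e ∈ T, f e • e = 0 ∧ 0 ≤ ∑ e ∈ T, f e ∧
      ∃ x ∈ T, 0 < f x := by
    obtain ⟨f, hf, x, hx, hfx⟩ := Module.exists_nontrivial_relation_of_finrank_lt_card hlt
    have key : ∀ g : V → ℝ, g x ≠ 0 → 0 ≤ ∑ e ∈ T, g e → ∃ x ∈ T, 0 < g x := by
      intro g hg hs
      by_contra! hc
      have := Finset.sum_eq_zero_iff_of_nonpos hc |>.1 (le_antisymm (Finset.sum_nonpos hc) hs)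
      exact hg (this x hx)
    rcases le_total 0 (∑ e ∈ T, f e) with h | h
    · exact ⟨f, hf, h, key f hfx h⟩
    · have h' : 0 ≤ ∑ e ∈ T, (-f) e := by simpa using h
      exact ⟨-f, by simpa using hf, h', key (-f) (by simpa using hfx) h'⟩
  obtain ⟨x0, hx0, hmin⟩ := (T.filter fun x => 0 < f x).exists_min_image (fun x => w x / f x)
    ⟨x1, by simp [hx1, hfx1]⟩
  simp only [Finset.mem_filter] at hx0 hmin
  obtain ⟨hx0T, hfx0⟩ := hx0
  set t := w x0 / f x0 with ht
  have ht0 : 0 ≤ t := div_nonneg (h0 _ hx0T) hfx0.le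
  have hz : w x0 - t * f x0 = 0 := by rw [ht]; field_simp; simp
  have hlt2 : (T.erase x0).card < Nat.find hex := by
    rw [← hcard]; exact Finset.card_erase_lt_of_mem hx0T
  refine Nat.find_min hex hlt2 ⟨T.erase x0, ⟨?_, fun x => w x - t * f x, ?_, ?_, ?_⟩, rfl⟩
  · exact fun x hx => hTX (Finset.mem_of_mem_erase hx)
  · intro x hx
    have hxT := Finset.mem_of_mem_erase hx
    rcases lt_or_ge 0 (f x) with h | h
    · have := hmin x ⟨hxT, h⟩
      rw [le_div_iff₀ h] at this
      simpa using this
    · have := h0 x hxT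
      nlinarith
  · rw [Finset.sum_erase (f := fun x => w x - t * f x) _ hz, Finset.sum_sub_distrib, ← Finset.mul_sum]
    nlinarith
  · rw [Finset.sum_erase _ (by simp only [hz, zero_smul])]
    simp only [sub_smul, Finset.sum_sub_distrib, mul_smul, ← Finset.smul_sum, hf0, h2]
    simp

theorem center_aux {V : Type*} [NormedAddCommGroup V] [NormedSpace ℝ V] [FiniteDimensional ℝ V]
    (hd : 1 ≤ Module.finrank ℝ V) {P : Set V} (hP : IsCompact P) (hc : Convex ℝ P)
    (hinter : (interior P).Nonempty) :
    ∃ c ∈ interior P, ∀ x, c + x ∈ P → c - ((Module.finrank ℝ V : ℝ)⁻¹) • x ∈ P := by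
  classical
  set d := Module.finrank ℝ V with hdd
  have hdpos : (0 : ℝ) < d := by exact_mod_cast hd
  obtain ⟨p, hp⟩ := hinter
  let X : Set (V × ℝ) := (fun x => (x, (1 : ℝ))) '' P
  have hX : IsCompact X := hP.image (by fun_prop)
  have hspan : ⊤ ≤ Submodule.span ℝ X := by
    have hpX : (p, (1:ℝ)) ∈ Submodule.span ℝ X :=
      Submodule.subset_span ⟨p, interior_subset hp, rfl⟩
    have h1 : ∀ z : V, (z, (0:ℝ)) ∈ Submodule.span ℝ X := by
      intro z
      have hev : ∀ᶠ ε : ℝ in nhds 0, p + ε • z ∈ P := by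
        have : Filter.Tendsto (fun ε : ℝ => p + ε • z) (nhds 0) (nhds p) := by
          have : Continuous (fun ε : ℝ => p + ε • z) := by fun_prop
          simpa using this.tendsto 0
        exact this (mem_interior_iff_mem_nhds.1 hp)
      obtain ⟨ε, hε, hε0⟩ := ((hev.filter_mono nhdsWithin_le_nhds).and
        (self_mem_nhdsWithin : Set.Ioi (0:ℝ) ∈ nhdsWithin 0 (Set.Ioi 0))).exists
      have h2 : (p + ε • z, (1:ℝ)) ∈ Submodule.span ℝ X := Submodule.subset_span ⟨_, hε, rfl⟩
      have h3 := Submodule.smul_mem _ ε⁻¹ (Submodule.sub_mem _ h2 hpX)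
      have hne : ε ≠ 0 := ne_of_gt hε0
      simpa [smul_smul, hne] using h3
    rintro ⟨z, s⟩ -
    have h4 := Submodule.add_mem _ (Submodule.smul_mem _ s hpX) (h1 (z - s • p))
    simpa using h4
  have hfr : Module.finrank ℝ (V × ℝ) = d + 1 := by simp [hdd]
  obtain ⟨b, hbX, hb⟩ := auerbach_aux (Module.finBasisOfFinrankEq ℝ (V × ℝ) hfr) hX hspan
  choose w hwP hw using hbX
  have hrep : ∀ x ∈ P, ∃ β : Fin (d+1) → ℝ, (∀ j, |β j| ≤ 1) ∧ ∑ j, β j = 1 ∧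
      ∑ j, β j • w j = x := by
    intro x hx
    refine ⟨b.repr (x, 1), hb _ ⟨x, hx, rfl⟩, ?_, ?_⟩
    · have := congrArg Prod.snd (b.sum_repr (x, (1:ℝ)))
      simpa [← hw, Prod.snd_sum] using this
    · have := congrArg Prod.fst (b.sum_repr (x, (1:ℝ)))
      simpa [← hw, Prod.fst_sum] using this
  let c : V := ((d : ℝ) + 1)⁻¹ • ∑ j, w j
  have hcprop : ∀ x, c + x ∈ P → c - ((d : ℝ)⁻¹) • x ∈ P := by
    intro x hx
    obtain ⟨β, hβ, hβ1, hβx⟩ := hrep _ hx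
    have hmem := hc.sum_mem (t := Finset.univ) (w := fun j => (d:ℝ)⁻¹ * (1 - β j)) (z := w)
      (fun j _ => mul_nonneg (by positivity) (by linarith [(abs_le.1 (hβ j)).2]))
      (by rw [← Finset.mul_sum, Finset.sum_sub_distrib, hβ1]; simp; field_simp) (fun j _ => hwP j)
    convert hmem using 1
    simp only [mul_smul, ← Finset.smul_sum, sub_smul, Finset.sum_sub_distrib, one_smul, hβx]
    have hs : ∑ j, w j = ((d:ℝ) + 1) • c := by
      simp only [c, smul_smul]; rw [mul_inv_cancel₀ (by positivity), one_smul]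
    rw [hs]
    have : (d:ℝ) ≠ 0 := hdpos.ne'
    rw [show ((d:ℝ) + 1) • c - (c + x) = (d:ℝ) • c - x by module, smul_sub, smul_smul,
      inv_mul_cancel₀ this, one_smul]
  refine ⟨c, ?_, hcprop⟩
  have hq := hcprop (p - c) (by simpa using interior_subset hp)
  refine hc.openSegment_interior_self_subset_interior hp hq ?_
  refine ⟨((d:ℝ)+1)⁻¹, ((d:ℝ)+1)⁻¹ * d, by positivity, by positivity, by field_simp; ring, ?_⟩
  have : (d:ℝ) ≠ 0 := hdpos.ne'
  have h1 : ((d:ℝ)+1) ≠ 0 := by positivity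
  clear_value c
  rw [mul_smul, ← smul_add, smul_sub, smul_smul, mul_inv_cancel₀ this, one_smul,
    show p + ((d:ℝ) • c - (p - c)) = ((d:ℝ) + 1) • c by module, smul_smul, inv_mul_cancel₀ h1,
    one_smul]

theorem core_aux {E ι : Type*} [NormedAddCommGroup E] [InnerProductSpace ℝ E]
    [FiniteDimensional ℝ E] [Finite ι] [Nonempty ι] (hd : 1 ≤ Module.finrank ℝ E)
    (K : ι → Set E) (hK : ∀ i, IsCompact (K i)) (hc : ∀ i, Convex ℝ (K i))
    (h0 : ∀ i, (0 : E) ∈ interior (K i))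
    (hP : ∀ x, (∀ i, x ∈ K i) → ∀ i, -((Module.finrank ℝ E : ℝ)⁻¹ • x) ∈ K i) :
    ∃ S : Finset ι, S.card ≤ 2 * Module.finrank ℝ E ∧ ∀ x, (∀ i ∈ S, x ∈ K i) →
      ∀ i, ((Module.finrank ℝ E : ℝ) * ((Module.finrank ℝ E : ℝ) + 3))⁻¹ • x ∈ K i := by
  classical
  set d := Module.finrank ℝ E with hdd
  have hdpos : (0 : ℝ) < d := by exact_mod_cast hd
  let pol : ι → Set E := fun i => {a | ∀ x ∈ K i, inner ℝ a x ≤ 1}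
  have hpolc : ∀ i, IsCompact (pol i) := by
    intro i
    apply Metric.isCompact_of_isClosed_isBounded
    · have : pol i = ⋂ x ∈ K i, {a | inner ℝ a x ≤ 1} := by ext a; simp [pol]
      rw [this]
      exact isClosed_biInter fun x _ => isClosed_le (by fun_prop) (by fun_prop)
    · obtain ⟨r, hr, hball⟩ := Metric.mem_nhds_iff.1 (mem_interior_iff_mem_nhds.1 (h0 i))
      refine (Metric.isBounded_closedBall (x := (0:E)) (r := 2 / r)).subset fun a ha => ?_
      rw [mem_closedBall_zero_iff]
      by_cases hz : a = 0
      · subst hz; simp; positivity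
      have hn : 0 < ‖a‖ := norm_pos_iff.2 hz
      have hx : (r / 2 / ‖a‖) • a ∈ K i := by
        apply hball
        rw [mem_ball_zero_iff, norm_smul, Real.norm_of_nonneg (by positivity),
          div_mul_cancel₀ _ hn.ne']
        linarith
      have := ha _ hx
      rw [inner_smul_right, real_inner_self_eq_norm_sq] at this
      rw [le_div_iff₀ hr]
      have h2 : r / 2 / ‖a‖ * ‖a‖ ^ 2 = r / 2 * ‖a‖ := by field_simp
      rw [h2] at this
      linarith
  have hbip : ∀ i x, (∀ a ∈ pol i, inner ℝ a x ≤ 1) → x ∈ K i := by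
    intro i x hx
    by_contra hxn
    obtain ⟨f, u, hfu, hux⟩ := geometric_hahn_banach_closed_point (hc i) (hK i).isClosed hxn
    have hu : 0 < u := by simpa using hfu 0 (interior_subset (h0 i))
    have hin : ∀ z, inner ℝ (u⁻¹ • (InnerProductSpace.toDual ℝ E).symm f) z = u⁻¹ * f z := by
      intro z; rw [real_inner_smul_left, InnerProductSpace.toDual_symm_apply]
    have h1 := hx (u⁻¹ • (InnerProductSpace.toDual ℝ E).symm f) (fun z hz => by
      rw [hin, inv_mul_le_iff₀ hu]; linarith [hfu z hz])
    rw [hin, inv_mul_le_iff₀ hu] at h1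
    linarith
  let X : Set E := ⋃ i, pol i
  have hXc : IsCompact X := isCompact_iUnion hpolc
  have hXn : X ∈ nhds (0 : E) := by
    let i0 : ι := Classical.arbitrary ι
    obtain ⟨R, hR, hKR⟩ := (hK i0).isBounded.exists_pos_norm_le
    refine Filter.mem_of_superset (Metric.ball_mem_nhds (0:E) (inv_pos.2 hR)) fun a ha => ?_
    refine Set.mem_iUnion.2 ⟨i0, fun x hx => ?_⟩
    rw [mem_ball_zero_iff] at ha
    calc inner ℝ a x ≤ ‖a‖ * ‖x‖ := real_inner_le_norm _ _
      _ ≤ R⁻¹ * R := by gcongr; exact hKR x hx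
      _ = 1 := inv_mul_cancel₀ hR.ne'
  have hspan : ⊤ ≤ Submodule.span ℝ X := by
    have : Submodule.span ℝ X = ⊤ := Submodule.eq_top_of_nonempty_interior' _
      ⟨0, mem_interior_iff_mem_nhds.2 (Filter.mem_of_superset hXn Submodule.subset_span)⟩
    exact this.ge
  obtain ⟨b, hbX, hb⟩ := auerbach_aux (Module.finBasisOfFinrankEq ℝ E hdd.symm) hXc hspan
  let y : E := -(((d:ℝ) * (d + 1))⁻¹ • ∑ j, b j)
  have hy : y ∈ convexHull ℝ X := by
    by_contra hyn
    have hinter : (0:E) ∈ interior (convexHull ℝ X) :=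
      mem_interior_iff_mem_nhds.2 (Filter.mem_of_superset hXn (subset_convexHull ℝ X))
    obtain ⟨f, hf0, hf⟩ := geometric_hahn_banach_of_nonempty_interior_point
      (convex_convexHull ℝ X) (fun h => hyn (interior_subset h)) ⟨0, hinter⟩
    set g := (InnerProductSpace.toDual ℝ E).symm f with hg
    have hfg : ∀ z, f z = inner ℝ z g := by
      intro z; rw [real_inner_comm, hg, InnerProductSpace.toDual_symm_apply]
    have hpos : 0 < f y := by
      by_contra! hle
      apply hf0
      have hgn : g ≠ 0 := by
        intro h
        apply hf0
        simpa [hg] using h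
      have hev : ∀ᶠ ε : ℝ in nhds 0, ε • g ∈ X := by
        have hc : Continuous (fun ε : ℝ => ε • g) := by fun_prop
        have := hc.tendsto 0
        rw [zero_smul] at this
        exact this hXn
      obtain ⟨ε, hε, hε0⟩ := ((hev.filter_mono nhdsWithin_le_nhds).and
        (self_mem_nhdsWithin : Set.Ioi (0:ℝ) ∈ nhdsWithin 0 (Set.Ioi 0))).exists
      have h1 := hf _ (subset_convexHull ℝ X hε)
      rw [hfg (ε • g), real_inner_smul_left] at h1
      have h2 : 0 < inner ℝ g g := real_inner_self_pos.2 hgn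
      have h3 : 0 < ε * inner ℝ g g := mul_pos hε0 h2
      linarith
    have hmem : ∀ i, (f y)⁻¹ • g ∈ K i := by
      intro i
      refine hbip i _ fun a ha => ?_
      rw [inner_smul_right, ← hfg, inv_mul_le_iff₀ hpos, mul_one]
      exact hf a (subset_convexHull ℝ X (Set.mem_iUnion.2 ⟨i, ha⟩))
    have hneg := hP _ hmem
    have hbj : ∀ j, -(f (b j)) ≤ d * f y := by
      intro j
      obtain ⟨i, hi⟩ := Set.mem_iUnion.1 (hbX j)
      have h1 := hi _ (hneg i)
      rw [inner_neg_right, inner_smul_right, inner_smul_right, ← hfg] at h1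
      have h2 : -((d:ℝ)⁻¹ * ((f y)⁻¹ * f (b j))) = -(f (b j)) / (d * f y) := by
        field_simp
      rw [h2, div_le_one (by positivity)] at h1
      exact h1
    have hfy : f y = ((d:ℝ) * (d + 1))⁻¹ * ∑ j, -(f (b j)) := by
      simp [y]
    have hs : ∑ j, -(f (b j)) ≤ d * (d * f y) := by
      calc ∑ j, -(f (b j)) ≤ ∑ _j : Fin d, d * f y := Finset.sum_le_sum fun j _ => hbj j
        _ = d * (d * f y) := by simp
    rw [eq_inv_mul_iff_mul_eq₀ (by positivity)] at hfy
    have : 0 < d * f y := by positivity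
    nlinarith
  obtain ⟨T, hTX, hTc, w, hw0, hw1, hwy⟩ := cone_carath hy
  have hidx : ∀ a : E, ∃ i, a ∈ X → a ∈ pol i := by
    intro a
    by_cases h : a ∈ X
    · obtain ⟨i, hi⟩ := Set.mem_iUnion.1 h
      exact ⟨i, fun _ => hi⟩
    · exact ⟨Classical.arbitrary ι, fun h' => absurd h' h⟩
  choose idx hidx using hidx
  refine ⟨Finset.univ.image (fun j => idx (b j)) ∪ T.image idx, ?_, ?_⟩
  · refine (Finset.card_union_le _ _).trans ?_
    have h1 : (Finset.univ.image (fun j => idx (b j))).card ≤ d := by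
      simpa using Finset.card_image_le (s := Finset.univ) (f := fun j => idx (b j))
    have h2 : (T.image idx).card ≤ d := Finset.card_image_le.trans hTc
    omega
  · intro x hx i
    have hbx : ∀ j, inner ℝ (b j) x ≤ 1 := fun j =>
      hidx _ (hbX j) x (hx _ (Finset.mem_union_left _ (Finset.mem_image.2 ⟨j, Finset.mem_univ _, rfl⟩)))
    have hTx : ∀ a ∈ T, inner ℝ a x ≤ 1 := fun a ha =>
      hidx _ (hTX ha) x (hx _ (Finset.mem_union_right _ (Finset.mem_image_of_mem _ ha)))
    have hyx : inner ℝ y x ≤ 1 := by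
      rw [← hwy, sum_inner]
      refine le_trans (Finset.sum_le_sum fun a ha => ?_) hw1
      rw [real_inner_smul_left]
      nlinarith [hw0 a ha, hTx a ha]
    have hsum : -(∑ j, inner ℝ (b j) x) ≤ d * (d + 1) := by
      have : inner ℝ y x = ((d:ℝ) * (d + 1))⁻¹ * -(∑ j, inner ℝ (b j) x) := by
        simp [y, inner_neg_left, real_inner_smul_left, sum_inner]
      rw [this, inv_mul_le_iff₀ (by positivity)] at hyx
      linarith
    refine hbip i _ fun a ha => ?_
    have haX : a ∈ X := Set.mem_iUnion.2 ⟨i, ha⟩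
    rw [inner_smul_right, inv_mul_le_iff₀ (by positivity), mul_one]
    have hax : inner ℝ a x = ∑ j, b.repr a j * inner ℝ (b j) x := by
      conv_lhs => rw [← b.sum_repr a, sum_inner]
      simp [real_inner_smul_left]
    have hterm : ∑ j, (b.repr a j + 1) * inner ℝ (b j) x ≤ ∑ _j : Fin d, (2:ℝ) := by
      refine Finset.sum_le_sum fun j _ => ?_
      have := abs_le.1 (hb a haX j)
      nlinarith [hbx j]
    simp only [add_mul, one_mul, Finset.sum_add_distrib, Finset.sum_const, Finset.card_univ,
      Fintype.card_fin, nsmul_eq_mul] at hterm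
    rw [hax]
    nlinarith

theorem dim_one_aux {E ι : Type*} [NormedAddCommGroup E] [NormedSpace ℝ E]
    [Finite ι] [Nonempty ι] (e : E ≃L[ℝ] ℝ)
    (K : ι → Set E) (hK : ∀ i, IsCompact (K i)) (hc : ∀ i, Convex ℝ (K i))
    (hne : ∀ i, (K i).Nonempty) :
    ∃ S : Finset ι, S.card ≤ 2 ∧ ∀ x, (∀ i ∈ S, x ∈ K i) → ∀ i, x ∈ K i := by
  classical
  have hmin : ∀ i, ∃ p ∈ K i, ∀ x ∈ K i, e p ≤ e x := fun i =>
    (hK i).exists_isMinOn (hne i) e.continuous.continuousOn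
  have hmax : ∀ i, ∃ p ∈ K i, ∀ x ∈ K i, e x ≤ e p := fun i =>
    (hK i).exists_isMaxOn (hne i) e.continuous.continuousOn
  choose p hp hpm using hmin
  choose q hq hqm using hmax
  obtain ⟨i0, hi0⟩ := Finite.exists_max fun i => e (p i)
  obtain ⟨j0, hj0⟩ := Finite.exists_min fun i => e (q i)
  refine ⟨{i0, j0}, Finset.card_le_two, fun x hx i => ?_⟩
  have h1 : e (p i) ≤ e x := (hi0 i).trans (hpm i0 x (hx _ (by simp)))
  have h2 : e x ≤ e (q i) := (hqm j0 x (hx _ (by simp))).trans (hj0 i)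
  have hconv : Convex ℝ (e '' K i) := (hc i).linear_image (e : E →ₗ[ℝ] ℝ)
  obtain ⟨z, hz, hzx⟩ := hconv.ordConnected.out ⟨p i, hp i, rfl⟩ ⟨q i, hq i, rfl⟩ ⟨h1, h2⟩
  rwa [← e.injective hzx]

theorem convex_interior_aux {E : Type*} [NormedAddCommGroup E] [InnerProductSpace ℝ E]
    [FiniteDimensional ℝ E] [MeasurableSpace E] [BorelSpace E] {s : Set E} (hs : Convex ℝ s)
    (h : volume s ≠ 0) : (interior s).Nonempty := by
  rw [hs.interior_nonempty_iff_affineSpan_eq_top]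
  by_contra hne
  exact h (measure_mono_null (subset_affineSpan ℝ s) (Measure.addHaar_affineSubspace volume _ hne))

open scoped Pointwise in
theorem compact_case (d n : ℕ) (hd : 1 ≤ d) (hn : 2 * d ≤ n)
    (K : Fin n → Set (EuclideanSpace ℝ (Fin d)))
    (hconv : ∀ i, Convex ℝ (K i)) (hcomp : ∀ i, IsCompact (K i)) (c : ENNReal) (hc : 0 < c)
    (hvol : ∀ S : Finset (Fin n), S.card = 2 * d → c ≤ volume (⋂ i ∈ S, K i)) :
    c ≤ (d : ENNReal) ^ (2 * d ^ 2) * volume (⋂ i, K i) := by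
  classical
  have hfr : Module.finrank ℝ (EuclideanSpace ℝ (Fin d)) = d := by simp
  have : Nonempty (Fin n) := ⟨⟨0, by omega⟩⟩
  have hvol' : ∀ S : Finset (Fin n), S.card ≤ 2 * d → c ≤ volume (⋂ i ∈ S, K i) := by
    intro S hS
    obtain ⟨T, hST, hT⟩ := Finset.exists_superset_card_eq hS (by simpa using hn)
    exact (hvol T hT).trans (measure_mono (Set.biInter_subset_biInter_left hST))
  have hintS : ∀ S : Finset (Fin n), S.card ≤ 2 * d → (⋂ i ∈ S, interior (K i)).Nonempty := by
    intro S hS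
    have h1 := convex_interior_aux (convex_iInter₂ fun i (_ : i ∈ S) => hconv i)
      (hc.trans_le (hvol' S hS)).ne'
    obtain ⟨x, hx⟩ := h1
    refine ⟨x, Set.mem_iInter₂.2 fun i hi => ?_⟩
    exact interior_mono (Set.biInter_subset_of_mem hi) hx
  rcases hd.eq_or_lt with h1 | h2
  · subst h1
    let e : EuclideanSpace ℝ (Fin 1) ≃L[ℝ] ℝ := ContinuousLinearEquiv.ofFinrankEq (by simp)
    obtain ⟨S, hS, hSK⟩ := dim_one_aux e K hcomp hconv (fun i => by
      obtain ⟨x, hx⟩ := hintS {i} (by simp)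
      exact ⟨x, interior_subset (by simpa using hx)⟩)
    have := hvol' S (by omega)
    simp only [Nat.cast_one, one_pow, one_mul]
    refine this.trans (measure_mono fun x hx => ?_)
    simp only [Set.mem_iInter] at hx ⊢
    exact hSK x hx
  · have hP : IsCompact (⋂ i, K i) := by
      refine (hcomp ⟨0, by omega⟩).of_isClosed_subset
        (isClosed_iInter fun i => (hcomp i).isClosed) (Set.iInter_subset _ _)
    have hPc : Convex ℝ (⋂ i, K i) := convex_iInter hconv
    have hPint : (interior (⋂ i, K i)).Nonempty := by
      rw [interior_iInter_of_finite]
      have := Convex.helly_theorem (𝕜 := ℝ) (F := fun i => interior (K i)) (s := Finset.univ)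
        (by simp; omega) (fun i _ => (hconv i).interior)
        (fun I _ hI => hintS I (by rw [hI, hfr]; omega))
      simpa using this
    obtain ⟨z, hz, hzP⟩ := center_aux (by rw [hfr]; exact hd) hP hPc hPint
    obtain ⟨S, hS, hSK⟩ := core_aux (by rw [hfr]; exact hd) (fun i => (fun x => z + x) ⁻¹' K i)
      (fun i => (Homeomorph.addLeft z).isCompact_preimage.2 (hcomp i))
      (fun i => (hconv i).translate_preimage_right z)
      (fun i => by
        have h3 : interior ((Homeomorph.addLeft z) ⁻¹' K i) = _ :=
          ((Homeomorph.addLeft z).preimage_interior (K i)).symm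
        change (0 : EuclideanSpace ℝ (Fin d)) ∈ interior ((Homeomorph.addLeft z) ⁻¹' K i)
        rw [h3]
        simpa using interior_mono (Set.iInter_subset K i) hz)
      (fun x hx i => by
        have := hzP x (Set.mem_iInter.2 hx)
        have := Set.mem_iInter.1 this i
        simpa [sub_eq_add_neg] using this)
    rw [hfr] at hS hSK
    have hd0 : (0:ℝ) < d := by exact_mod_cast hd
    set m : ℝ := (d:ℝ) * ((d:ℝ) + 3) with hm
    have hmpos : 0 < m := by positivity
    have hsub : (fun x => z + x) ⁻¹' (⋂ i ∈ S, K i) ⊆ m • ((fun x => z + x) ⁻¹' (⋂ i, K i)) := by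
      intro x hx
      rw [Set.mem_smul_set_iff_inv_smul_mem₀ hmpos.ne']
      simp only [Set.mem_preimage, Set.mem_iInter] at hx ⊢
      exact hSK x hx
    have h4 := measure_mono (μ := volume) hsub
    rw [measure_preimage_add, Measure.addHaar_smul, measure_preimage_add, hfr] at h4
    refine (hvol' S hS).trans (h4.trans ?_)
    gcongr
    rw [abs_of_nonneg (by positivity)]
    have hle : m ≤ (d:ℝ) ^ (2 * d) := by
      have h2' : (2:ℝ) ≤ d := by exact_mod_cast h2
      calc m ≤ (d:ℝ) ^ 4 := by
            rw [hm, show (d:ℝ) ^ 4 = d * d ^ 3 by ring]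
            gcongr
            nlinarith [mul_nonneg (sub_nonneg.2 h2') (sub_nonneg.2 h2'), mul_pos hd0 hd0]
        _ ≤ (d:ℝ) ^ (2 * d) := pow_le_pow_right₀ (by linarith) (by omega)
    calc ENNReal.ofReal (m ^ d) ≤ ENNReal.ofReal (((d:ℝ) ^ (2 * d)) ^ d) := by gcongr
      _ = (d : ENNReal) ^ (2 * d ^ 2) := by
        rw [← pow_mul, ENNReal.ofReal_pow hd0.le, ENNReal.ofReal_natCast]
        congr 1; ring

/-- **Helly's theorem with volume** (Bárány–Katchalski–Pach). If every `2d` members of a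
finite family of at least `2d` convex sets in `ℝ^d` have an intersection of volume at
least `1`, then the intersection of the whole family has volume at least `d^{-2d²}`. -/
theorem helly_with_volume (d n : ℕ) (hd : 1 ≤ d) (hn : 2 * d ≤ n)
    (K : Fin n → Set (EuclideanSpace ℝ (Fin d)))
    (hconv : ∀ i, Convex ℝ (K i))
    (hvol : ∀ S : Finset (Fin n), S.card = 2 * d → 1 ≤ volume (⋂ i ∈ S, K i)) :
    ((d : ENNReal) ^ (2 * d ^ 2))⁻¹ ≤ volume (⋂ i, K i) := by
  classical
  have hcl : volume (⋂ i, closure (K i)) ≤ volume (⋂ i, K i) := by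
    have hsub : (⋂ i, closure (K i)) ⊆ (⋂ i, K i) ∪ ⋃ i, frontier (K i) := by
      intro x hx
      by_cases h : x ∈ ⋂ i, K i
      · exact Or.inl h
      · right
        simp only [Set.mem_iInter, not_forall] at h hx
        obtain ⟨i, hi⟩ := h
        exact Set.mem_iUnion.2 ⟨i, hx i, fun h' => hi (interior_subset h')⟩
    have hnull : volume (⋃ i, frontier (K i)) = 0 :=
      measure_iUnion_null fun i => (hconv i).addHaar_frontier volume
    calc volume (⋂ i, closure (K i)) ≤ _ := measure_mono hsub
      _ ≤ _ := measure_union_le _ _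
      _ = volume (⋂ i, K i) := by rw [hnull, add_zero]
  refine le_trans ?_ hcl
  rw [ENNReal.inv_le_iff_le_mul (by simp) (by simp)]
  refine le_of_forall_lt_imp_le_of_dense fun c hc => ?_
  rcases eq_zero_or_pos c with h0 | h0
  · rw [h0]; exact zero_le
  have hev : ∀ S : Finset (Fin n), S.card = 2 * d → ∀ᶠ N : ℕ in Filter.atTop,
      c ≤ volume (⋂ i ∈ S, closure (K i) ∩ Metric.closedBall 0 N) := by
    intro S hS
    have hmono : Monotone fun N : ℕ => (⋂ i ∈ S, K i) ∩ Metric.closedBall 0 (N : ℝ) := by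
      intro a b hab
      exact Set.inter_subset_inter_right _ (Metric.closedBall_subset_closedBall (by exact_mod_cast hab))
    have ht := tendsto_measure_iUnion_atTop (μ := volume) hmono
    rw [← Set.inter_iUnion, Metric.iUnion_closedBall_nat, Set.inter_univ] at ht
    filter_upwards [ht.eventually (lt_mem_nhds (hc.trans_le (hvol S hS)))] with N hN
    refine hN.le.trans (measure_mono ?_)
    rintro x ⟨hx, hxN⟩
    simp only [Set.mem_iInter] at hx ⊢
    exact fun i hi => ⟨subset_closure (hx i hi), hxN⟩
  have hall : ∀ᶠ N : ℕ in Filter.atTop, ∀ S : Finset (Fin n), S.card = 2 * d →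
      c ≤ volume (⋂ i ∈ S, closure (K i) ∩ Metric.closedBall 0 N) := by
    rw [Filter.eventually_all]
    intro S
    by_cases hS : S.card = 2 * d
    · filter_upwards [hev S hS] with N hN _ using hN
    · exact Filter.Eventually.of_forall fun N h => absurd h hS
  obtain ⟨N, hN⟩ := hall.exists
  refine (compact_case d n hd hn _
    (fun i => (hconv i).closure.inter (convex_closedBall 0 (N:ℝ)))
    (fun i => (isCompact_closedBall (0 : EuclideanSpace ℝ (Fin d)) (N:ℝ)).inter_left isClosed_closure)
    c h0 hN).trans ?_
  gcongr
  exact Set.inter_subset_left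
end
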